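/- The centred complete pin class P° (the class of all centred pin permutations) has generating function f(z) = (1−z)²(1−2z) / (1 − 8z + 19z² − 26z³ + 14z⁴ − 12z⁵ − 8z⁶ + 20z⁷ − 8z⁸), and its growth rate ω_∞ ≈ 5.24112 is the reciprocal of the smallest positive real root of the denominator. -/

import Mathlib

/-- A *centred permutation*: `vals` is the one-line notation of the filled-in
permutation (length `n+1`), `origin` the index of the origin point. -/
structure CPerm where
  vals : List ℕ
  origin : ℕ
deriving DecidableEq

namespace CPerm

/-- Length of a centred permutation (origin does not count). -/
def len (p : CPerm) : ℕ := p.vals.length - 1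

/-- A genuine centred permutation: one-line notation is a permutation of
`{0, …, N-1}` and the origin index is in range. -/
def IsValid (p : CPerm) : Prop :=
  p.vals ≠ [] ∧ p.origin < p.vals.length ∧ p.vals.Perm (List.range p.vals.length)

def valAt (p : CPerm) (i : ℕ) : ℕ := p.vals.getD i 0

def originVal (p : CPerm) : ℕ := p.valAt p.origin

/-- The box-sum `p ⊞ q`: inflate the origin of `q` by a copy of `p`. -/
def boxSum (p q : CPerm) : CPerm :=
  let N := p.vals.length
  let v := q.originVal
  let shift : ℕ → ℕ := fun u => if u < v then u else u + (N - 1)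
  ⟨(q.vals.take q.origin).map shift ++ p.vals.map (· + v) ++
      (q.vals.drop (q.origin + 1)).map shift,
    q.origin + p.origin⟩

/-- The trivial centred permutation (origin only, length 0). -/
def trivial : CPerm := ⟨[0], 0⟩

/-- Iterated box-sum `σ₁ ⊞ σ₂ ⊞ ⋯ ⊞ σₙ`. -/
def boxSumList (l : List CPerm) : CPerm := l.foldr boxSum trivial

/-- `p` is ⊞-indecomposable: nonempty and not a box-sum of two strictly smaller
centred permutations. -/
def BoxIndecomposable (p : CPerm) : Prop :=
  1 ≤ p.len ∧
    ¬∃ a b : CPerm, a.IsValid ∧ b.IsValid ∧ 1 ≤ a.len ∧ 1 ≤ b.len ∧ boxSum a b = p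

/-- The non-origin point at index `i` of `p` lies in quadrant `q` (1–4,
numbered anticlockwise). -/
def InQuadrant (p : CPerm) (q : ℕ) (i : ℕ) : Prop :=
  i < p.vals.length ∧ i ≠ p.origin ∧
    ((q = 1 ∧ p.origin < i ∧ p.originVal < p.valAt i) ∨
     (q = 2 ∧ i < p.origin ∧ p.originVal < p.valAt i) ∨
     (q = 3 ∧ i < p.origin ∧ p.valAt i < p.originVal) ∨
     (q = 4 ∧ p.origin < i ∧ p.valAt i < p.originVal))

/-- All non-origin points of `p` lie in quadrant `q`. -/
def OneQuadrant (p : CPerm) (q : ℕ) : Prop :=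
  ∀ i, i < p.vals.length → i ≠ p.origin → InQuadrant p q i

def OppositeQuadrants (q₁ q₂ : ℕ) : Prop :=
  (q₁ = 1 ∧ q₂ = 3) ∨ (q₁ = 3 ∧ q₂ = 1) ∨ (q₁ = 2 ∧ q₂ = 4) ∨ (q₁ = 4 ∧ q₂ = 2)

/-- Centred pattern containment `p ≤ q` (origins must match up). -/
def PatternLE (p q : CPerm) : Prop :=
  ∃ f : ℕ → ℕ,
    (∀ i j, i < p.vals.length → j < p.vals.length → i < j → f i < f j) ∧
    (∀ i, i < p.vals.length → f i < q.vals.length) ∧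
    f p.origin = q.origin ∧
    (∀ i j, i < p.vals.length → j < p.vals.length →
      (p.valAt i < p.valAt j ↔ q.valAt (f i) < q.valAt (f j)))

/-- A centred permutation class: nonempty, consisting of valid centred
permutations, and downward closed under centred containment. -/
def IsClass (S : Set CPerm) : Prop :=
  S.Nonempty ∧ (∀ p ∈ S, p.IsValid) ∧
    ∀ p q : CPerm, q ∈ S → p.IsValid → PatternLE p q → p ∈ S

/-- `S` is closed under the box-sum. -/
def BoxClosed (S : Set CPerm) : Prop := ∀ p ∈ S, ∀ q ∈ S, boxSum p q ∈ S

/-- Number of centred permutations of length `n` in `S`. -/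
noncomputable def count (S : Set CPerm) (n : ℕ) : ℕ := {p | p ∈ S ∧ p.len = n}.ncard

/-- The single-point centred permutation in quadrant `q`. -/
def mu : ℕ → CPerm
  | 1 => ⟨[0, 1], 0⟩
  | 2 => ⟨[1, 0], 1⟩
  | 3 => ⟨[0, 1], 1⟩
  | 4 => ⟨[1, 0], 0⟩
  | _ => ⟨[0], 0⟩

def AdjacentQuadrants (a b : ℕ) : Prop :=
  (a, b) = (1, 2) ∨ (a, b) = (2, 3) ∨ (a, b) = (3, 4) ∨ (a, b) = (4, 1) ∨
  (a, b) = (2, 1) ∨ (a, b) = (3, 2) ∨ (a, b) = (4, 3) ∨ (a, b) = (1, 4)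

/-- The adjacency condition on a centred class. -/
def AdjacencyCondition (S : Set CPerm) : Prop :=
  (∃! q : ℕ, q ∈ ({1, 2, 3, 4} : Set ℕ) ∧ mu q ∈ S) ∨
    ∃ a b : ℕ, AdjacentQuadrants a b ∧ mu a ∈ S ∧ mu b ∈ S

end CPerm

inductive PinLetter | u | d | l | r
deriving DecidableEq

def PinLetter.isVert : PinLetter → Bool
  | .u => true
  | .d => true
  | .l => false
  | .r => false

/-- Letters strictly alternate between vertical and horizontal alignment. -/
def PinAlt (ls : List PinLetter) : Prop :=
  List.Chain' (fun a b => a.isVert ≠ b.isVert) ls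

/-- A pin word: an initial numeral `q ∈ {1,…,4}` followed by alternating letters. -/
def IsPinWord (q : ℕ) (ls : List PinLetter) : Prop := 1 ≤ q ∧ q ≤ 4 ∧ PinAlt ls

def firstPt : ℕ → ℚ × ℚ
  | 1 => (1, 1)
  | 2 => (-1, 1)
  | 3 => (-1, -1)
  | 4 => (1, -1)
  | _ => (1, 1)

def maxOf (l : List ℚ) : ℚ := l.foldr max 0
def minOf (l : List ℚ) : ℚ := l.foldr min 0

/-- Place the next pin: beyond the bounding rectangle in the given direction,
separating the previous point from all the others. The list holds the points
newest-first; the origin `(0,0)` is the last entry. -/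
def pinStep (pts : List (ℚ × ℚ)) (dir : PinLetter) : List (ℚ × ℚ) :=
  let last := pts.headD (0, 0)
  let rest := pts.tail
  let btwY : ℚ :=
    if maxOf (rest.map Prod.snd) < last.2 then (last.2 + maxOf (rest.map Prod.snd)) / 2
    else (last.2 + minOf (rest.map Prod.snd)) / 2
  let btwX : ℚ :=
    if maxOf (rest.map Prod.fst) < last.1 then (last.1 + maxOf (rest.map Prod.fst)) / 2
    else (last.1 + minOf (rest.map Prod.fst)) / 2
  let np : ℚ × ℚ :=
    match dir with
    | .r => (maxOf (pts.map Prod.fst) + 1, btwY)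
    | .l => (minOf (pts.map Prod.fst) - 1, btwY)
    | .u => (btwX, maxOf (pts.map Prod.snd) + 1)
    | .d => (btwX, minOf (pts.map Prod.snd) - 1)
  np :: pts

/-- The points (newest first, origin last) drawn from a pin word. -/
def pinPts (q : ℕ) (ls : List PinLetter) : List (ℚ × ℚ) :=
  ls.foldl pinStep [firstPt q, (0, 0)]

/-- Convert a finite set of plane points (with origin `(0,0)`) into a centred
permutation in canonical form. -/
def toCPerm (pts : List (ℚ × ℚ)) : CPerm :=
  ⟨(pts.mergeSort (fun a b => decide (a.1 ≤ b.1))).map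
      (fun pt => ((pts.map Prod.snd).filter (fun y => decide (y < pt.2))).length),
    ((pts.map Prod.fst).filter (fun x => decide (x < 0))).length⟩

/-- The centred pin permutation of a pin word. -/
def pinPerm (q : ℕ) (ls : List PinLetter) : CPerm := toCPerm (pinPts q ls)

/-- The complete pin class `P°`: the downward closure of all box-sums of
centred pin permutations. -/
def CompletePinClass : Set CPerm :=
  {p | p.IsValid ∧
    ∃ ws : List (ℕ × List PinLetter), (∀ w ∈ ws, IsPinWord w.1 w.2) ∧
      CPerm.PatternLE p (CPerm.boxSumList (ws.map fun w => pinPerm w.1 w.2))}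

/-- An infinite pin sequence: numeral `q` and letters `f 0, f 1, …`,
alternating in alignment. -/
def IsPinSeq (q : ℕ) (f : ℕ → PinLetter) : Prop :=
  1 ≤ q ∧ q ≤ 4 ∧ ∀ n, (f n).isVert ≠ (f (n + 1)).isVert

def seqPrefix (f : ℕ → PinLetter) (n : ℕ) : List PinLetter := (List.range n).map f

/-- The pin class of an infinite pin sequence. -/
def PinClassOf (q : ℕ) (f : ℕ → PinLetter) : Set CPerm :=
  {p | p.IsValid ∧ ∃ n : ℕ, CPerm.PatternLE p (pinPerm q (seqPrefix f n))}

/-- The `i`-th point (`i ≥ 1`) placed when drawing the pin sequence. -/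
def seqPoint (q : ℕ) (f : ℕ → PinLetter) (i : ℕ) : ℚ × ℚ :=
  (pinPts q (seqPrefix f (i - 1))).headD (0, 0)

/-- The quadrant of a plane point. -/
def quadOf (pt : ℚ × ℚ) : ℕ :=
  if 0 < pt.1 then (if 0 < pt.2 then 1 else 4) else (if 0 < pt.2 then 2 else 3)

/-- The pin word `w` is the pin factor of the sequence starting at position `i ≥ 1`
(first letter replaced by the quadrant of the corresponding point). -/
def FactorAt (q : ℕ) (f : ℕ → PinLetter) (i : ℕ) (w : ℕ × List PinLetter) : Prop :=
  1 ≤ i ∧ w.1 = quadOf (seqPoint q f i) ∧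
    ∀ t, t < w.2.length → w.2.getD t PinLetter.u = f (i - 1 + t)

/-- A recurrent pin factor: one occurring arbitrarily late. -/
def RecurrentFactor (q : ℕ) (f : ℕ → PinLetter) (w : ℕ × List PinLetter) : Prop :=
  ∀ N : ℕ, ∃ i, N ≤ i ∧ FactorAt q f i w

/-- The ⊞-interior of a pin class: the ⊞-closure (as a class) of the
permutations generated by recurrent pin factors. -/
def BoxInterior (q : ℕ) (f : ℕ → PinLetter) : Set CPerm :=
  {p | p.IsValid ∧
    ∃ l : List CPerm,
      (∀ x ∈ l, ∃ w : ℕ × List PinLetter, RecurrentFactor q f w ∧ x = pinPerm w.1 w.2) ∧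
      CPerm.PatternLE p (CPerm.boxSumList l)}

namespace PinAux
open PinLetter Set

/-- The opposite direction. -/
def opp : PinLetter → PinLetter
  | .u => .d
  | .d => .u
  | .l => .r
  | .r => .l

/-- Height of a plane point along a ray. -/
def ht {K : Type*} [Neg K] (c : PinLetter) (z : K × K) : K :=
  match c with
  | .u => z.2
  | .d => -z.2
  | .l => -z.1
  | .r => z.1

/-- Order equivalence of two labelled configurations of points. -/
def OE {ι K K' : Type*} [Neg K] [Zero K] [LT K] [Neg K'] [Zero K'] [LT K']
    (s : Set ι) (f : ι → K × K) (g : ι → K' × K') : Prop :=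
  ∀ i ∈ s, ∀ c, (0 < ht c (f i) ↔ 0 < ht c (g i)) ∧
    ∀ j ∈ s, (ht c (f i) < ht c (f j) ↔ ht c (g i) < ht c (g j))

/-- Canonical plane point of index `k` of a centred permutation. -/
def cpt (p : CPerm) (k : ℕ) : ℤ × ℤ :=
  ((k : ℤ) - p.origin, (p.valAt k : ℤ) - p.originVal)

/-- Indices of non-origin points. -/
def idx (p : CPerm) : Set ℕ := {k | k < p.vals.length ∧ k ≠ p.origin}

def Models {ι : Type*} (p : CPerm) (s : Set ι) (f : ι → ℤ × ℤ) : Prop :=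
  p.IsValid ∧ ∃ e : ι → ℕ, BijOn e s (idx p) ∧ OE s f (fun i => cpt p (e i))

def Good {ι : Type*} (s : Set ι) (f : ι → ℤ × ℤ) : Prop :=
  ∀ i ∈ s, ∀ c, ht c (f i) ≠ 0 ∧ ∀ j ∈ s, j ≠ i → ht c (f j) ≠ ht c (f i)

/-- Every point of `s` precedes every point of `t` on every common ray. -/
def Before {ι : Type*} (f : ι → ℤ × ℤ) (s t : Set ι) : Prop :=
  ∀ i ∈ s, ∀ j ∈ t, ∀ c, 0 < ht c (f i) → 0 < ht c (f j) → ht c (f i) < ht c (f j)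

section basics
variable {ι κ : Type*}

theorem OE.symm {K K' : Type*} [Neg K] [Zero K] [LT K] [Neg K'] [Zero K'] [LT K']
    {s : Set ι} {f : ι → K × K} {g : ι → K' × K'} (h : OE s f g) : OE s g f :=
  fun i hi c => ⟨(h i hi c).1.symm, fun j hj => ((h i hi c).2 j hj).symm⟩

theorem OE.trans {K K' K'' : Type*} [Neg K] [Zero K] [LT K] [Neg K'] [Zero K'] [LT K']
    [Neg K''] [Zero K''] [LT K'']
    {s : Set ι} {f : ι → K × K} {g : ι → K' × K'} {k : ι → K'' × K''}
    (h : OE s f g) (h' : OE s g k) : OE s f k :=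
  fun i hi c => ⟨(h i hi c).1.trans (h' i hi c).1,
    fun j hj => ((h i hi c).2 j hj).trans ((h' i hi c).2 j hj)⟩

theorem OE.mono {K K' : Type*} [Neg K] [Zero K] [LT K] [Neg K'] [Zero K'] [LT K']
    {s t : Set ι} {f : ι → K × K} {g : ι → K' × K'} (h : OE s f g) (hts : t ⊆ s) : OE t f g :=
  fun i hi c => ⟨(h i (hts hi) c).1, fun j hj => (h i (hts hi) c).2 j (hts hj)⟩

theorem valid_iff (p : CPerm) : p.IsValid ↔ 0 < p.vals.length ∧ p.origin < p.vals.length ∧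
    p.vals.Nodup ∧ ∀ v ∈ p.vals, v < p.vals.length := by
  unfold CPerm.IsValid
  constructor
  · rintro ⟨h1, h2, h3⟩
    refine ⟨List.length_pos_iff.2 h1, h2, h3.nodup_iff.2 List.nodup_range, fun v hv => ?_⟩
    exact List.mem_range.1 (h3.mem_iff.1 hv)
  · rintro ⟨h1, h2, h3, h4⟩
    refine ⟨List.length_pos_iff.1 h1, h2, ?_⟩
    have hs : p.vals ⊆ List.range p.vals.length := fun v hv => List.mem_range.2 (h4 v hv)
    exact (List.subperm_of_subset h3 hs).perm_of_length_le (by simp)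

theorem valAt_eq (p : CPerm) {k : ℕ} (h : k < p.vals.length) : p.valAt k = p.vals[k] := by
  simp [CPerm.valAt, h]

theorem valAt_inj {p : CPerm} (hp : p.IsValid) {j k : ℕ} (hj : j < p.vals.length)
    (hk : k < p.vals.length) (h : p.valAt j = p.valAt k) : j = k := by
  rw [valAt_eq p hj, valAt_eq p hk] at h
  exact (List.Nodup.getElem_inj_iff ((valid_iff p).1 hp).2.2.1).1 h

theorem valAt_lt {p : CPerm} (hp : p.IsValid) {j : ℕ} (hj : j < p.vals.length) :
    p.valAt j < p.vals.length := by
  rw [valAt_eq p hj]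
  exact ((valid_iff p).1 hp).2.2.2 _ (List.getElem_mem _)

theorem valAt_surj {p : CPerm} (hp : p.IsValid) {v : ℕ} (hv : v < p.vals.length) :
    ∃ k < p.vals.length, p.valAt k = v := by
  have : v ∈ p.vals := hp.2.2.mem_iff.2 (List.mem_range.2 hv)
  obtain ⟨k, hk, h⟩ := List.mem_iff_getElem.1 this
  exact ⟨k, hk, by rw [valAt_eq p hk, h]⟩

theorem models_self {p : CPerm} (hp : p.IsValid) : Models p (idx p) (cpt p) :=
  ⟨hp, id, bijOn_id _, fun _ _ _ => ⟨Iff.rfl, fun _ _ => Iff.rfl⟩⟩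

theorem Models.congr {p : CPerm} {s : Set ι} {f g : ι → ℤ × ℤ} (h : Models p s f)
    (hfg : OE s f g) : Models p s g := by
  obtain ⟨hp, e, he, ho⟩ := h
  exact ⟨hp, e, he, hfg.symm.trans ho⟩

theorem Models.map {p : CPerm} {s : Set ι} {t : Set κ} {f : ι → ℤ × ℤ} {g : κ → ℤ × ℤ}
    (h : Models p t g) {τ : ι → κ} (hτ : BijOn τ s t) (hfg : OE s f (fun i => g (τ i))) :
    Models p s f := by
  obtain ⟨hp, e, he, ho⟩ := h
  refine ⟨hp, e ∘ τ, he.comp hτ, hfg.trans ?_⟩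
  intro i hi c
  exact ⟨(ho _ (hτ.mapsTo hi) c).1, fun j hj => (ho _ (hτ.mapsTo hi) c).2 _ (hτ.mapsTo hj)⟩

theorem bij_symm [Nonempty ι] {s : Set ι} {t : Set κ} {e : ι → κ} (h : BijOn e s t) :
    BijOn (Function.invFunOn e s) t s ∧ (∀ i ∈ s, Function.invFunOn e s (e i) = i) ∧
      ∀ k ∈ t, e (Function.invFunOn e s k) = k := by
  have h1 := h.invOn_invFunOn
  exact ⟨h.symm h1.symm, h1.1, h1.2⟩

theorem Models.iso [Nonempty κ] {p : CPerm} {s : Set ι} {t : Set κ} {f : ι → ℤ × ℤ} {g : κ → ℤ × ℤ}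
    (h : Models p s f) (h' : Models p t g) :
    ∃ τ : ι → κ, BijOn τ s t ∧ OE s f (fun i => g (τ i)) := by
  obtain ⟨hp, e, he, ho⟩ := h
  obtain ⟨_, e', he', ho'⟩ := h'
  · obtain ⟨h1, h2, h3⟩ := bij_symm he'
    refine ⟨Function.invFunOn e' t ∘ e, h1.comp he, ho.trans ?_⟩
    intro i hi c
    have hi' := h1.mapsTo (he.mapsTo hi)
    have e1 := h3 _ (he.mapsTo hi)
    have := ho' _ hi' c
    simp only [Function.comp, e1] at this ⊢
    refine ⟨this.1.symm, fun j hj => ?_⟩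
    have e2 := h3 _ (he.mapsTo hj)
    have := this.2 _ (h1.mapsTo (he.mapsTo hj))
    simp only [e2] at this
    exact this.symm

end basics
end PinAux

namespace PinAux
open PinLetter Set

section basics
variable {ι κ : Type*}

def ext (f : ι → ℤ × ℤ) : Option ι → ℤ × ℤ
  | none => (0, 0)
  | some i => f i

def extSet (s : Set ι) : Set (Option ι) := insert none (some '' s)

theorem Models.ext {p : CPerm} {s : Set ι} {f : ι → ℤ × ℤ} (h : Models p s f) :
    ∃ E : Option ι → ℕ, BijOn E (extSet s) (Iio p.vals.length) ∧ E none = p.origin ∧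
      ∀ a ∈ extSet s, ∀ b ∈ extSet s,
        ((ext f a).1 < (ext f b).1 ↔ E a < E b) ∧
        ((ext f a).2 < (ext f b).2 ↔ p.valAt (E a) < p.valAt (E b)) := by
  obtain ⟨hp, e, he, ho⟩ := h
  have hol := hp.2.1
  refine ⟨fun a => a.elim p.origin e, ⟨?_, ?_, ?_⟩, rfl, ?_⟩
  · rintro a (rfl | ⟨i, hi, rfl⟩)
    · exact hol
    · exact (he.mapsTo hi).1
  · rintro a (rfl | ⟨i, hi, rfl⟩) b (rfl | ⟨j, hj, rfl⟩) hab
    · rfl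
    · exact absurd hab.symm (he.mapsTo hj).2
    · exact absurd hab (he.mapsTo hi).2
    · exact congrArg some (he.injOn hi hj hab)
  · intro k hk
    by_cases hko : k = p.origin
    · exact ⟨none, Or.inl rfl, hko.symm⟩
    · obtain ⟨i, hi, h⟩ := he.surjOn (show k ∈ idx p from ⟨hk, hko⟩)
      exact ⟨some i, Or.inr ⟨i, hi, rfl⟩, h⟩
  · rintro a (rfl | ⟨i, hi, rfl⟩) b (rfl | ⟨j, hj, rfl⟩)
    · simp [PinAux.ext]
    · have h1 := (ho j hj .r).1
      have h2 := (ho j hj .u).1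
      simp only [ht, cpt] at h1 h2
      simp only [PinAux.ext, Option.elim, h1, h2, CPerm.originVal]
      omega
    · have h1 := (ho i hi .l).1
      have h2 := (ho i hi .d).1
      simp only [ht, cpt, neg_sub, sub_pos, Nat.cast_lt, Left.neg_pos_iff] at h1 h2
      simp only [PinAux.ext, Option.elim, h1, h2, CPerm.originVal]
      simp
    · have h1 := (ho i hi .r).2 j hj
      have h2 := (ho i hi .u).2 j hj
      simp only [ht, cpt] at h1 h2
      simp only [PinAux.ext, Option.elim, h1, h2]
      omega

theorem mono_bij_id {N M : ℕ} {φ : ℕ → ℕ} (hb : BijOn φ (Iio N) (Iio M))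
    (hm : ∀ a < N, ∀ b < N, a < b → φ a < φ b) : N = M ∧ ∀ k < N, φ k = k := by
  have key : ∀ k, k < N → φ k = k := by
    intro k
    induction k using Nat.strong_induction_on with
    | _ k ih =>
      intro hk
      rcases lt_trichotomy (φ k) k with h | h | h
      · have := ih _ h (h.trans hk)
        have := hb.injOn (show φ k ∈ Iio N from h.trans hk) (show k ∈ Iio N from hk) this
        omega
      · exact h
      · have hkM : k < M := h.trans (hb.mapsTo (show k ∈ Iio N from hk))
        obtain ⟨m, hm1, hm2⟩ := hb.surjOn (show k ∈ Iio M from hkM)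
        rcases lt_trichotomy m k with h' | h' | h'
        · have := ih m h' hm1
          omega
        · subst h'; omega
        · have := hm k hk m hm1 h'
          omega
  refine ⟨?_, key⟩
  have : Iio N = Iio M := by
    rw [← hb.image_eq]
    ext k
    constructor
    · intro hk
      exact ⟨k, hk, key k hk⟩
    · rintro ⟨a, ha, rfl⟩
      rwa [key a ha]
  exact Iio_injective this

theorem Models.uniq {p q : CPerm} {s : Set ι} {f : ι → ℤ × ℤ}
    (h : Models p s f) (h' : Models q s f) : p = q := by
  have hp := h.1
  have hq := h'.1
  obtain ⟨E, hE, hEo, hEm⟩ := h.ext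
  obtain ⟨F, hF, hFo, hFm⟩ := h'.ext
  obtain ⟨i1, i2, i3⟩ := bij_symm hE
  set G := Function.invFunOn E (extSet s) with hG
  have hGF : BijOn (F ∘ G) (Iio p.vals.length) (Iio q.vals.length) := hF.comp i1
  obtain ⟨hN, hid⟩ := mono_bij_id hGF (by
    intro a ha b hb hab
    have ma := i1.mapsTo (show a ∈ Iio p.vals.length from ha)
    have mb := i1.mapsTo (show b ∈ Iio p.vals.length from hb)
    refine ((hFm _ ma _ mb).1).1 (((hEm _ ma _ mb).1).2 ?_)
    rw [i3 a ha, i3 b hb]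
    exact hab)
  have hor : p.origin = q.origin := by
    have := hid (E none) (by rw [hEo]; exact hp.2.1)
    simp only [Function.comp] at this
    rw [i2 none (Or.inl rfl), hEo, hFo] at this
    exact this.symm
  have hval : ∀ a < p.vals.length, ∀ b < p.vals.length,
      (p.valAt a < p.valAt b ↔ q.valAt a < q.valAt b) := by
    intro a ha b hb
    have ma := i1.mapsTo (show a ∈ Iio p.vals.length from ha)
    have mb := i1.mapsTo (show b ∈ Iio p.vals.length from hb)
    have h1 := (hEm _ ma _ mb).2
    have h2 := (hFm _ ma _ mb).2
    rw [i3 a ha, i3 b hb] at h1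
    have ea := hid a ha
    have eb := hid b hb
    simp only [Function.comp] at ea eb
    rw [ea, eb] at h2
    exact h1.symm.trans h2
  have hb1 : BijOn p.valAt (Iio p.vals.length) (Iio p.vals.length) :=
    ⟨fun a ha => valAt_lt hp ha, fun a ha b hb => valAt_inj hp ha hb,
      fun v hv => valAt_surj hp hv⟩
  have hb2 : BijOn q.valAt (Iio p.vals.length) (Iio q.vals.length) := by
    rw [hN]
    exact ⟨fun a ha => valAt_lt hq ha, fun a ha b hb => valAt_inj hq ha hb,
      fun v hv => valAt_surj hq hv⟩
  obtain ⟨j1, j2, j3⟩ := bij_symm hb1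
  obtain ⟨-, hid2⟩ := mono_bij_id (hb2.comp j1) (by
    intro a ha b hb hab
    have ma := j1.mapsTo (show a ∈ Iio p.vals.length from ha)
    have mb := j1.mapsTo (show b ∈ Iio p.vals.length from hb)
    refine (hval _ ma _ mb).1 ?_
    rw [j3 a ha, j3 b hb]
    exact hab)
  have hv : p.vals = q.vals := by
    apply List.ext_getElem hN
    intro k hk hk'
    have := hid2 (p.valAt k) (valAt_lt hp hk)
    simp only [Function.comp] at this
    rw [j2 k hk] at this
    rw [← valAt_eq p hk, ← valAt_eq q hk', this]
  cases p; cases q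
  simp only at hv hor
  subst hv hor
  rfl

theorem Models.iso_eq {p q : CPerm} {s : Set ι} {t : Set κ} {f : ι → ℤ × ℤ} {g : κ → ℤ × ℤ}
    (h : Models p s f) (h' : Models q t g) {τ : ι → κ} (hτ : BijOn τ s t)
    (ho : OE s f (fun i => g (τ i))) : p = q :=
  h.uniq (h'.map hτ ho)

theorem idx_finite (p : CPerm) : (idx p).Finite :=
  (Set.finite_Iio p.vals.length).subset fun _ h => h.1

theorem idx_ncard {p : CPerm} (hp : p.IsValid) : (idx p).ncard = p.len := by
  have : idx p = ((Finset.range p.vals.length).erase p.origin : Finset ℕ) := by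
    ext k
    simp [idx, and_comm]
  rw [this, Set.ncard_coe_finset, Finset.card_erase_of_mem (Finset.mem_range.2 hp.2.1),
    Finset.card_range]
  rfl

theorem Models.finite {p : CPerm} {s : Set ι} {f : ι → ℤ × ℤ} (h : Models p s f) : s.Finite := by
  obtain ⟨_, e, he, _⟩ := h
  exact Set.Finite.of_finite_image (he.image_eq ▸ idx_finite p) he.injOn

theorem Models.ncard {p : CPerm} {s : Set ι} {f : ι → ℤ × ℤ} (h : Models p s f) :
    s.ncard = p.len := by
  obtain ⟨hp, e, he, _⟩ := h
  rw [← idx_ncard hp, ← he.image_eq, he.injOn.ncard_image]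

theorem cpt_good {p : CPerm} (hp : p.IsValid) : Good (idx p) (cpt p) := by
  intro i hi c
  have h0 : p.valAt i ≠ p.originVal := fun h => hi.2 (valAt_inj hp hi.1 hp.2.1 h)
  refine ⟨?_, fun j hj hji => ?_⟩
  · have := hi.2
    cases c <;> simp only [ht, cpt] <;> omega
  · have h1 : p.valAt j ≠ p.valAt i := fun h => hji (valAt_inj hp hj.1 hi.1 h)
    cases c <;> simp only [ht, cpt] <;> omega

theorem ht_opp (c : PinLetter) (z : ℤ × ℤ) : ht (opp c) z = - ht c z := by
  cases c <;> simp [ht, opp]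

theorem Good.of_OE {s : Set ι} {f g : ι → ℤ × ℤ} (h : Good s g) (ho : OE s f g) : Good s f := by
  intro i hi c
  have h1 := (ho i hi c)
  have h2 := (ho i hi (opp c))
  simp only [ht_opp] at h2
  have := h i hi c
  refine ⟨fun h0 => this.1 ?_, fun j hj hji h0 => this.2 j hj hji ?_⟩
  · omega
  · have a1 := h1.2 j hj
    have a2 := h2.2 j hj
    omega

theorem Models.good {p : CPerm} {s : Set ι} {f : ι → ℤ × ℤ} (h : Models p s f) : Good s f := by
  obtain ⟨hp, e, he, ho⟩ := h
  refine Good.of_OE (g := fun i => cpt p (e i)) ?_ ho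
  intro i hi c
  have := cpt_good hp _ (he.mapsTo hi) c
  exact ⟨this.1, fun j hj hji => this.2 _ (he.mapsTo hj) fun h => hji (he.injOn hj hi h)⟩

theorem sub_models {p q : CPerm} {s : Set ι} {f : ι → ℤ × ℤ} (hpq : CPerm.PatternLE p q)
    (hp : p.IsValid) (h : Models q s f) : ∃ t ⊆ s, Models p t f := by
  obtain ⟨F, h1, h2, h3, h4⟩ := hpq
  obtain ⟨hq, e, he, ho⟩ := h
  have h1' : ∀ i j, i < p.vals.length → j < p.vals.length → (F i < F j ↔ i < j) := by
    intro i j hi hj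
    rcases lt_trichotomy i j with h | h | h
    · simp [h, h1 i j hi hj h]
    · subst h; simp
    · have := h1 j i hj hi h
      omega
  have hF : MapsTo F (idx p) (idx q) := by
    intro k hk
    refine ⟨h2 k hk.1, fun h => hk.2 ?_⟩
    have a := h1' k p.origin hk.1 hp.2.1
    have b := h1' p.origin k hp.2.1 hk.1
    omega
  have hFi : InjOn F (idx p) := by
    intro a ha b hb hab
    have a1 := h1' a b ha.1 hb.1
    have b1 := h1' b a hb.1 ha.1
    omega
  rcases isEmpty_or_nonempty ι with hι | hι
  · refine ⟨∅, by simp, hp, fun i => hι.elim i, ?_, fun i hi => absurd hi (by simp)⟩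
    have : idx p = ∅ := by
      by_contra hne
      obtain ⟨k, hk⟩ := Set.nonempty_iff_ne_empty.2 hne
      obtain ⟨i, -, -⟩ := he.surjOn (hF hk)
      exact hι.elim i
    rw [this]
    simp
  obtain ⟨i1, i2, i3⟩ := bij_symm he
  set G := Function.invFunOn e s
  have hb : BijOn (G ∘ F) (idx p) ((G ∘ F) '' idx p) :=
    (InjOn.bijOn_image (i1.injOn.comp hFi hF))
  have hs : (G ∘ F) '' idx p ⊆ s := by
    rintro _ ⟨k, hk, rfl⟩
    exact i1.mapsTo (hF hk)
  refine ⟨_, hs, ?_⟩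
  obtain ⟨j1, j2, j3⟩ := bij_symm hb
  refine (models_self hp).map j1 ?_
  -- transfer
  have main : OE (idx p) (cpt p) (fun k => f (G (F k))) := by
    have : OE (idx p) (fun k => f (G (F k))) (fun k => cpt q (F k)) := by
      intro k hk c
      have := ho _ (i1.mapsTo (hF hk)) c
      simp only [i3 _ (hF hk)] at this
      refine ⟨this.1, fun j hj => ?_⟩
      have := this.2 _ (i1.mapsTo (hF hj))
      simpa only [i3 _ (hF hj)] using this
    refine OE.trans ?_ this.symm
    intro k hk c
    have a1 := h1' k p.origin hk.1 hp.2.1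
    have a2 := h1' p.origin k hp.2.1 hk.1
    have a3 := h4 k p.origin hk.1 hp.2.1
    have a4 := h4 p.origin k hp.2.1 hk.1
    rw [h3] at a1 a2 a3 a4
    refine ⟨?_, fun j hj => ?_⟩
    · cases c <;> simp only [ht, cpt, CPerm.originVal] <;> omega
    · have a1 := h1' k j hk.1 hj.1
      have a2 := h1' j k hj.1 hk.1
      have a3 := h4 k j hk.1 hj.1
      have a4 := h4 j k hj.1 hk.1
      cases c <;> simp only [ht, cpt, CPerm.originVal] <;> omega
  intro i hi c
  have hi' := j1.mapsTo hi
  have := main _ hi' c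
  have e1 := j3 i hi
  simp only [Function.comp] at e1
  simp only [e1] at this
  refine ⟨this.1.symm, fun j hj => ?_⟩
  have := this.2 _ (j1.mapsTo hj)
  have e2 := j3 j hj
  simp only [Function.comp] at e2
  simp only [e2] at this
  exact this.symm

theorem patternLE_refl (p : CPerm) : CPerm.PatternLE p p :=
  ⟨id, fun _ _ _ _ h => h, fun _ h => h, rfl, fun _ _ _ _ => Iff.rfl⟩

end basics
end PinAux

namespace PinAux
open PinLetter Set

section box
variable {ι κ : Type*}

theorem bs_length {a b : CPerm} (hb : b.IsValid) :
    (CPerm.boxSum a b).vals.length + 1 = b.vals.length + a.vals.length := by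
  have := hb.2.1
  simp [CPerm.boxSum]
  omega

theorem bs_mid {a b : CPerm} (hb : b.IsValid) {k : ℕ} (hk : k < a.vals.length) :
    (CPerm.boxSum a b).valAt (b.origin + k) = a.valAt k + b.originVal := by
  have := hb.2.1
  have hl := bs_length (a := a) hb
  rw [valAt_eq _ (by omega), valAt_eq _ hk]
  have h1 : min b.origin b.vals.length = b.origin := by omega
  simp only [CPerm.boxSum]
  rw [List.getElem_append_left (by simp; omega), List.getElem_append_right (by simp)]
  simp [h1]

def bsh (a b : CPerm) (w : ℕ) : ℕ := if w < b.originVal then w else w + (a.vals.length - 1)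

theorem bs_left {a b : CPerm} (ha : a.IsValid) (hb : b.IsValid) {k : ℕ} (hk : k < b.origin) :
    (CPerm.boxSum a b).valAt k = bsh a b (b.valAt k) := by
  have := hb.2.1
  have := ((valid_iff a).1 ha).1
  have hl := bs_length (a := a) hb
  rw [valAt_eq _ (by omega), valAt_eq _ (by omega)]
  simp only [CPerm.boxSum]
  rw [List.getElem_append_left (by simp; omega), List.getElem_append_left (by simp; omega)]
  simp [bsh]

theorem bs_right {a b : CPerm} (ha : a.IsValid) (hb : b.IsValid) {k : ℕ} (hk : b.origin < k)
    (hk' : k < b.vals.length) :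
    (CPerm.boxSum a b).valAt (k + (a.vals.length - 1)) = bsh a b (b.valAt k) := by
  have := hb.2.1
  have := ((valid_iff a).1 ha).1
  have hl := bs_length (a := a) hb
  rw [valAt_eq _ (by omega), valAt_eq _ hk']
  have h1 : min b.origin b.vals.length = b.origin := by omega
  simp only [CPerm.boxSum]
  rw [List.getElem_append_right (by simp; omega)]
  simp only [List.getElem_map, List.getElem_drop, bsh]
  have : b.origin + 1 + (k + (a.vals.length - 1) -
      ((b.vals.take b.origin).map (fun u => if u < b.originVal then u else u + (a.vals.length - 1)) ++
      a.vals.map (· + b.originVal)).length) = k := by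
    simp [h1]; omega
  simp only [this]

theorem bs_originVal {a b : CPerm} (ha : a.IsValid) (hb : b.IsValid) :
    (CPerm.boxSum a b).originVal = a.originVal + b.originVal := by
  have := bs_mid (a := a) hb ha.2.1
  exact this

/-- index map for the outer summand -/
def bix (a b : CPerm) (k : ℕ) : ℕ := if k < b.origin then k else k + (a.vals.length - 1)

theorem bs_out {a b : CPerm} (ha : a.IsValid) (hb : b.IsValid) {k : ℕ} (hk : k ∈ idx b) :
    (CPerm.boxSum a b).valAt (bix a b k) = bsh a b (b.valAt k) := by
  obtain ⟨h1, h2⟩ := hk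
  unfold bix
  split_ifs with h
  · exact bs_left ha hb h
  · exact bs_right ha hb (by omega) h1

theorem bs_cases {a b : CPerm} (ha : a.IsValid) (hb : b.IsValid) {m : ℕ}
    (hm : m < (CPerm.boxSum a b).vals.length) :
    (∃ k < a.vals.length, m = b.origin + k) ∨ ∃ k ∈ idx b, m = bix a b k := by
  have hl := bs_length (a := a) hb
  have := hb.2.1
  have := ((valid_iff a).1 ha).1
  by_cases h1 : m < b.origin
  · exact Or.inr ⟨m, ⟨by omega, by omega⟩, by simp [bix, h1]⟩
  · by_cases h2 : m < b.origin + a.vals.length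
    · exact Or.inl ⟨m - b.origin, by omega, by omega⟩
    · refine Or.inr ⟨m - (a.vals.length - 1), ⟨by omega, by omega⟩, ?_⟩
      unfold bix
      rw [if_neg (by omega)]
      omega

theorem bs_valid {a b : CPerm} (ha : a.IsValid) (hb : b.IsValid) :
    (CPerm.boxSum a b).IsValid := by
  have hl := bs_length (a := a) hb
  have hbo := hb.2.1
  have hao := ha.2.1
  have ha0 := ((valid_iff a).1 ha).1
  have hbv := valAt_lt hb hbo
  have hout : ∀ k ∈ idx b, b.valAt k ≠ b.originVal ∧ b.valAt k < b.vals.length := fun k hk =>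
    ⟨fun h => hk.2 (valAt_inj hb hk.1 hbo h), valAt_lt hb hk.1⟩
  rw [valid_iff]
  refine ⟨by omega, ?_, ?_, ?_⟩
  · show b.origin + a.origin < _
    omega
  · rw [List.nodup_iff_injective_get]
    have key : ∀ m < (CPerm.boxSum a b).vals.length, ∀ n < (CPerm.boxSum a b).vals.length,
        (CPerm.boxSum a b).valAt m = (CPerm.boxSum a b).valAt n → m = n := by
      intro m hm n hn
      rcases bs_cases ha hb hm with ⟨k, hk, rfl⟩ | ⟨k, hk, rfl⟩ <;>
        rcases bs_cases ha hb hn with ⟨j, hj, rfl⟩ | ⟨j, hj, rfl⟩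
      · rw [bs_mid hb hk, bs_mid hb hj]
        intro h
        rw [valAt_inj ha hk hj (by omega)]
      · rw [bs_mid hb hk, bs_out ha hb hj]
        have := valAt_lt ha hk
        have := hout j hj
        unfold bsh
        split_ifs <;> omega
      · rw [bs_mid hb hj, bs_out ha hb hk]
        have := valAt_lt ha hj
        have := hout k hk
        unfold bsh
        split_ifs <;> omega
      · rw [bs_out ha hb hj, bs_out ha hb hk]
        have h1 := hout k hk
        have h2 := hout j hj
        intro h
        have : b.valAt k = b.valAt j := by
          unfold bsh at h
          split_ifs at h <;> omega
        rw [valAt_inj hb hk.1 hj.1 this]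
    intro ⟨m, hm⟩ ⟨n, hn⟩ h
    have := key m hm n hn (by rw [valAt_eq _ hm, valAt_eq _ hn]; exact h)
    exact Fin.ext this
  · intro v hv
    obtain ⟨m, hm, rfl⟩ := List.mem_iff_getElem.1 hv
    rw [← valAt_eq _ hm]
    rcases bs_cases ha hb hm with ⟨k, hk, rfl⟩ | ⟨k, hk, rfl⟩
    · rw [bs_mid hb hk]
      have := valAt_lt ha hk
      have : b.originVal < b.vals.length := hbv
      omega
    · rw [bs_out ha hb hk]
      have := hout k hk
      unfold bsh
      split_ifs <;> omega

/-- The size of the inner summand along a ray. -/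
def ray (a : CPerm) : PinLetter → ℤ
  | .u => a.vals.length - 1 - a.originVal
  | .d => a.originVal
  | .l => a.origin
  | .r => a.vals.length - 1 - a.origin

theorem cpt_in {a b : CPerm} (ha : a.IsValid) (hb : b.IsValid) {k : ℕ} (hk : k < a.vals.length) :
    cpt (CPerm.boxSum a b) (b.origin + k) = cpt a k := by
  unfold cpt
  rw [bs_mid hb hk, bs_originVal ha hb]
  have : (CPerm.boxSum a b).origin = b.origin + a.origin := rfl
  rw [this]
  ext <;> push_cast <;> simp

theorem ht_le_ray {a : CPerm} (ha : a.IsValid) {k : ℕ} (hk : k < a.vals.length) (c : PinLetter) :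
    ht c (cpt a k) ≤ ray a c := by
  have := valAt_lt ha hk
  cases c <;> simp only [ht, cpt, ray] <;> omega

theorem ray_nonneg {a : CPerm} (ha : a.IsValid) (c : PinLetter) : 0 ≤ ray a c := by
  have := valAt_lt ha ha.2.1
  have := ha.2.1
  cases c <;> simp only [ray, CPerm.originVal] <;> omega

theorem ht_out {a b : CPerm} (ha : a.IsValid) (hb : b.IsValid) {k : ℕ} (hk : k ∈ idx b)
    (c : PinLetter) :
    ht c (cpt (CPerm.boxSum a b) (bix a b k)) =
      if 0 < ht c (cpt b k) then ht c (cpt b k) + ray a c else ht c (cpt b k) - ray a (opp c) := by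
  have h0 : b.valAt k ≠ b.originVal := fun h => hk.2 (valAt_inj hb hk.1 hb.2.1 h)
  have ha0 := ((valid_iff a).1 ha).1
  have hk2 := hk.2
  unfold cpt
  rw [bs_out ha hb hk, bs_originVal ha hb]
  have : (CPerm.boxSum a b).origin = b.origin + a.origin := rfl
  rw [this]
  unfold bsh bix
  cases c <;> simp only [ht, ray, opp] <;> split_ifs <;> push_cast <;> omega

theorem Models.box {a b : CPerm} {s t : Set ι} {f : ι → ℤ × ℤ} (h1 : Models a s f)
    (h2 : Models b t f) (hd : Disjoint s t) (hB : Before f s t) :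
    Models (CPerm.boxSum a b) (s ∪ t) f := by
  classical
  have hg1 := h1.good
  have hg2 := h2.good
  obtain ⟨ha, e, he, ho⟩ := h1
  obtain ⟨hb, e', he', ho'⟩ := h2
  have ha0 := ((valid_iff a).1 ha).1
  have hl := bs_length (a := a) hb
  have hts : ∀ j ∈ t, j ∉ s := fun j hj hs => Set.disjoint_left.1 hd hs hj
  have horig : (CPerm.boxSum a b).origin = b.origin + a.origin := rfl
  have hao := ha.2.1
  have hbo := hb.2.1
  refine ⟨bs_valid ha hb, fun i => if i ∈ s then b.origin + e i else bix a b (e' i), ⟨?_, ?_, ?_⟩,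
    ?_⟩
  · rintro i (hi | hi)
    · have := he.mapsTo hi
      simp only [hi, if_true, idx, mem_ofPred_eq, horig] at this ⊢
      omega
    · have := he'.mapsTo hi
      simp only [hts i hi, if_false, idx, mem_ofPred_eq, horig, bix] at this ⊢
      split_ifs <;> omega
  · rintro i (hi | hi) j (hj | hj) hij
    · simp only [hi, hj, if_true] at hij
      exact he.injOn hi hj (by omega)
    · simp only [hi, hts j hj, if_true, if_false, bix] at hij
      have h3 := he.mapsTo hi
      have h4 := he'.mapsTo hj
      simp only [idx, mem_ofPred_eq] at h3 h4
      split_ifs at hij <;> omega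
    · simp only [hts i hi, hj, if_true, if_false, bix] at hij
      have h3 := he.mapsTo hj
      have h4 := he'.mapsTo hi
      simp only [idx, mem_ofPred_eq] at h3 h4
      split_ifs at hij <;> omega
    · simp only [hts i hi, hts j hj, if_false, bix] at hij
      have h3 := he'.mapsTo hi
      have h4 := he'.mapsTo hj
      simp only [idx, mem_ofPred_eq] at h3 h4
      exact he'.injOn hi hj (by split_ifs at hij <;> omega)
  · rintro m ⟨hm, hm'⟩
    rcases bs_cases ha hb hm with ⟨k, hk, rfl⟩ | ⟨k, hk, rfl⟩
    · obtain ⟨i, hi, rfl⟩ := he.surjOn (show k ∈ idx a from ⟨hk, by rw [horig] at hm'; omega⟩)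
      exact ⟨i, Or.inl hi, by simp [hi]⟩
    · obtain ⟨i, hi, rfl⟩ := he'.surjOn hk
      exact ⟨i, Or.inr hi, by simp [hts i hi]⟩
  · -- order equivalence
    have E1 : ∀ i ∈ s, ∀ c, ht c (cpt (CPerm.boxSum a b)
        (if i ∈ s then b.origin + e i else bix a b (e' i))) = ht c (cpt a (e i)) := by
      intro i hi c
      rw [if_pos hi, cpt_in ha hb (he.mapsTo hi).1]
    have E2 : ∀ i ∈ t, ∀ c, ht c (cpt (CPerm.boxSum a b)
        (if i ∈ s then b.origin + e i else bix a b (e' i))) =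
        if 0 < ht c (cpt b (e' i)) then ht c (cpt b (e' i)) + ray a c
          else ht c (cpt b (e' i)) - ray a (opp c) := by
      intro i hi c
      rw [if_neg (hts i hi), ht_out ha hb (he'.mapsTo hi)]
    rintro i (hi | hi) c
    · have a1 := ho i hi c
      have a2 := ho i hi (opp c)
      have r1 := ht_le_ray ha (he.mapsTo hi).1 c
      have r2 := ht_le_ray ha (he.mapsTo hi).1 (opp c)
      refine ⟨by rw [E1 i hi]; exact a1.1, ?_⟩
      rintro j (hj | hj)
      · rw [E1 i hi, E1 j hj]
        exact a1.2 j hj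
      · rw [E1 i hi, E2 j hj]
        have b1 := ho' j hj c
        have b2 := ho' j hj (opp c)
        have B1 := hB i hi j hj c
        have B2 := hB i hi j hj (opp c)
        have g1 := (hg1 i hi c).1
        have g2 := (hg2 j hj c).1
        have a3 := a1.1
        have a4 := a2.1
        have b3 := b1.1
        have b4 := b2.1
        simp only [ht_opp] at *
        split_ifs <;> omega
    · have a1 := ho' i hi c
      have a2 := ho' i hi (opp c)
      have p1 := ray_nonneg ha c
      have p2 := ray_nonneg ha (opp c)
      refine ⟨by rw [E2 i hi, a1.1]; beta_reduce; split_ifs <;> omega, ?_⟩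
      rintro j (hj | hj)
      · rw [E2 i hi, E1 j hj]
        have b1 := ho j hj c
        have b2 := ho j hj (opp c)
        have B1 := hB j hj i hi c
        have B2 := hB j hj i hi (opp c)
        have g1 := (hg1 j hj c).1
        have g2 := (hg2 i hi c).1
        have r1 := ht_le_ray ha (he.mapsTo hj).1 c
        have r2 := ht_le_ray ha (he.mapsTo hj).1 (opp c)
        have a3 := a1.1
        have a4 := a2.1
        have b3 := b1.1
        have b4 := b2.1
        simp only [ht_opp] at *
        split_ifs <;> omega
      · rw [E2 i hi, E2 j hj, a1.2 j hj]
        beta_reduce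
        split_ifs <;> omega

/-- push a point outward -/
def push (M : ℤ) (z : ℤ × ℤ) : ℤ × ℤ :=
  (if 0 < z.1 then z.1 + M else z.1 - M, if 0 < z.2 then z.2 + M else z.2 - M)

theorem ht_push (M : ℤ) (z : ℤ × ℤ) (c : PinLetter) (h : ht c z ≠ 0) :
    ht c (push M z) = if 0 < ht c z then ht c z + M else ht c z - M := by
  cases c <;> simp only [ht, push] at * <;> split_ifs <;> omega

theorem Models.split {a b : CPerm} {s : Set ι} {f : ι → ℤ × ℤ} (ha : a.IsValid) (hb : b.IsValid)
    (h : Models (CPerm.boxSum a b) s f) :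
    ∃ I ⊆ s, Models a I f ∧ Models b (s \ I) f ∧ Before f I (s \ I) := by
  obtain ⟨M, hM⟩ : ∃ M : ℤ, M = (a.vals.length : ℤ) := ⟨_, rfl⟩
  let g : ℕ ⊕ ℕ → ℤ × ℤ := fun x => match x with
    | .inl k => cpt a k
    | .inr k => push M (cpt b k)
  have hgb := cpt_good hb
  have m1 : Models a (Sum.inl '' idx a) g := by
    have hbij : BijOn (Sum.elim id id : ℕ ⊕ ℕ → ℕ) (Sum.inl '' idx a) (idx a) := by
      refine ⟨?_, ?_, ?_⟩
      · rintro _ ⟨k, hk, rfl⟩; exact hk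
      · rintro _ ⟨k, hk, rfl⟩ _ ⟨j, hj, rfl⟩ h
        simpa using h
      · intro k hk; exact ⟨.inl k, ⟨k, hk, rfl⟩, rfl⟩
    refine (models_self ha).map hbij ?_
    rintro _ ⟨k, hk, rfl⟩ c
    refine ⟨Iff.rfl, ?_⟩
    rintro _ ⟨j, hj, rfl⟩
    exact Iff.rfl
  have m2 : Models b (Sum.inr '' idx b) g := by
    have hbij : BijOn (Sum.elim id id : ℕ ⊕ ℕ → ℕ) (Sum.inr '' idx b) (idx b) := by
      refine ⟨?_, ?_, ?_⟩
      · rintro _ ⟨k, hk, rfl⟩; exact hk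
      · rintro _ ⟨k, hk, rfl⟩ _ ⟨j, hj, rfl⟩ h
        simpa using h
      · intro k hk; exact ⟨.inr k, ⟨k, hk, rfl⟩, rfl⟩
    refine (models_self hb).map hbij ?_
    rintro _ ⟨k, hk, rfl⟩ c
    simp only [g, Sum.elim_inr, id]
    rw [ht_push _ _ _ (hgb k hk c).1]
    refine ⟨by split_ifs <;> omega, ?_⟩
    rintro _ ⟨j, hj, rfl⟩
    simp only [Sum.elim_inr, id]
    rw [ht_push _ _ _ (hgb j hj c).1]
    split_ifs <;> omega
  have hd : Disjoint (Sum.inl '' idx a : Set (ℕ ⊕ ℕ)) (Sum.inr '' idx b) := by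
    rw [Set.disjoint_left]
    rintro _ ⟨k, hk, rfl⟩ ⟨j, hj, h⟩
    simp at h
  have hB : Before g (Sum.inl '' idx a : Set (ℕ ⊕ ℕ)) (Sum.inr '' idx b) := by
    rintro _ ⟨k, hk, rfl⟩ _ ⟨j, hj, rfl⟩ c
    simp only [g]
    rw [ht_push _ _ _ (hgb j hj c).1]
    have := ht_le_ray ha hk.1 c
    have h2 : ray a c < M := by
      have := ha.2.1
      cases c <;> simp only [ray] <;> first | omega | (have := valAt_lt ha ha.2.1; simp only [CPerm.originVal]; omega)
    split_ifs <;> omega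
  have m3 := m1.box m2 hd hB
  obtain ⟨τ, hτ, hoe⟩ := h.iso m3
  set I : Set ι := {i ∈ s | τ i ∈ (Sum.inl '' idx a : Set (ℕ ⊕ ℕ))} with hI
  have hIs : I ⊆ s := fun i hi => hi.1
  have hout : ∀ i ∈ s \ I, τ i ∈ (Sum.inr '' idx b : Set (ℕ ⊕ ℕ)) := by
    intro i hi
    rcases hτ.mapsTo hi.1 with h | h
    · exact absurd ⟨hi.1, h⟩ hi.2
    · exact h
  refine ⟨I, hIs, ?_, ?_, ?_⟩
  · refine m1.map (τ := τ) ⟨fun i hi => hi.2, hτ.injOn.mono hIs, ?_⟩ (hoe.mono hIs)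
    intro x hx
    obtain ⟨i, hi, rfl⟩ := hτ.surjOn (Or.inl hx)
    exact ⟨i, ⟨hi, hx⟩, rfl⟩
  · refine m2.map (τ := τ) ⟨hout, hτ.injOn.mono sdiff_subset, ?_⟩ (hoe.mono sdiff_subset)
    intro x hx
    obtain ⟨i, hi, rfl⟩ := hτ.surjOn (Or.inr hx)
    exact ⟨i, ⟨hi, fun h => Set.disjoint_left.1 hd h.2 hx⟩, rfl⟩
  · intro i hi j hj c h1 h2
    have q1 := hoe i hi.1 c
    have q2 := hoe j hj.1 c
    exact (q1.2 j hj.1).2 (hB _ hi.2 _ (hout j hj) c (q1.1.1 h1) (q2.1.1 h2))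

end box
end PinAux

namespace PinAux
open PinLetter Set

section toc
variable {ι κ : Type*}

def rk (l : List ℚ) (y : ℚ) : ℕ := (l.filter (fun x => decide (x < y))).length

theorem rk_le (l : List ℚ) {a b : ℚ} (h : a ≤ b) : rk l a ≤ rk l b := by
  induction l with
  | nil => simp [rk]
  | cons x l ih =>
    unfold rk at *
    simp only [List.filter_cons]
    split_ifs with h1 h2 h2
    · simpa using ih
    · simp only [decide_eq_true_eq] at h1 h2
      exact absurd (lt_of_lt_of_le h1 h) h2
    · simp; omega
    · exact ih

theorem rk_lt (l : List ℚ) {a b : ℚ} (h : a < b) (ha : a ∈ l) : rk l a < rk l b := by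
  induction l with
  | nil => simp at ha
  | cons x l ih =>
    have hle := rk_le l h.le
    unfold rk at *
    simp only [List.filter_cons]
    rcases List.mem_cons.1 ha with rfl | ha
    · simp [h]; omega
    · have := ih ha
      split_ifs with h1 h2 h2
      · simpa using this
      · simp only [decide_eq_true_eq] at h1 h2
        exact absurd (h1.trans h) h2
      · simp; omega
      · exact this

theorem rk_lt_iff (l : List ℚ) {a b : ℚ} (ha : a ∈ l) : rk l a < rk l b ↔ a < b := by
  constructor
  · intro h
    by_contra hc
    have := rk_le l (not_lt.1 hc)
    omega
  · intro h; exact rk_lt l h ha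

theorem rk_lt_length (l : List ℚ) {a : ℚ} (ha : a ∈ l) : rk l a < l.length := by
  unfold rk
  refine lt_of_le_of_ne (List.length_filter_le _ _) fun h => ?_
  have := (List.length_filter_eq_length_iff.1 h) a ha
  simp at this

theorem rk_perm {l l' : List ℚ} (h : l.Perm l') (a : ℚ) : rk l a = rk l' a :=
  (h.filter _).length_eq

theorem rk_sorted {l : List ℚ} (h : l.Pairwise (· < ·)) {k : ℕ} (hk : k < l.length) :
    rk l l[k] = k := by
  unfold rk
  have h1 : (l.take k).filter (fun x => decide (x < l[k])) = l.take k := by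
    rw [List.filter_eq_self]
    intro a ha
    obtain ⟨j, hj, rfl⟩ := List.mem_iff_getElem.1 ha
    simp only [List.length_take] at hj
    simp only [List.getElem_take, decide_eq_true_eq]
    exact List.pairwise_iff_getElem.1 h j k (by omega) hk (by omega)
  have h2 : (l.drop k).filter (fun x => decide (x < l[k])) = [] := by
    rw [List.filter_eq_nil_iff]
    intro a ha
    obtain ⟨j, hj, rfl⟩ := List.mem_iff_getElem.1 ha
    simp only [List.length_drop] at hj
    simp only [List.getElem_drop, decide_eq_true_eq, not_lt]
    rcases Nat.eq_zero_or_pos j with rfl | hj0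
    · simp
    · exact (List.pairwise_iff_getElem.1 h k (k + j) hk (by omega) (by omega)).le
  generalize l[k] = v at h1 h2 ⊢
  have h3 : l.filter (fun x => decide (x < v)) =
      (l.take k).filter (fun x => decide (x < v)) ++ (l.drop k).filter (fun x => decide (x < v)) := by
    rw [← List.filter_append, List.take_append_drop]
  rw [h3, h1, h2]
  simp; omega

theorem toCPerm_models {L : List ι} (hL : L.Nodup) {f : ι → ℚ × ℚ} {o : ι} (ho : o ∈ L)
    (hfo : f o = (0, 0)) (hx : ∀ i ∈ L, ∀ j ∈ L, (f i).1 = (f j).1 → i = j)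
    (hy : ∀ i ∈ L, ∀ j ∈ L, (f i).2 = (f j).2 → i = j)
    {g : ι → ℤ × ℤ} (hg : OE {i | i ∈ L ∧ i ≠ o} g f) :
    Models (toCPerm (L.map f)) {i | i ∈ L ∧ i ≠ o} g := by
  set P := L.map f with hP
  set M := P.mergeSort (fun a b => decide (a.1 ≤ b.1)) with hM
  set xs := P.map Prod.fst with hxs
  set ys := P.map Prod.snd with hys
  have hperm : M.Perm P := List.mergeSort_perm _ _
  have hpx : (M.map Prod.fst).Perm xs := hperm.map _
  have hxnd : xs.Nodup := by
    rw [hxs, hP, List.map_map]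
    exact List.Nodup.map_on (fun i hi j hj h => hx i hi j hj h) hL
  have hsort : (M.map Prod.fst).Pairwise (· < ·) := by
    have h1 : M.Pairwise (fun a b => decide (a.1 ≤ b.1) = true) := by
      apply List.pairwise_mergeSort
      · intro a b c; simp; exact le_trans
      · intro a b; simp; exact le_total _ _
    have h2 : (M.map Prod.fst).Pairwise (· ≤ ·) := by
      rw [List.pairwise_map]
      exact h1.imp (by simp)
    have h3 : (M.map Prod.fst).Nodup := hpx.nodup_iff.2 hxnd
    exact (h2.and h3).imp fun ⟨a, b⟩ => lt_of_le_of_ne a b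
  have hvals : (toCPerm P).vals = M.map (fun pt => rk ys pt.2) := rfl
  have horig : (toCPerm P).origin = rk xs 0 := rfl
  have hlenM : M.length = L.length := by rw [hperm.length_eq, hP, List.length_map]
  have hlen : (toCPerm P).vals.length = L.length := by rw [hvals, List.length_map, hlenM]
  have memx : ∀ i ∈ L, (f i).1 ∈ xs := fun i hi =>
    List.mem_map_of_mem (List.mem_map_of_mem hi)
  have memy : ∀ i ∈ L, (f i).2 ∈ ys := fun i hi =>
    List.mem_map_of_mem (List.mem_map_of_mem hi)
  have hxl : xs.length = L.length := by simp [hxs, hP]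
  have hyl : ys.length = L.length := by simp [hys, hP]
  -- the index map
  have hget : ∀ i ∈ L, ∃ k, ∃ hk : k < M.length, M[k] = f i ∧ rk xs (f i).1 = k := by
    intro i hi
    have : f i ∈ M := hperm.mem_iff.2 (List.mem_map_of_mem hi)
    obtain ⟨k, hk, h⟩ := List.mem_iff_getElem.1 this
    refine ⟨k, hk, h, ?_⟩
    have := rk_sorted hsort (k := k) (by simpa using hk)
    rw [rk_perm hpx] at this
    simpa [h] using this
  have hval : ∀ i ∈ L, (toCPerm P).valAt (rk xs (f i).1) = rk ys (f i).2 := by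
    intro i hi
    obtain ⟨k, hk, h1, h2⟩ := hget i hi
    rw [h2, valAt_eq _ (by rw [hlen, ← hlenM]; exact hk)]
    simp only [hvals, List.getElem_map, h1]
  have hlt : ∀ i ∈ L, rk xs (f i).1 < L.length := fun i hi => hxl ▸ rk_lt_length xs (memx i hi)
  have hsurj : ∀ k < L.length, ∃ i ∈ L, rk xs (f i).1 = k := by
    intro k hk
    have hk' : k < M.length := by omega
    have : M[k] ∈ P := hperm.mem_iff.1 (List.getElem_mem hk')
    obtain ⟨i, hi, h⟩ := List.mem_map.1 this
    refine ⟨i, hi, ?_⟩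
    have := rk_sorted hsort (k := k) (by simpa using hk')
    rw [rk_perm hpx] at this
    simpa [h] using this
  have hxlt : ∀ i ∈ L, ∀ j ∈ L, (rk xs (f i).1 < rk xs (f j).1 ↔ (f i).1 < (f j).1) :=
    fun i hi j hj => rk_lt_iff xs (memx i hi)
  have hylt : ∀ i ∈ L, ∀ j ∈ L, (rk ys (f i).2 < rk ys (f j).2 ↔ (f i).2 < (f j).2) :=
    fun i hi j hj => rk_lt_iff ys (memy i hi)
  have hxinj : ∀ i ∈ L, ∀ j ∈ L, rk xs (f i).1 = rk xs (f j).1 → i = j := by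
    intro i hi j hj h
    apply hx i hi j hj
    have h1 := hxlt i hi j hj
    have h2 := hxlt j hj i hi
    rw [h] at h1 h2
    simp only [lt_self_iff_false, false_iff, not_lt] at h1 h2
    exact le_antisymm h2 h1
  have hyinj : ∀ i ∈ L, ∀ j ∈ L, rk ys (f i).2 = rk ys (f j).2 → i = j := by
    intro i hi j hj h
    apply hy i hi j hj
    have h1 := hylt i hi j hj
    have h2 := hylt j hj i hi
    rw [h] at h1 h2
    simp only [lt_self_iff_false, false_iff, not_lt] at h1 h2
    exact le_antisymm h2 h1
  have horig' : (toCPerm P).origin = rk xs (f o).1 := by rw [horig, hfo]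
  have hov : (toCPerm P).originVal = rk ys (f o).2 := by
    unfold CPerm.originVal
    rw [horig', hval o ho]
  have hvalid : (toCPerm P).IsValid := by
    rw [valid_iff]
    refine ⟨?_, ?_, ?_, ?_⟩
    · rw [hlen]; exact List.length_pos_of_mem ho
    · rw [horig', hlen]; exact hlt o ho
    · rw [hvals]
      have h4 : (M.map (fun pt => rk ys pt.2)).Perm (L.map (fun i => rk ys (f i).2)) := by
        have := hperm.map (fun pt : ℚ × ℚ => rk ys pt.2)
        rwa [hP, List.map_map] at this
      rw [h4.nodup_iff]
      exact List.Nodup.map_on (fun i hi j hj h => hyinj i hi j hj h) hL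
    · intro v hv
      rw [hvals] at hv
      obtain ⟨z, hz, rfl⟩ := List.mem_map.1 hv
      obtain ⟨i, hi, rfl⟩ := List.mem_map.1 (hperm.mem_iff.1 hz)
      rw [hlen, ← hyl]
      exact rk_lt_length ys (memy i hi)
  refine ⟨hvalid, fun i => rk xs (f i).1, ⟨?_, ?_, ?_⟩, hg.trans ?_⟩
  · rintro i ⟨hi, hio⟩
    refine ⟨by rw [hlen]; exact hlt i hi, fun h => hio ?_⟩
    rw [horig'] at h
    exact hxinj i hi o ho h
  · rintro i ⟨hi, -⟩ j ⟨hj, -⟩ h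
    exact hxinj i hi j hj h
  · rintro k ⟨hk, hk'⟩
    rw [hlen] at hk
    obtain ⟨i, hi, h⟩ := hsurj k hk
    refine ⟨i, ⟨hi, fun hio => hk' ?_⟩, h⟩
    rw [horig', ← h, hio]
  · rintro i ⟨hi, hio⟩ c
    have a1 := hxlt i hi o ho
    have a2 := hxlt o ho i hi
    have a3 := hylt i hi o ho
    have a4 := hylt o ho i hi
    have z1 : (f o).1 = 0 := by rw [hfo]
    have z2 : (f o).2 = 0 := by rw [hfo]
    simp only [z1, z2] at a1 a2 a3 a4
    refine ⟨?_, ?_⟩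
    · cases c <;> simp only [ht, cpt, hov, horig', hval i hi, sub_pos, neg_sub, Nat.cast_lt,
        Left.neg_pos_iff, z1, z2, a1, a2, a3, a4]
    · rintro j ⟨hj, hjo⟩
      cases c <;> simp only [ht, cpt, hov, horig', hval i hi, hval j hj, neg_lt_neg_iff,
        sub_lt_sub_iff_right, Nat.cast_lt, hxlt i hi j hj, hxlt j hj i hi, hylt i hi j hj,
        hylt j hj i hi]

theorem exists_models {s : Set ι} (hs : s.Finite) {f : ι → ℤ × ℤ} (hg : Good s f) :
    ∃ p, Models p s f := by
  classical
  let L : List (Option ι) := none :: hs.toFinset.toList.map some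
  let F : Option ι → ℚ × ℚ := fun a => (((ext f a).1 : ℤ), ((ext f a).2 : ℤ))
  have hL : L.Nodup := by
    simp only [L, List.nodup_cons]
    refine ⟨by simp, ?_⟩
    exact (Finset.nodup_toList _).map (Option.some_injective _)
  have hmem : ∀ a, a ∈ L ↔ a = none ∨ ∃ i ∈ s, a = some i := by
    intro a; simp [L]
    constructor
    · rintro (h | ⟨i, hi, rfl⟩)
      · exact Or.inl h
      · exact Or.inr ⟨i, hi, rfl⟩
    · rintro (h | ⟨i, hi, rfl⟩)
      · exact Or.inl h
      · exact Or.inr ⟨i, hi, rfl⟩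
  have hset : {a | a ∈ L ∧ a ≠ none} = some '' s := by
    ext a
    simp only [mem_ofPred_eq, hmem, mem_image]
    constructor
    · rintro ⟨h | ⟨i, hi, rfl⟩, h2⟩
      · exact absurd h h2
      · exact ⟨i, hi, rfl⟩
    · rintro ⟨i, hi, rfl⟩
      exact ⟨Or.inr ⟨i, hi, rfl⟩, by simp⟩
  have hm : Models (toCPerm (L.map F)) {a | a ∈ L ∧ a ≠ none} (ext f) := by
    refine toCPerm_models hL (o := none) (by simp [L]) (by simp [F, ext]) ?_ ?_ ?_
    · intro a ha b hb h
      simp only [F, Int.cast_inj] at h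
      rcases (hmem a).1 ha with rfl | ⟨i, hi, rfl⟩ <;> rcases (hmem b).1 hb with rfl | ⟨j, hj, rfl⟩
      · rfl
      · exact absurd h.symm (hg j hj .r).1
      · exact absurd h (hg i hi .r).1
      · by_contra hne
        exact (hg i hi .r).2 j hj (fun h => hne (by rw [h])) h.symm
    · intro a ha b hb h
      simp only [F, Int.cast_inj] at h
      rcases (hmem a).1 ha with rfl | ⟨i, hi, rfl⟩ <;> rcases (hmem b).1 hb with rfl | ⟨j, hj, rfl⟩
      · rfl
      · exact absurd h.symm (hg j hj .u).1
      · exact absurd h (hg i hi .u).1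
      · by_contra hne
        exact (hg i hi .u).2 j hj (fun h => hne (by rw [h])) h.symm
    · intro a _ c
      refine ⟨?_, fun b _ => ?_⟩
      · cases c <;> simp [ht, F]
      · cases c <;> simp [ht, F]
  rw [hset] at hm
  refine ⟨_, hm.map (τ := some) (s := s) (f := f) ?_ ?_⟩
  · exact (Option.some_injective ι).injOn.bijOn_image
  · intro i _ c
    exact ⟨Iff.rfl, fun j _ => Iff.rfl⟩

end toc
end PinAux

namespace PinAux
open PinLetter Set

section pins
variable {K K' : Type*} [CommRing K] [LinearOrder K] [IsStrictOrderedRing K]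
  [CommRing K'] [LinearOrder K'] [IsStrictOrderedRing K'] {ι : Type*}

def Alt (d : ℕ → PinLetter) : Prop := ∀ i, (d i).isVert ≠ (d (i + 1)).isVert

theorem ht_opp' (c : PinLetter) (z : K × K) : ht (opp c) z = - ht c z := by
  cases c <;> simp [ht, opp]

theorem opp_opp (c : PinLetter) : opp (opp c) = c := by cases c <;> rfl

theorem opp_ne (c : PinLetter) : opp c ≠ c := by cases c <;> simp [opp]

theorem opp_inj {a b : PinLetter} : opp a = opp b ↔ a = b := by
  cases a <;> cases b <;> simp [opp]

theorem isVert_opp (c : PinLetter) : (opp c).isVert = c.isVert := by cases c <;> rfl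

theorem four {a b : PinLetter} (h : a.isVert ≠ b.isVert) (c : PinLetter) :
    c = a ∨ c = b ∨ c = opp a ∨ c = opp b := by
  revert h; cases a <;> cases b <;> cases c <;> simp [opp, PinLetter.isVert]

theorem four_ne {a b : PinLetter} (h : a.isVert ≠ b.isVert) :
    a ≠ b ∧ a ≠ opp b ∧ opp a ≠ b ∧ opp a ≠ opp b := by
  revert h; cases a <;> cases b <;> simp [opp, PinLetter.isVert]

theorem two {a b : PinLetter} (h : a.isVert = b.isVert) : a = b ∨ a = opp b := by
  revert h; cases a <;> cases b <;> simp [opp, PinLetter.isVert]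

theorem OE_of_rays {s : Set ι} {f : ι → K × K} {g : ι → K' × K'}
    (h1 : ∀ i ∈ s, ∀ c, ht c (f i) ≠ 0) (h2 : ∀ i ∈ s, ∀ c, ht c (g i) ≠ 0)
    (h3 : ∀ i ∈ s, ∀ c, 0 < ht c (f i) ↔ 0 < ht c (g i))
    (h4 : ∀ i ∈ s, ∀ j ∈ s, ∀ c, 0 < ht c (f i) → 0 < ht c (f j) →
      (ht c (f i) < ht c (f j) ↔ ht c (g i) < ht c (g j))) : OE s f g := by
  intro i hi c
  refine ⟨h3 i hi c, fun j hj => ?_⟩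
  have a1 := h3 i hi c
  have a2 := h3 j hj c
  have a3 := h3 i hi (opp c)
  have a4 := h3 j hj (opp c)
  have b1 := h4 i hi j hj c
  have b2 := h4 j hj i hi (opp c)
  have c1 := h1 i hi c
  have c2 := h1 j hj c
  have e1 := h2 i hi c
  have e2 := h2 j hj c
  simp only [ht_opp', neg_lt_neg_iff, Left.neg_pos_iff] at a3 a4 b2
  rcases lt_or_gt_of_ne c1 with p | p <;> rcases lt_or_gt_of_ne c2 with q | q
  · exact b2 q p
  · exact iff_of_true (p.trans q) ((a3.1 p).trans (a2.1 q))
  · exact iff_of_false (q.trans p).not_gt ((a4.1 q).trans (a1.1 p)).not_gt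
  · exact b1 p q

/-- The defining order conditions of a pin sequence. -/
structure Spec (d : ℕ → PinLetter) (f : ℕ → K × K) (n : ℕ) : Prop where
  zero : ∀ c, ht c (f 0) = 0
  exit : ∀ i, 1 ≤ i → i ≤ n → ∀ j < i, ht (d i) (f j) < ht (d i) (f i)
  entry : ∀ i, 1 ≤ i → i ≤ n → ∀ j < i, (j + 1 < i ∨ j = 0) → ht (d (i-1)) (f j) < ht (d (i-1)) (f i)
  sep : ∀ i, 2 ≤ i → i ≤ n → ht (d (i-1)) (f i) < ht (d (i-1)) (f (i-1))

theorem Alt.pred {d : ℕ → PinLetter} (hd : Alt d) {i : ℕ} (hi : 1 ≤ i) :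
    (d (i-1)).isVert ≠ (d i).isVert := by
  have := hd (i - 1)
  rwa [Nat.sub_add_cancel hi] at this

section

theorem Spec.pos {d : ℕ → PinLetter} (hd : Alt d) {f : ℕ → K × K} {n : ℕ} (hs : Spec d f n)
    {i : ℕ} (h1 : 1 ≤ i) (hn : i ≤ n) (c : PinLetter) :
    ht c (f i) ≠ 0 ∧ (0 < ht c (f i) ↔ c = d i ∨ c = d (i-1)) := by
  have e1 := hs.exit i h1 hn 0 (by omega)
  have e2 := hs.entry i h1 hn 0 (by omega) (Or.inr rfl)
  rw [hs.zero] at e1 e2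
  have hp := hd.pred h1
  have h4 := four_ne hp
  rcases four hp c with rfl | rfl | rfl | rfl
  · exact ⟨e2.ne', iff_of_true e2 (Or.inr rfl)⟩
  · exact ⟨e1.ne', iff_of_true e1 (Or.inl rfl)⟩
  · rw [ht_opp']
    refine ⟨neg_ne_zero.2 e2.ne', iff_of_false (by simpa using e2.le) ?_⟩
    rintro (h | h)
    · exact h4.2.2.1 h
    · exact opp_ne _ h
  · rw [ht_opp']
    refine ⟨neg_ne_zero.2 e1.ne', iff_of_false (by simpa using e1.le) ?_⟩
    rintro (h | h)
    · exact opp_ne _ h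
    · exact h4.2.1 h.symm

theorem Spec.cmp {d : ℕ → PinLetter} (hd : Alt d) {f : ℕ → K × K} {n : ℕ} (hs : Spec d f n)
    {i j : ℕ} (h1 : 1 ≤ i) (hij : i < j) (hn : j ≤ n) {c : PinLetter}
    (hi : 0 < ht c (f i)) (hj : 0 < ht c (f j)) :
    ((j = i + 1 ∧ c = d i) ∧ ht c (f j) < ht c (f i)) ∨
    (¬(j = i + 1 ∧ c = d i) ∧ ht c (f i) < ht c (f j)) := by
  rw [(hs.pos hd h1 (by omega) c).2] at hi
  rw [(hs.pos hd (by omega) hn c).2] at hj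
  have h4 := four_ne (hd.pred (i := j) (by omega))
  rcases hj with rfl | rfl
  · right
    refine ⟨?_, hs.exit j (by omega) hn i hij⟩
    rintro ⟨rfl, h⟩
    exact h4.1 h.symm
  · by_cases h : i + 1 = j
    · subst h
      left
      exact ⟨⟨rfl, rfl⟩, hs.sep (i+1) (by omega) hn⟩
    · right
      exact ⟨fun h' => h h'.1.symm, hs.entry j (by omega) hn i hij (Or.inl (by omega))⟩

theorem Spec.ne {d : ℕ → PinLetter} (hd : Alt d) {f : ℕ → K × K} {n : ℕ} (hs : Spec d f n)
    {i j : ℕ} (h1 : i ≤ n) (h2 : j ≤ n) (c : PinLetter) (h : ht c (f i) = ht c (f j)) :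
    i = j := by
  wlog hij : i < j generalizing i j
  · by_contra hne
    exact hne (this h2 h1 h.symm (by omega)).symm
  exfalso
  rcases Nat.eq_zero_or_pos i with rfl | hi
  · rw [hs.zero] at h
    exact (hs.pos hd (by omega) h2 c).1 h.symm
  have key : ∀ c, 0 < ht c (f i) → ht c (f i) = ht c (f j) → False := by
    intro c hc h
    rcases hs.cmp hd hi hij h2 hc (h ▸ hc) with ⟨-, h'⟩ | ⟨-, h'⟩
    · exact h'.ne h.symm
    · exact h'.ne h
  rcases lt_or_gt_of_ne (hs.pos hd hi (by omega) c).1 with hc | hc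
  · refine key (opp c) ?_ ?_
    · rw [ht_opp']; simpa using hc
    · rw [ht_opp', ht_opp', h]
  · exact key c hc h
end

theorem Spec.OE {d : ℕ → PinLetter} (hd : Alt d) {f : ℕ → K × K} {g : ℕ → K' × K'} {n : ℕ}
    (hs : Spec d f n) (hg : Spec d g n) : OE (Icc 1 n) f g := by
  have e : ∀ i ∈ Icc 1 n, ∀ c, (0 < ht c (f i) ↔ 0 < ht c (g i)) := fun i hi c => by
    rw [(hs.pos hd hi.1 hi.2 c).2, (hg.pos hd hi.1 hi.2 c).2]
  refine OE_of_rays (fun i hi c => (hs.pos hd hi.1 hi.2 c).1)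
    (fun i hi c => (hg.pos hd hi.1 hi.2 c).1) e ?_
  intro i hi j hj c hc hc'
  have gc := (e i hi c).1 hc
  have gc' := (e j hj c).1 hc'
  rcases lt_trichotomy i j with h | h | h
  · rcases hs.cmp hd hi.1 h hj.2 hc hc' with ⟨a, a'⟩ | ⟨a, a'⟩ <;>
    rcases hg.cmp hd hi.1 h hj.2 gc gc' with ⟨b, b'⟩ | ⟨b, b'⟩
    · exact iff_of_false a'.not_gt b'.not_gt
    · exact absurd a b
    · exact absurd b a
    · exact iff_of_true a' b'
  · subst h; simp
  · rcases hs.cmp hd hj.1 h hi.2 hc' hc with ⟨a, a'⟩ | ⟨a, a'⟩ <;>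
    rcases hg.cmp hd hj.1 h hi.2 gc' gc with ⟨b, b'⟩ | ⟨b, b'⟩
    · exact iff_of_true a' b'
    · exact absurd a b
    · exact absurd b a
    · exact iff_of_false a'.not_gt b'.not_gt

/-- The explicit integer configuration of a pin sequence. -/
def vec (c : PinLetter) (h : ℤ) : ℤ × ℤ :=
  match c with
  | .u => (0, h)
  | .d => (0, -h)
  | .l => (-h, 0)
  | .r => (h, 0)

def cfg (d : ℕ → PinLetter) : ℕ → ℤ × ℤ
  | 0 => 0
  | i + 1 => vec (d (i+1)) (2 * i + 4) + vec (d i) (2 * i + 1)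

theorem ht_vec (a b c : PinLetter) (h : a.isVert ≠ b.isVert) (x y : ℤ) :
    ht c (vec a x + vec b y) =
      if c = a then x else if c = b then y else if c = opp a then -x else -y := by
  revert h
  cases a <;> cases b <;> cases c <;> simp [ht, vec, opp, PinLetter.isVert]

theorem cfg_spec {d : ℕ → PinLetter} (hd : Alt d) (n : ℕ) : Spec d (cfg d) n := by
  have H : ∀ i c, 1 ≤ i → ht c (cfg d i) = if c = d i then 2 * (i:ℤ) + 2 else
      if c = d (i-1) then 2 * i - 1 else if c = opp (d i) then -(2 * i + 2) else -(2 * i - 1) := by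
    intro i c hi
    obtain ⟨k, rfl⟩ : ∃ k, i = k + 1 := ⟨i - 1, by omega⟩
    simp only [cfg, Nat.add_sub_cancel]
    rw [ht_vec _ _ _ (hd k).symm]
    push_cast
    ring_nf
  have H0 : ∀ c, ht c (cfg d 0) = 0 := by intro c; cases c <;> simp [ht, cfg]
  have H1 : ∀ i c, 1 ≤ i → ht c (cfg d i) ≤ 2 * i + 2 := by
    intro i c hi
    rw [H i c hi]
    split_ifs <;> omega
  refine ⟨H0, ?_, ?_, ?_⟩
  · intro i h1 _ j hj
    rw [H i _ h1, if_pos rfl]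
    rcases Nat.eq_zero_or_pos j with rfl | hj0
    · rw [H0]; positivity
    · have := H1 j (d i) hj0; omega
  · intro i h1 _ j hj hj'
    rw [H i _ h1, if_neg (four_ne (hd.pred h1)).1, if_pos rfl]
    rcases Nat.eq_zero_or_pos j with rfl | hj0
    · rw [H0]; omega
    · have := H1 j (d (i-1)) hj0; omega
  · intro i h1 _
    rw [H i _ (by omega), H (i-1) _ (by omega), if_neg (four_ne (hd.pred (by omega))).1, if_pos rfl, if_pos rfl]
    omega

theorem le_maxOf (l : List ℚ) : 0 ≤ maxOf l ∧ ∀ x ∈ l, x ≤ maxOf l := by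
  induction l with
  | nil => simp [maxOf]
  | cons a l ih =>
    have : maxOf (a :: l) = max a (maxOf l) := rfl
    rw [this]
    refine ⟨le_max_of_le_right ih.1, ?_⟩
    intro x hx
    rcases List.mem_cons.1 hx with rfl | hx
    · exact le_max_left _ _
    · exact le_max_of_le_right (ih.2 x hx)

theorem maxOf_lt (l : List ℚ) {v : ℚ} (h0 : 0 < v) (h : ∀ x ∈ l, x < v) : maxOf l < v := by
  induction l with
  | nil => simpa [maxOf] using h0
  | cons a l ih =>
    have : maxOf (a :: l) = max a (maxOf l) := rfl
    rw [this]
    exact max_lt (h a (by simp)) (ih fun x hx => h x (by simp [hx]))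

theorem minOf_le (l : List ℚ) : minOf l ≤ 0 ∧ ∀ x ∈ l, minOf l ≤ x := by
  induction l with
  | nil => simp [minOf]
  | cons a l ih =>
    have : minOf (a :: l) = min a (minOf l) := rfl
    rw [this]
    refine ⟨min_le_of_right_le ih.1, ?_⟩
    intro x hx
    rcases List.mem_cons.1 hx with rfl | hx
    · exact min_le_left _ _
    · exact min_le_of_right_le (ih.2 x hx)

theorem lt_minOf (l : List ℚ) {v : ℚ} (h0 : v < 0) (h : ∀ x ∈ l, v < x) : v < minOf l := by
  induction l with
  | nil => simpa [minOf] using h0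
  | cons a l ih =>
    have : minOf (a :: l) = min a (minOf l) := rfl
    rw [this]
    exact lt_min (h a (by simp)) (ih fun x hx => h x (by simp [hx]))

def btw (l : List ℚ) (v : ℚ) : ℚ :=
  if maxOf l < v then (v + maxOf l) / 2 else (v + minOf l) / 2

theorem btw_pos (l : List ℚ) {v : ℚ} (h0 : 0 < v) (h : ∀ x ∈ l, x < v) :
    0 < btw l v ∧ (∀ x ∈ l, x < btw l v) ∧ btw l v < v := by
  have h1 := maxOf_lt l h0 h
  have h2 := le_maxOf l
  unfold btw
  rw [if_pos h1]
  refine ⟨by linarith, fun x hx => ?_, by linarith⟩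
  have := h2.2 x hx
  linarith

theorem btw_neg (l : List ℚ) {v : ℚ} (h0 : v < 0) (h : ∀ x ∈ l, v < x) :
    btw l v < 0 ∧ (∀ x ∈ l, btw l v < x) ∧ v < btw l v := by
  have h1 := lt_minOf l h0 h
  have h2 := minOf_le l
  have h3 := le_maxOf l
  unfold btw
  rw [if_neg (by linarith)]
  refine ⟨by linarith, fun x hx => ?_, by linarith⟩
  have := h2.2 x hx
  linarith

def newPt (last : ℚ × ℚ) (rest : List (ℚ × ℚ)) (c : PinLetter) : ℚ × ℚ :=
  match c with
  | .r => (maxOf ((last :: rest).map Prod.fst) + 1, btw (rest.map Prod.snd) last.2)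
  | .l => (minOf ((last :: rest).map Prod.fst) - 1, btw (rest.map Prod.snd) last.2)
  | .u => (btw (rest.map Prod.fst) last.1, maxOf ((last :: rest).map Prod.snd) + 1)
  | .d => (btw (rest.map Prod.fst) last.1, minOf ((last :: rest).map Prod.snd) - 1)

theorem pinStep_eq (last : ℚ × ℚ) (rest : List (ℚ × ℚ)) (c : PinLetter) :
    pinStep (last :: rest) c = newPt last rest c :: last :: rest := by
  cases c <;> rfl

theorem newPt_exit (last : ℚ × ℚ) (rest : List (ℚ × ℚ)) (c : PinLetter) :
    ∀ z ∈ last :: rest, ht c z < ht c (newPt last rest c) := by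
  intro z hz
  have a := (le_maxOf ((last :: rest).map Prod.fst)).2 _ (List.mem_map_of_mem hz)
  have b := (le_maxOf ((last :: rest).map Prod.snd)).2 _ (List.mem_map_of_mem hz)
  have a' := (minOf_le ((last :: rest).map Prod.fst)).2 _ (List.mem_map_of_mem hz)
  have b' := (minOf_le ((last :: rest).map Prod.snd)).2 _ (List.mem_map_of_mem hz)
  cases c <;> simp only [ht, newPt] <;> linarith

theorem newPt_entry (last : ℚ × ℚ) (rest : List (ℚ × ℚ)) {c e : PinLetter}
    (hce : e.isVert ≠ c.isVert) (h0 : 0 < ht e last) (h : ∀ z ∈ rest, ht e z < ht e last) :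
    (∀ z ∈ rest, ht e z < ht e (newPt last rest c)) ∧ ht e (newPt last rest c) < ht e last := by
  have key : newPt last rest c = (btw (rest.map Prod.fst) last.1, (newPt last rest c).2) ∧ (e = l ∨ e = r) ∨
      newPt last rest c = ((newPt last rest c).1, btw (rest.map Prod.snd) last.2) ∧ (e = u ∨ e = PinLetter.d) := by
    revert hce
    cases c <;> cases e <;> simp [newPt, PinLetter.isVert]
  rcases key with ⟨k, rfl | rfl⟩ | ⟨k, rfl | rfl⟩ <;> rw [k] <;> simp only [ht] at *
  · have := btw_neg (rest.map Prod.fst) (v := last.1) (by linarith)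
      (by simp only [List.mem_map]; rintro x ⟨z, hz, rfl⟩; have := h z hz; linarith)
    exact ⟨fun z hz => neg_lt_neg (this.2.1 _ (List.mem_map_of_mem hz)), neg_lt_neg this.2.2⟩
  · have := btw_pos (rest.map Prod.fst) (v := last.1) (by linarith)
      (by simp only [List.mem_map]; rintro x ⟨z, hz, rfl⟩; have := h z hz; linarith)
    exact ⟨fun z hz => (this.2.1 _ (List.mem_map_of_mem hz)), this.2.2⟩
  · have := btw_pos (rest.map Prod.snd) (v := last.2) (by linarith)
      (by simp only [List.mem_map]; rintro x ⟨z, hz, rfl⟩; have := h z hz; linarith)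
    exact ⟨fun z hz => (this.2.1 _ (List.mem_map_of_mem hz)), this.2.2⟩
  · have := btw_neg (rest.map Prod.snd) (v := last.2) (by linarith)
      (by simp only [List.mem_map]; rintro x ⟨z, hz, rfl⟩; have := h z hz; linarith)
    exact ⟨fun z hz => neg_lt_neg (this.2.1 _ (List.mem_map_of_mem hz)), neg_lt_neg this.2.2⟩

/-- The quadrant between two perpendicular rays. -/
def quad (a b : PinLetter) : ℕ :=
  if a = u ∨ b = u then (if a = r ∨ b = r then 1 else 2) else (if a = r ∨ b = r then 4 else 3)

def lets (d : ℕ → PinLetter) (n : ℕ) : List PinLetter := (List.range (n - 1)).map fun i => d (i + 2)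

def pt (d : ℕ → PinLetter) : ℕ → ℚ × ℚ
  | 0 => (0, 0)
  | n + 1 => (pinPts (quad (d 0) (d 1)) (lets d (n+1))).headD (0, 0)

theorem pinPts_eq (d : ℕ → PinLetter) (n : ℕ) :
    pinPts (quad (d 0) (d 1)) (lets d (n+1)) = ((List.range (n + 2)).map (pt d)).reverse := by
  induction n with
  | zero => rfl
  | succ n ih =>
    have e : lets d (n + 1 + 1) = lets d (n+1) ++ [d (n+2)] := by
      simp [lets, List.range_succ]
    have e2 : ((List.range (n + 1 + 2)).map (pt d)).reverse =
        pt d (n+2) :: ((List.range (n + 2)).map (pt d)).reverse := by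
      rw [show n + 1 + 2 = (n + 2) + 1 from rfl, List.range_succ]; simp
    have e3 : pinPts (quad (d 0) (d 1)) (lets d (n + 1 + 1)) =
      pinStep (pinPts (quad (d 0) (d 1)) (lets d (n+1))) (d (n+2)) := by
      rw [e]; simp [pinPts]
    have e4 : pt d (n+2) = (pinPts (quad (d 0) (d 1)) (lets d (n + 1 + 1))).headD (0,0) := rfl
    rw [e2, e4, e3, ih]
    rw [show List.range (n + 2) = List.range (n+1) ++ [n+1] from List.range_succ]
    simp only [List.map_append, List.reverse_append, List.map_cons, List.map_nil,
      List.reverse_cons, List.reverse_nil, List.nil_append, List.cons_append]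
    rw [pinStep_eq]; rfl

theorem pt_succ (d : ℕ → PinLetter) (n : ℕ) :
    pt d (n+2) = newPt (pt d (n+1)) ((List.range (n + 1)).map (pt d)).reverse (d (n+2)) := by
  have h := pinPts_eq d n
  have h2 : pt d (n+2) = (pinStep (pinPts (quad (d 0) (d 1)) (lets d (n+1))) (d (n+2))).headD (0,0) := by
    have e : lets d (n + 1 + 1) = lets d (n+1) ++ [d (n+2)] := by
      simp [lets, List.range_succ]
    show (pinPts (quad (d 0) (d 1)) (lets d (n + 1 + 1))).headD (0,0) = _
    rw [e]; simp [pinPts]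
  rw [h2, h, show List.range (n + 2) = List.range (n+1) ++ [n+1] from List.range_succ]
  simp only [List.map_append, List.reverse_append, List.map_cons, List.map_nil,
      List.reverse_cons, List.reverse_nil, List.nil_append, List.cons_append]
  rw [pinStep_eq]; rfl

theorem firstPt_quad {a b : PinLetter} (h : a.isVert ≠ b.isVert) :
    ht a (firstPt (quad a b)) = 1 ∧ ht b (firstPt (quad a b)) = 1 := by
  revert h
  cases a <;> cases b <;> simp [ht, quad, firstPt, PinLetter.isVert]

theorem pt_spec {d : ℕ → PinLetter} (hd : Alt d) (n : ℕ) : Spec d (pt d) n := by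
  have H0 : ∀ c, ht c (pt d 0) = 0 := by intro c; cases c <;> simp [ht, pt]
  have h1 : ∀ c, c = d 0 ∨ c = d 1 → ht c (pt d 1) = 1 := by
    have := firstPt_quad (hd 0)
    have e : pt d 1 = firstPt (quad (d 0) (d 1)) := rfl
    rintro c (rfl | rfl)
    · rw [e]; exact this.1
    · rw [e]; exact this.2
  induction n with
  | zero => exact ⟨H0, fun i _ _ => by omega, fun i _ _ => by omega, fun i _ _ => by omega⟩
  | succ n ih =>
    rcases Nat.eq_zero_or_pos n with rfl | hn
    · refine ⟨H0, fun i a b j hj => ?_, fun i a b j hj _ => ?_, fun i _ _ => by omega⟩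
      · obtain rfl : i = 1 := by omega
        obtain rfl : j = 0 := by omega
        rw [H0, h1 _ (Or.inr rfl)]; norm_num
      · obtain rfl : i = 1 := by omega
        obtain rfl : j = 0 := by omega
        rw [H0, h1 _ (Or.inl rfl)]; norm_num
    · obtain ⟨m, rfl⟩ : ∃ m, n = m + 1 := ⟨n - 1, by omega⟩
      have e0 := newPt_exit (pt d (m+1)) ((List.range (m + 1)).map (pt d)).reverse (d (m+2))
      have e1 := newPt_entry (pt d (m+1)) ((List.range (m + 1)).map (pt d)).reverse (hd (m+1))
        (by have := ih.exit (m+1) (by omega) le_rfl 0 (by omega); rwa [H0] at this)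
        (by
          simp only [List.mem_reverse, List.mem_map, List.mem_range]
          rintro z ⟨j, hj, rfl⟩
          exact ih.exit (m+1) (by omega) le_rfl j hj)
      rw [← pt_succ] at e0 e1
      have mem : ∀ j < m + 1, pt d j ∈ ((List.range (m + 1)).map (pt d)).reverse := by
        intro j hj
        simp only [List.mem_reverse, List.mem_map, List.mem_range]
        exact ⟨j, hj, rfl⟩
      refine ⟨H0, fun i a b j hj => ?_, fun i a b j hj hj' => ?_, fun i a b => ?_⟩
      · rcases Nat.lt_or_ge i (m+2) with hi | hi
        · exact ih.exit i a (by omega) j hj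
        · obtain rfl : i = m + 2 := by omega
          apply e0
          rcases Nat.lt_or_ge j (m+1) with hj1 | hj1
          · exact List.mem_cons_of_mem _ (mem j hj1)
          · obtain rfl : j = m + 1 := by omega
            exact List.mem_cons_self
      · rcases Nat.lt_or_ge i (m+2) with hi | hi
        · exact ih.entry i a (by omega) j hj hj'
        · obtain rfl : i = m + 2 := by omega
          exact e1.1 _ (mem j (by omega))
      · rcases Nat.lt_or_ge i (m+2) with hi | hi
        · exact ih.sep i a (by omega)
        · obtain rfl : i = m + 2 := by omega
          exact e1.2

/-- The pin permutation of length `n` of an alternating sequence of rays. -/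
def pp (d : ℕ → PinLetter) : ℕ → CPerm
  | 0 => CPerm.trivial
  | n + 1 => pinPerm (quad (d 0) (d 1)) (lets d (n+1))

theorem models_trivial (f : ι → ℤ × ℤ) : Models CPerm.trivial ∅ f := by
  refine ⟨by rw [valid_iff]; simp [CPerm.trivial], fun _ => 0, ?_, fun i hi => absurd hi (by simp)⟩
  have : idx CPerm.trivial = ∅ := by
    ext k; simp [idx, CPerm.trivial]
  rw [this]
  exact bijOn_empty _

theorem pp_models {d : ℕ → PinLetter} (hd : Alt d) (n : ℕ) : Models (pp d n) (Icc 1 n) (cfg d) := by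
  rcases n with _ | n
  · have : Icc 1 0 = (∅ : Set ℕ) := by ext; simp
    rw [this]; exact models_trivial _
  have hs := pt_spec hd (n+1)
  have hset : Icc 1 (n+1) = {i | i ∈ (List.range (n+2)).reverse ∧ i ≠ 0} := by
    ext i; simp; omega
  have hO : OE {i | i ∈ (List.range (n+2)).reverse ∧ i ≠ 0} (cfg d) (pt d) := by
    rw [← hset]; exact Spec.OE hd (cfg_spec hd _) hs
  have := toCPerm_models (L := (List.range (n+2)).reverse) (f := pt d) (o := 0)
    (List.nodup_reverse.2 List.nodup_range) (by simp) rfl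
    (fun i hi j hj h => hs.ne hd (by simp at hi; omega) (by simp at hj; omega) .r h)
    (fun i hi j hj h => hs.ne hd (by simp at hi; omega) (by simp at hj; omega) .u h) hO
  rw [← hset] at this
  rw [List.map_reverse, ← pinPts_eq] at this
  exact this

end pins
end PinAux

namespace PinAux
open PinLetter Set CPerm

section cls
variable {ι : Type*}

theorem Good.mono {s t : Set ι} {f : ι → ℤ × ℤ} (h : Good s f) (hts : t ⊆ s) : Good t f :=
  fun i hi c => ⟨(h i (hts hi) c).1, fun j hj => (h i (hts hi) c).2 j (hts hj)⟩

theorem Before.mono {f : ι → ℤ × ℤ} {s t s' t' : Set ι} (h : Before f s t) (h1 : s' ⊆ s)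
    (h2 : t' ⊆ t) : Before f s' t' := fun i hi j hj => h i (h1 hi) j (h2 hj)

theorem exists_sub {p : CPerm} {s t : Set ι} {f : ι → ℤ × ℤ} (h : Models p s f) (hts : t ⊆ s) :
    ∃ q, Models q t f := exists_models (h.finite.subset hts) (h.good.mono hts)

theorem box_assoc {a b c : CPerm} (ha : a.IsValid) (hb : b.IsValid) (hc : c.IsValid) :
    boxSum (boxSum a b) c = boxSum a (boxSum b c) := by
  have hab := bs_valid ha hb
  have h := models_self (bs_valid hab hc)
  obtain ⟨I, hI, h1, h2, h3⟩ := Models.split hab hc h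
  obtain ⟨J, hJ, h4, h5, h6⟩ := Models.split ha hb h1
  have hd : Disjoint (I \ J) (idx (boxSum (boxSum a b) c) \ I) :=
    Set.disjoint_left.2 fun x hx hx' => hx'.2 hx.1
  have k1 := Models.box h5 h2 hd (h3.mono sdiff_subset le_rfl)
  have k2 := Models.box h4 k1
    (Set.disjoint_left.2 fun x hx hx' => hx'.elim (fun h => h.2 hx) (fun h => h.2 (hJ hx))) (by
      intro i hi j hj c
      rcases hj with hj | hj
      · exact h6 i hi j hj c
      · exact h3 i (hJ hi) j hj c)
  have e : J ∪ (I \ J ∪ idx (boxSum (boxSum a b) c) \ I) = idx (boxSum (boxSum a b) c) := by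
    ext x
    simp only [mem_union, mem_sdiff]
    constructor
    · rintro (h | h | h)
      · exact hI (hJ h)
      · exact hI h.1
      · exact h.1
    · intro h; tauto
  rw [e] at k2
  exact h.uniq k2

theorem trivial_valid : CPerm.trivial.IsValid := (models_trivial (fun _ : ℕ => (0, 0))).1

theorem triv_box {a : CPerm} (ha : a.IsValid) : boxSum CPerm.trivial a = a := by
  have h := models_self ha
  have := Models.box (models_trivial (cpt a)) h (by simp) (fun i hi => absurd hi (by simp))
  rw [empty_union] at this
  exact this.uniq h

theorem box_triv {a : CPerm} (ha : a.IsValid) : boxSum a CPerm.trivial = a := by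
  have h := models_self ha
  have := Models.box h (models_trivial (cpt a)) (by simp) (fun i _ j hj => absurd hj (by simp))
  rw [union_empty] at this
  exact this.uniq h

theorem pp_valid {d : ℕ → PinLetter} (hd : Alt d) (n : ℕ) : (pp d n).IsValid := (pp_models hd n).1

theorem pp_len {d : ℕ → PinLetter} (hd : Alt d) (n : ℕ) : (pp d n).len = n := by
  have := (pp_models hd n).ncard
  rw [← this]
  have : (Icc 1 n : Set ℕ) = (Finset.Icc 1 n : Finset ℕ) := by simp
  rw [this, Set.ncard_coe_finset]; simp

inductive T : CPerm → Prop
  | nil : T CPerm.trivial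
  | snoc {a : CPerm} {d : ℕ → PinLetter} {n : ℕ} : T a → Alt d → 1 ≤ n → T (boxSum a (pp d n))

theorem T.valid {p : CPerm} (h : T p) : p.IsValid := by
  induction h with
  | nil => exact trivial_valid
  | snoc _ hd _ ih => exact bs_valid ih (pp_valid hd _)

theorem T.box {a b : CPerm} (ha : T a) (hb : T b) : T (boxSum a b) := by
  induction hb with
  | nil => rwa [box_triv ha.valid]
  | snoc hb hd hn ih =>
    rw [← box_assoc ha.valid hb.valid (pp_valid hd _)]
    exact T.snoc ih hd hn

theorem T.pp {d : ℕ → PinLetter} (hd : Alt d) (n : ℕ) : T (pp d n) := by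
  rcases n with _ | n
  · exact T.nil
  · have := T.snoc T.nil hd (n := n+1) (by omega)
    rwa [triv_box (pp_valid hd _)] at this

theorem Alt.shift {d : ℕ → PinLetter} (hd : Alt d) (m : ℕ) : Alt (fun i => d (i + m)) := by
  intro i
  have := hd (i + m)
  rwa [show i + m + 1 = i + 1 + m by omega] at this

theorem shift_OE {d : ℕ → PinLetter} (hd : Alt d) (m k : ℕ) :
    OE (Icc 1 k) (cfg fun i => d (i + m)) (fun i => cfg d (i + m)) := by
  have hs := cfg_spec hd (m + k)
  have : Spec (fun i => d (i + m)) (fun i => if i = 0 then 0 else cfg d (i + m)) k := by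
    refine ⟨?_, ?_, ?_, ?_⟩
    · intro c; cases c <;> simp [ht]
    · intro i h1 h2 j hj
      have z : ∀ c, ht c (0 : ℤ × ℤ) = 0 := by intro c; cases c <;> simp [ht]
      rw [if_neg (by omega : ¬ i = 0)]
      split_ifs with h0
      · rw [z, (hs.pos hd (by omega) (by omega) _).2]; left; rfl
      · exact hs.exit (i + m) (by omega) (by omega) _ (by omega)
    · intro i h1 h2 j hj hj'
      have z : ∀ c, ht c (0 : ℤ × ℤ) = 0 := by intro c; cases c <;> simp [ht]
      rw [if_neg (by omega : ¬ i = 0), show i - 1 + m = i + m - 1 by omega]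
      split_ifs with h0
      · rw [z, (hs.pos hd (by omega) (by omega) _).2]; right; rfl
      · exact hs.entry (i + m) (by omega) (by omega) _ (by omega) (by omega)
    · intro i h1 h2
      rw [if_neg (by omega : ¬ i = 0), if_neg (by omega : ¬ i - 1 = 0), show i - 1 + m = i + m - 1 by omega]
      exact hs.sep (i + m) (by omega) (by omega)
  have h := Spec.OE (hd.shift m) (cfg_spec (hd.shift m) k) this
  intro i hi c
  have hi' : i ≠ 0 := by have := hi.1; omega
  have := h i hi c
  simp only [if_neg hi'] at this
  refine ⟨this.1, fun j hj => ?_⟩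
  have hj' : j ≠ 0 := by have := hj.1; omega
  have := this.2 j hj
  simpa only [if_neg hj'] using this

theorem before_gap {d : ℕ → PinLetter} (hd : Alt d) {s t : Set ℕ} {m : ℕ}
    (hs : ∀ i ∈ s, 1 ≤ i ∧ i < m) (ht' : ∀ j ∈ t, m < j) : Before (cfg d) s t := by
  intro i hi j hj c h1 h2
  have a := hs i hi
  have b := ht' j hj
  rcases (cfg_spec hd j).cmp hd a.1 (by omega) le_rfl h1 h2 with h | h
  · omega
  · exact h.2

theorem T_sub_pp (n : ℕ) : ∀ {d : ℕ → PinLetter}, Alt d → ∀ {t : Set ℕ} {p : CPerm}, t ⊆ Icc 1 n →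
    Models p t (cfg d) → T p := by
  induction n using Nat.strong_induction_on with
  | _ n ih =>
    intro d hd t p htn hp
    by_cases hall : t = Icc 1 n
    · rw [hall] at hp
      rw [hp.uniq (pp_models hd n)]
      exact T.pp hd n
    obtain ⟨m, hm, hmt⟩ : ∃ m ∈ Icc 1 n, m ∉ t := by
      by_contra hc
      push Not at hc
      exact hall (htn.antisymm hc)
    have e : {i ∈ t | i < m} ∪ {i ∈ t | m < i} = t := by
      ext i
      simp only [mem_union, mem_ofPred_eq]
      constructor
      · rintro (h | h) <;> exact h.1
      · intro h
        rcases lt_trichotomy i m with h' | h' | h'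
        · exact Or.inl ⟨h, h'⟩
        · exact absurd (h' ▸ h) hmt
        · exact Or.inr ⟨h, h'⟩
    obtain ⟨p1, h1⟩ := exists_sub hp (t := {i ∈ t | i < m}) (fun i hi => hi.1)
    obtain ⟨p2, h2⟩ := exists_sub hp (t := {i ∈ t | m < i}) (fun i hi => hi.1)
    have hb := Models.box h1 h2 (Set.disjoint_left.2 fun i hi hi' => by
      have := hi.2; have := hi'.2; omega) (before_gap hd (m := m)
        (fun i hi => ⟨(htn hi.1).1, hi.2⟩) (fun i hi => hi.2))
    rw [e] at hb
    rw [hp.uniq hb]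
    apply T.box
    · refine ih (m-1) (by have := hm.1; have := hm.2; omega) hd (t := {i ∈ t | i < m}) ?_ h1
      intro i hi
      have := htn hi.1
      exact ⟨this.1, by have := hi.2; omega⟩
    · refine ih (n - m) (by have := hm.1; have := hm.2; omega) (hd.shift m)
        (t := {i | i + m ∈ t ∧ m < i + m}) (p := p2) ?_ ?_
      · rintro i ⟨hi, hi'⟩
        have := htn hi
        exact ⟨by omega, by have := this.2; omega⟩
      · refine h2.map (τ := fun i => i + m) ⟨?_, ?_, ?_⟩ ?_
        · exact fun i hi => hi
        · intro i _ j _ h; simpa using h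
        · rintro j ⟨hj, hj'⟩
          refine ⟨j - m, ⟨?_, ?_⟩, ?_⟩
          · rwa [Nat.sub_add_cancel hj'.le]
          · omega
          · show j - m + m = j
            omega
        · refine (shift_OE hd m (n - m)).mono ?_
          rintro i ⟨hi, hi'⟩
          have := htn hi
          exact ⟨by omega, by have := this.2; omega⟩

theorem T.sub {q : CPerm} (hq : T q) : ∀ {p : CPerm} {s t : Set ι} {f : ι → ℤ × ℤ}, Models q s f → t ⊆ s →
    Models p t f → T p := by
  induction hq with
  | nil =>
    intro p s t f h hts hp
    have : s = ∅ := by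
      have h1 := h.ncard
      have h2 : CPerm.trivial.len = 0 := rfl
      rw [h2] at h1
      exact (Set.ncard_eq_zero h.finite).1 h1
    subst this
    obtain rfl : t = ∅ := subset_empty_iff.1 hts
    rw [hp.uniq (models_trivial f)]
    exact T.nil
  | @snoc a d n ha hd hn ih =>
    intro p s t f h hts hp
    obtain ⟨I, hI, h1, h2, h3⟩ := Models.split ha.valid (pp_valid hd n) h
    obtain ⟨p1, k1⟩ := exists_sub hp (t := t ∩ I) inter_subset_left
    obtain ⟨p2, k2⟩ := exists_sub hp (t := t \ I) sdiff_subset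
    have hb := Models.box k1 k2 (Set.disjoint_left.2 fun i hi hi' => hi'.2 hi.2)
      (h3.mono inter_subset_right (sdiff_subset_sdiff_left hts))
    rw [inter_union_sdiff] at hb
    rw [hp.uniq hb]
    refine T.box (ih h1 inter_subset_right k1) ?_
    obtain ⟨τ, hτ, ho⟩ := h2.iso (pp_models hd n)
    have hsub : t \ I ⊆ s \ I := sdiff_subset_sdiff_left hts
    have hbij : BijOn τ (t \ I) (τ '' (t \ I)) := (hτ.injOn.mono hsub).bijOn_image
    have hg : Good (τ '' (t \ I)) (cfg d) := (pp_models hd n).good.mono (by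
      rintro _ ⟨i, hi, rfl⟩
      exact hτ.mapsTo (hsub hi))
    obtain ⟨p3, k3⟩ := exists_models (k2.finite.image τ) hg
    have : p2 = p3 := k2.iso_eq k3 hbij (ho.mono hsub)
    rw [this]
    refine T_sub_pp n hd ?_ k3
    rintro _ ⟨i, hi, rfl⟩
    exact hτ.mapsTo (hsub hi)

def vlet (q : ℕ) : PinLetter := if q ≤ 2 then u else PinLetter.d
def hlet (q : ℕ) : PinLetter := if q = 1 ∨ q = 4 then r else l

theorem quad_vh {q : ℕ} (h1 : 1 ≤ q) (h2 : q ≤ 4) :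
    quad (vlet q) (hlet q) = q ∧ quad (hlet q) (vlet q) = q ∧ (vlet q).isVert = true ∧
      (hlet q).isVert = false := by
  interval_cases q <;> decide

theorem word_seq {q : ℕ} {ls : List PinLetter} (h : IsPinWord q ls) :
    ∃ d, Alt d ∧ pinPerm q ls = pp d (ls.length + 1) := by
  obtain ⟨h1, h2, h3⟩ := h
  obtain ⟨a1, a2, a3, a4⟩ := quad_vh h1 h2
  have h3' := List.isChain_iff_getElem.1 h3
  set v0 : Bool := (ls.headD u).isVert with hv0
  let e : ℕ → PinLetter := fun i => ls.getD i (if xor v0 (i.bodd) then u else r)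
  have he : ∀ i, (e i).isVert = xor v0 i.bodd := by
    intro i
    by_cases hi : i < ls.length
    · have : e i = ls[i] := by simp [e, hi]
      rw [this]
      clear this
      induction i with
      | zero =>
        cases ls with
        | nil => simp at hi
        | cons a l => simp [hv0]
      | succ i ih =>
        have := h3' i hi
        rw [ih (by omega)] at this
        rw [Nat.bodd_succ]
        revert this
        cases v0 <;> cases i.bodd <;> cases (ls[i+1]).isVert <;> simp
    · have : e i = if xor v0 (i.bodd) then u else r := by
        simp only [e]
        rw [List.getD_eq_default _ _ (by omega)]
      rw [this]
      split_ifs with h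
      · simpa [PinLetter.isVert] using h.symm
      · simp only [PinLetter.isVert]
        simp at h
        simp [h]
  let d : ℕ → PinLetter := fun i => match i with
    | 0 => if v0 then vlet q else hlet q
    | 1 => if v0 then hlet q else vlet q
    | i + 2 => e i
  refine ⟨d, ?_, ?_⟩
  · intro i
    match i with
    | 0 => cases hv : v0 <;> simp [d, a3, a4, hv]
    | 1 =>
      have := he 0
      cases hv : v0 <;> simp [d, a3, a4, hv, this]
    | i + 2 =>
      show (e i).isVert ≠ (e (i+1)).isVert
      rw [he, he, Nat.bodd_succ]
      cases v0 <;> cases i.bodd <;> simp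
  · show pinPerm q ls = pinPerm (quad (d 0) (d 1)) (lets d (ls.length + 1))
    have e1 : quad (d 0) (d 1) = q := by cases hv : v0 <;> simp [d, a1, a2, hv]
    have e2 : lets d (ls.length + 1) = ls := by
      apply List.ext_getElem
      · simp [lets]
      · intro i hi hi'
        simp [lets, d, e, hi']
    rw [e1, e2]

theorem seq_word {d : ℕ → PinLetter} (hd : Alt d) {n : ℕ} (hn : 1 ≤ n) :
    ∃ q ls, IsPinWord q ls ∧ pp d n = pinPerm q ls := by
  obtain ⟨k, rfl⟩ : ∃ k, n = k + 1 := ⟨n - 1, by omega⟩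
  refine ⟨quad (d 0) (d 1), lets d (k+1), ⟨?_, ?_, ?_⟩, rfl⟩
  · unfold quad; split_ifs <;> omega
  · unfold quad; split_ifs <;> omega
  · apply List.isChain_iff_getElem.2
    intro i hi
    simp only [lets, List.getElem_map, List.getElem_range]
    exact hd (i + 2)

theorem boxSumList_snoc {l : List CPerm} (h : ∀ x ∈ l, x.IsValid) {x : CPerm} (hx : x.IsValid) :
    (boxSumList l).IsValid ∧ boxSumList (l ++ [x]) = boxSum (boxSumList l) x := by
  induction l with
  | nil =>
    refine ⟨trivial_valid, ?_⟩
    show boxSum x CPerm.trivial = boxSum CPerm.trivial x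
    rw [box_triv hx, triv_box hx]
  | cons a l ih =>
    have ih := ih (fun x hx => h x (by simp [hx]))
    have ha := h a (by simp)
    refine ⟨bs_valid ha ih.1, ?_⟩
    show boxSum a (boxSumList (l ++ [x])) = boxSum (boxSum a (boxSumList l)) x
    rw [ih.2, box_assoc ha ih.1 hx]

theorem boxSumList_cons (a : CPerm) (l : List CPerm) :
    boxSumList (a :: l) = boxSum a (boxSumList l) := rfl

theorem mem_class {p : CPerm} : p ∈ CompletePinClass ↔ T p := by
  constructor
  · rintro ⟨hp, ws, hws, hle⟩
    have hT : T (boxSumList (ws.map fun w => pinPerm w.1 w.2)) := by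
      clear hle
      induction ws with
      | nil => exact T.nil
      | cons w ws ih =>
        obtain ⟨d, hd, h⟩ := word_seq (hws w (by simp))
        rw [List.map_cons, boxSumList_cons, h]
        exact T.box (T.pp hd _) (ih fun w hw => hws w (by simp [hw]))
    obtain ⟨t, ht', hm⟩ := sub_models hle hp (models_self hT.valid)
    exact hT.sub (models_self hT.valid) ht' hm
  · intro h
    refine ⟨h.valid, ?_⟩
    have : ∃ ws : List (ℕ × List PinLetter), (∀ w ∈ ws, IsPinWord w.1 w.2) ∧
        p = boxSumList (ws.map fun w => pinPerm w.1 w.2) := by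
      induction h with
      | nil => exact ⟨[], by simp, rfl⟩
      | @snoc a d n ha hd hn ih =>
        obtain ⟨ws, h1, h2⟩ := ih
        obtain ⟨q, ls, h3, h4⟩ := seq_word hd hn
        refine ⟨ws ++ [(q, ls)], ?_, ?_⟩
        · intro w hw
          rcases List.mem_append.1 hw with hw | hw
          · exact h1 w hw
          · simp at hw; subst hw; exact h3
        · rw [List.map_append]
          simp only [List.map_cons, List.map_nil]
          rw [(boxSumList_snoc (x := pinPerm q ls) ?_ ?_).2, ← h2, h4]
          · intro x hx
            obtain ⟨w, hw, rfl⟩ := List.mem_map.1 hx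
            obtain ⟨d', hd', h'⟩ := word_seq (h1 w hw)
            rw [h']; exact pp_valid hd' _
          · rw [← h4]; exact pp_valid hd n
    obtain ⟨ws, h1, h2⟩ := this
    exact ⟨ws, h1, h2 ▸ patternLE_refl p⟩

end cls
end PinAux

namespace PinAux
open PinLetter Set CPerm

section fac
variable {ι : Type*}

def Ind (p : CPerm) : Prop := T p ∧ BoxIndecomposable p

theorem len_box {a b : CPerm} (ha : a.IsValid) (hb : b.IsValid) :
    (boxSum a b).len = a.len + b.len := by
  have h := models_self (bs_valid ha hb)
  obtain ⟨I, hI, h1, h2, h3⟩ := Models.split ha hb h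
  rw [← h.ncard, ← h1.ncard, ← h2.ncard, Set.ncard_sdiff hI h1.finite]
  have := Set.ncard_le_ncard hI h.finite
  omega

theorem len_zero {a : CPerm} (ha : a.IsValid) (h : a.len = 0) : a = CPerm.trivial := by
  have h1 := models_self ha
  have h2 := h1.ncard
  rw [h] at h2
  have := (Set.ncard_eq_zero h1.finite).1 h2
  rw [this] at h1
  exact h1.uniq (models_trivial _)

theorem indec_split {p : CPerm} (hp : BoxIndecomposable p) {s : Set ι} {f : ι → ℤ × ℤ}
    (h : Models p s f) {I : Set ι} (hI : I ⊆ s) (hB : Before f I (s \ I)) : I = ∅ ∨ I = s := by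
  obtain ⟨a, ha⟩ := exists_sub h hI
  obtain ⟨b, hb⟩ := exists_sub h (t := s \ I) sdiff_subset
  have hbx := Models.box ha hb disjoint_sdiff_right hB
  rw [union_sdiff_cancel hI] at hbx
  by_contra hc
  push Not at hc
  refine hp.2 ⟨a, b, ha.1, hb.1, ?_, ?_, hbx.uniq h⟩
  · rw [← ha.ncard, Nat.one_le_iff_ne_zero]
    intro h0
    exact Set.nonempty_iff_ne_empty.1 hc.1 ((Set.ncard_eq_zero ha.finite).1 h0)
  · rw [← hb.ncard, Nat.one_le_iff_ne_zero]
    intro h0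
    have := (Set.ncard_eq_zero hb.finite).1 h0
    exact hc.2 (hI.antisymm (sdiff_eq_empty.1 this))

theorem dec_split {p : CPerm} (hl : 1 ≤ p.len) (hp : ¬ BoxIndecomposable p) {s : Set ι} {f : ι → ℤ × ℤ}
    (h : Models p s f) : ∃ I ⊆ s, I ≠ ∅ ∧ I ≠ s ∧ Before f I (s \ I) := by
  unfold BoxIndecomposable at hp
  push Not at hp
  obtain ⟨a, b, ha, hb, h1, h2, rfl⟩ := hp hl
  obtain ⟨I, hI, k1, k2, k3⟩ := Models.split ha hb h
  refine ⟨I, hI, ?_, ?_, k3⟩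
  · rintro rfl
    have := k1.ncard
    simp at this; omega
  · rintro rfl
    have := k2.ncard
    simp at this; omega

/-- All points lie in the quadrant spanned by the rays `v` and `h`. -/
def OneQ (v h : PinLetter) (p : CPerm) : Prop :=
  ∀ k ∈ idx p, 0 < ht v (cpt p k) ∧ 0 < ht h (cpt p k)

theorem oneQ_iff {v h : PinLetter} {p : CPerm} {s : Set ι} {f : ι → ℤ × ℤ} (hm : Models p s f) :
    OneQ v h p ↔ ∀ i ∈ s, 0 < ht v (f i) ∧ 0 < ht h (f i) := by
  obtain ⟨hp, e, he, ho⟩ := hm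
  constructor
  · intro hq i hi
    have := hq (e i) (he.mapsTo hi)
    exact ⟨(ho i hi v).1.2 this.1, (ho i hi h).1.2 this.2⟩
  · intro hq k hk
    obtain ⟨i, hi, rfl⟩ := he.surjOn hk
    have := hq i hi
    exact ⟨(ho i hi v).1.1 this.1, (ho i hi h).1.1 this.2⟩

theorem quad_of {s : Set ι} {f : ι → ℤ × ℤ} (hg : Good s f) {i : ι} (hi : i ∈ s) :
    ∃ v h, (v = u ∨ v = PinLetter.d) ∧ (h = r ∨ h = l) ∧ 0 < ht v (f i) ∧ 0 < ht h (f i) := by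
  have h1 := (hg i hi u).1
  have h2 := (hg i hi r).1
  simp only [ht] at h1 h2
  rcases lt_or_gt_of_ne h1 with a | a <;> rcases lt_or_gt_of_ne h2 with b | b
  · exact ⟨PinLetter.d, l, by simp, by simp, by simpa [ht] using a, by simpa [ht] using b⟩
  · exact ⟨PinLetter.d, r, by simp, by simp, by simpa [ht] using a, by simpa [ht] using b⟩
  · exact ⟨u, l, by simp, by simp, by simpa [ht] using a, by simpa [ht] using b⟩
  · exact ⟨u, r, by simp, by simp, by simpa [ht] using a, by simpa [ht] using b⟩

theorem pos_opp {s : Set ι} {f : ι → ℤ × ℤ} (hg : Good s f) {i : ι} (hi : i ∈ s) {c : PinLetter}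
    (h : ¬ 0 < ht c (f i)) : 0 < ht (opp c) (f i) := by
  have := (hg i hi c).1
  rw [ht_opp']
  have : ht c (f i) < 0 := lt_of_le_of_ne (not_lt.1 h) this
  linarith

theorem not_pos_opp {z : ℤ × ℤ} {c : PinLetter} (h : 0 < ht c z) : ¬ 0 < ht (opp c) z := by
  rw [ht_opp']; linarith

theorem unique_fac {a b a' b' : CPerm} (ha : T a) (hb : Ind b) (ha' : T a') (hb' : Ind b')
    (h : boxSum a b = boxSum a' b') :
    (a = a' ∧ b = b') ∨ ∃ c v w, T c ∧ (v = u ∨ v = PinLetter.d) ∧ (w = r ∨ w = l) ∧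
      OneQ v w b ∧ OneQ (opp v) (opp w) b' ∧ a = boxSum c b' ∧ a' = boxSum c b := by
  obtain ⟨p, hp⟩ : ∃ p, p = boxSum a b := ⟨_, rfl⟩
  have hT : T p := hp ▸ ha.box hb.1
  have hm := models_self hT.valid
  obtain ⟨s, hs⟩ : ∃ s, s = idx p := ⟨_, rfl⟩
  obtain ⟨f, hf⟩ : ∃ f, f = cpt p := ⟨_, rfl⟩
  rw [← hs, ← hf] at hm
  obtain ⟨I, hI, m1, m2, m3⟩ := Models.split ha.valid hb.1.valid (hp ▸ hm)
  obtain ⟨J, hJ, k1, k2, k3⟩ := Models.split ha'.valid hb'.1.valid (h ▸ hp ▸ hm)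
  have e1 := indec_split hb.2 m2 (I := (s \ I) ∩ J) inter_subset_left
    (k3.mono inter_subset_right (fun x hx => ⟨hx.1.1, fun hx' => hx.2 ⟨hx.1, hx'⟩⟩))
  have e2 := indec_split hb'.2 k2 (I := (s \ J) ∩ I) inter_subset_left
    (m3.mono inter_subset_right (fun x hx => ⟨hx.1.1, fun hx' => hx.2 ⟨hx.1, hx'⟩⟩))
  have n1 : (s \ I).Nonempty := by
    rw [Set.nonempty_iff_ne_empty]
    intro h0; have := m2.ncard; rw [h0] at this; simp at this; have := hb.2.1; omega
  have n2 : (s \ J).Nonempty := by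
    rw [Set.nonempty_iff_ne_empty]
    intro h0; have := k2.ncard; rw [h0] at this; simp at this; have := hb'.2.1; omega
  have disj : ∀ x ∈ s \ I, x ∈ J → (∀ y ∈ s \ I, y ∈ J) ∧ (∀ y ∈ s \ J, y ∈ I) := by
    intro x hx hxJ
    have t1 : ∀ y ∈ s \ I, y ∈ J := by
      rcases e1 with e1 | e1
      · exact absurd (show x ∈ (s \ I) ∩ J from ⟨hx, hxJ⟩) (by rw [e1]; simp)
      · intro y hy; rw [← e1] at hy; exact hy.2
    refine ⟨t1, ?_⟩
    intro y hy
    by_contra hyI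
    exact hy.2 (t1 y ⟨hy.1, hyI⟩)
  by_cases hc : ∃ x ∈ s \ I, x ∈ J
  · right
    obtain ⟨x0, hx0, hx0J⟩ := hc
    obtain ⟨d1, d2⟩ := disj x0 hx0 hx0J
    obtain ⟨y0, hy0⟩ := n2
    have noshare : ∀ x ∈ s \ I, ∀ y ∈ s \ J, ∀ c, 0 < ht c (f x) → ¬ 0 < ht c (f y) := by
      intro x hx y hy c hcx hcy
      have q1 := k3 x (d1 x hx) y hy c hcx hcy
      have q2 := m3 y (d2 y hy) x hx c hcy hcx
      omega
    obtain ⟨v, w, hv, hw, hvx, hwx⟩ := quad_of hm.good hx0.1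
    have hy : ∀ y ∈ s \ J, 0 < ht (opp v) (f y) ∧ 0 < ht (opp w) (f y) := fun y hy =>
      ⟨pos_opp hm.good hy.1 (noshare x0 hx0 y hy v hvx), pos_opp hm.good hy.1 (noshare x0 hx0 y hy w hwx)⟩
    have hx : ∀ x ∈ s \ I, 0 < ht v (f x) ∧ 0 < ht w (f x) := by
      intro x hx
      constructor
      · by_contra hcon
        exact noshare x hx y0 hy0 (opp v) (pos_opp hm.good hx.1 hcon) (hy y0 hy0).1
      · by_contra hcon
        exact noshare x hx y0 hy0 (opp w) (pos_opp hm.good hx.1 hcon) (hy y0 hy0).2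
    obtain ⟨c, hcm⟩ := exists_sub hm (t := I ∩ J) (inter_subset_left.trans hI)
    have b1 := Models.box hcm k2 (Set.disjoint_left.2 fun x hx hx' => hx'.2 hx.2)
      (k3.mono inter_subset_right le_rfl)
    have b2 := Models.box hcm m2 (Set.disjoint_left.2 fun x hx hx' => hx'.2 hx.1)
      (m3.mono inter_subset_left le_rfl)
    have u1 : I ∩ J ∪ s \ J = I := by
      ext x
      constructor
      · rintro (h | h)
        · exact h.1
        · exact d2 x h
      · intro h
        by_cases hxJ : x ∈ J
        · exact Or.inl ⟨h, hxJ⟩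
        · exact Or.inr ⟨hI h, hxJ⟩
    have u2 : I ∩ J ∪ s \ I = J := by
      ext x
      constructor
      · rintro (h | h)
        · exact h.2
        · exact d1 x h
      · intro h
        by_cases hxI : x ∈ I
        · exact Or.inl ⟨hxI, h⟩
        · exact Or.inr ⟨hJ h, hxI⟩
    rw [u1] at b1
    rw [u2] at b2
    exact ⟨c, v, w, hT.sub hm (inter_subset_left.trans hI) hcm, hv, hw, (oneQ_iff m2).2 hx,
      (oneQ_iff k2).2 hy, m1.uniq b1, k1.uniq b2⟩
  · left
    push Not at hc
    have hIJ : I = J := by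
      ext x
      constructor
      · intro hxI
        by_contra hxJ
        rcases e2 with e2 | e2
        · exact absurd (show x ∈ (s \ J) ∩ I from ⟨⟨hI hxI, hxJ⟩, hxI⟩) (by rw [e2]; simp)
        · obtain ⟨z, hz⟩ := n1
          have hz' : z ∈ s \ J := ⟨hz.1, hc z hz⟩
          rw [← e2] at hz'
          exact hz.2 hz'.2
      · intro hxJ
        by_contra hxI
        exact hc x ⟨hJ hxJ, hxI⟩ hxJ
    subst hIJ
    exact ⟨m1.uniq k1, m2.uniq k2⟩

theorem box_comm {c b b' : CPerm} (hc : c.IsValid) (hb : b.IsValid) (hb' : b'.IsValid)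
    {v w : PinLetter} (hvw : v.isVert ≠ w.isVert) (h1 : OneQ v w b) (h2 : OneQ (opp v) (opp w) b') :
    boxSum (boxSum c b) b' = boxSum (boxSum c b') b := by
  have hm := models_self (bs_valid (bs_valid hc hb) hb')
  obtain ⟨s, hs⟩ : ∃ s, s = idx (boxSum (boxSum c b) b') := ⟨_, rfl⟩
  obtain ⟨f, hf⟩ : ∃ f, f = cpt (boxSum (boxSum c b) b') := ⟨_, rfl⟩
  rw [← hs, ← hf] at hm
  obtain ⟨I, hI, m1, m2, m3⟩ := Models.split (bs_valid hc hb) hb' hm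
  obtain ⟨J, hJ, k1, k2, k3⟩ := Models.split hc hb m1
  have q1 := (oneQ_iff k2).1 h1
  have q2 := (oneQ_iff m2).1 h2
  have ns : ∀ x ∈ I \ J, ∀ y ∈ s \ I, ∀ c, 0 < ht c (f x) → ¬ 0 < ht c (f y) := by
    intro x hx y hy c hcx hcy
    obtain ⟨a1, a2⟩ := q1 x hx
    obtain ⟨a3, a4⟩ := q2 y hy
    rw [ht_opp'] at a3 a4
    rcases four hvw c with rfl | rfl | rfl | rfl
    · linarith
    · linarith
    · rw [ht_opp'] at hcx; linarith
    · rw [ht_opp'] at hcx; linarith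
  have b1 := Models.box k1 m2 (Set.disjoint_left.2 fun x hx hx' => hx'.2 (hJ hx)) (m3.mono hJ le_rfl)
  have b2 := Models.box b1 k2 (Set.disjoint_left.2 fun x hx hx' => by
      rcases hx with hx | hx
      · exact hx'.2 hx
      · exact hx.2 hx'.1) (by
      intro i hi j hj c hci hcj
      rcases hi with hi | hi
      · exact k3 i hi j hj c hci hcj
      · exact absurd hci (ns j hj i hi c hcj))
  have e : J ∪ s \ I ∪ I \ J = s := by
    ext x
    simp only [mem_union, mem_sdiff]
    constructor
    · rintro ((h | h) | h)
      · exact hI (hJ h)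
      · exact h.1
      · exact hI h.1
    · tauto
  rw [e] at b2
  exact hm.uniq b2

theorem exists_fac (n : ℕ) : ∀ {p : CPerm}, T p → p.len = n → 1 ≤ n →
    ∃ a b, T a ∧ Ind b ∧ p = boxSum a b := by
  induction n using Nat.strong_induction_on with
  | _ n ih =>
    intro p hp hn h1
    by_cases hi : BoxIndecomposable p
    · exact ⟨CPerm.trivial, p, T.nil, ⟨hp, hi⟩, (triv_box hp.valid).symm⟩
    · unfold BoxIndecomposable at hi
      push Not at hi
      obtain ⟨a, b, ha, hb, l1, l2, rfl⟩ := hi (by omega)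
      have hm := models_self hp.valid
      obtain ⟨I, hI, k1, k2, k3⟩ := Models.split ha hb hm
      have Ta : T a := hp.sub hm hI k1
      have Tb : T b := hp.sub hm sdiff_subset k2
      rw [len_box ha hb] at hn
      obtain ⟨b1, b2, t1, t2, rfl⟩ := ih b.len (by omega) Tb rfl l2
      exact ⟨boxSum a b1, b2, Ta.box t1, t2, (box_assoc ha t1.valid t2.1.valid).symm⟩

theorem box_left_T {a b : CPerm} (ha : a.IsValid) (hb : b.IsValid) (h : T (boxSum a b)) : T a ∧ T b := by
  obtain ⟨I, hI, k1, k2, k3⟩ := Models.split ha hb (models_self h.valid)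
  exact ⟨h.sub (models_self h.valid) hI k1, h.sub (models_self h.valid) sdiff_subset k2⟩

theorem Ind.pp {b : CPerm} (hb : Ind b) : ∃ d, Alt d ∧ b = pp d b.len := by
  obtain ⟨ht, hi⟩ := hb
  cases ht with
  | nil => exact absurd hi.1 (by simp [CPerm.len, CPerm.trivial])
  | @snoc a d n ha hd hn =>
    refine ⟨d, hd, ?_⟩
    have h0 : a.len = 0 := by
      by_contra h0
      exact hi.2 ⟨a, PinAux.pp d n, ha.valid, pp_valid hd n, by omega, by rw [pp_len hd]; exact hn, rfl⟩
    have := len_zero ha.valid h0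
    subst this
    rw [triv_box (pp_valid hd n), pp_len hd]

/-- Counting by size. -/
noncomputable def cnt {α : Type*} (A : Set α) (ℓ : α → ℕ) (n : ℕ) : ℕ := {a | a ∈ A ∧ ℓ a = n}.ncard

theorem cnt_prod {α β : Type*} {A : Set α} {B : Set β} {ℓ : α → ℕ} {ℓ' : β → ℕ}
    (hA : ∀ n, {a | a ∈ A ∧ ℓ a = n}.Finite) (hB : ∀ n, {a | a ∈ B ∧ ℓ' a = n}.Finite) :
    (∀ n, {x | x ∈ A ×ˢ B ∧ ℓ x.1 + ℓ' x.2 = n}.Finite) ∧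
    ∀ n, cnt (A ×ˢ B) (fun x => ℓ x.1 + ℓ' x.2) n =
      ∑ ij ∈ Finset.HasAntidiagonal.antidiagonal n, cnt A ℓ ij.1 * cnt B ℓ' ij.2 := by
  classical
  have key : ∀ n, {x | x ∈ A ×ˢ B ∧ ℓ x.1 + ℓ' x.2 = n} =
    ((Finset.HasAntidiagonal.antidiagonal n).biUnion fun ij => (hA ij.1).toFinset ×ˢ (hB ij.2).toFinset : Finset (α × β)) := by
    intro n
    ext ⟨a, b⟩
    simp only [mem_prod, mem_ofPred_eq, Finset.coe_biUnion, Finset.mem_coe, Finset.HasAntidiagonal.mem_antidiagonal,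
      Finset.coe_product, Finite.coe_toFinset, mem_iUnion, exists_prop, Prod.exists]
    constructor
    · rintro ⟨⟨h1, h2⟩, h3⟩
      exact ⟨_, _, h3, ⟨h1, rfl⟩, ⟨h2, rfl⟩⟩
    · rintro ⟨i, j, h, ⟨h1, rfl⟩, ⟨h2, rfl⟩⟩
      exact ⟨⟨h1, h2⟩, h⟩
  refine ⟨fun n => by rw [key]; exact Finset.finite_toSet _, fun n => ?_⟩
  unfold cnt
  rw [key, Set.ncard_coe_finset, Finset.card_biUnion]
  · apply Finset.sum_congr rfl
    intro ij _
    rw [Finset.card_product, Set.ncard_eq_toFinset_card _ (hA ij.1), Set.ncard_eq_toFinset_card _ (hB ij.2)]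
  · intro x _ y _ hxy
    refine Finset.disjoint_left.2 ?_
    rintro ⟨a, b⟩ h1 h2
    simp only [Finset.mem_product, Finite.mem_toFinset, mem_ofPred_eq] at h1 h2
    exact hxy (Prod.ext (h1.1.2.symm.trans h2.1.2) (h1.2.2.symm.trans h2.2.2))

theorem finite_len (A : Set CPerm) (hA : ∀ p ∈ A, p.IsValid) (n : ℕ) : {p | p ∈ A ∧ p.len = n}.Finite := by
  let F : List ℕ × ℕ → CPerm := fun x => ⟨x.1, x.2⟩
  refine (((List.finite_toSet (List.range (n+1)).permutations).prod (Set.finite_Iio (n+1))).image F).subset ?_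
  rintro p ⟨hp, hl⟩
  obtain ⟨h1, h2, h3⟩ := hA p hp
  have : p.vals.length = n + 1 := by
    have := List.length_pos_iff.2 h1
    unfold CPerm.len at hl; omega
  refine ⟨(p.vals, p.origin), ⟨?_, ?_⟩, rfl⟩
  · show p.vals ∈ (List.range (n+1)).permutations
    rw [List.mem_permutations, ← this]; exact h3
  · show p.origin < n + 1
    omega

def SS : Set CPerm := {p | T p}
def GG : Set CPerm := {p | Ind p}
def QQ (v w : PinLetter) : Set CPerm := {p | Ind p ∧ OneQ v w p}

theorem cnt_recurrence (n : ℕ) (hn : 1 ≤ n) :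
    cnt SS len n + (cnt (SS ×ˢ (QQ u r ×ˢ QQ d l)) (fun x => x.1.len + (x.2.1.len + x.2.2.len)) n +
      cnt (SS ×ˢ (QQ u l ×ˢ QQ d r)) (fun x => x.1.len + (x.2.1.len + x.2.2.len)) n) =
    cnt (SS ×ˢ GG) (fun x => x.1.len + x.2.len) n := by
  have fS := finite_len SS (fun p hp => T.valid hp)
  have fG := finite_len GG (fun p hp => T.valid hp.1)
  have fQ := fun v w => finite_len (QQ v w) (fun p hp => T.valid hp.1.1)
  have fE1 := (cnt_prod (ℓ := len) (ℓ' := len) fS fG).1 n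
  have fE2 := fun v w v' w' => (cnt_prod (ℓ := len) (ℓ' := fun x : CPerm × CPerm => x.1.len + x.2.len) fS
    (cnt_prod (fQ v w) (fQ v' w')).1).1 n
  unfold cnt
  set E1 := {x : CPerm × CPerm | x ∈ SS ×ˢ GG ∧ x.1.len + x.2.len = n} with hE1
  set E2 := {x : CPerm × CPerm × CPerm | x ∈ SS ×ˢ (QQ u r ×ˢ QQ d l) ∧ x.1.len + (x.2.1.len + x.2.2.len) = n} with hE2
  set E3 := {x : CPerm × CPerm × CPerm | x ∈ SS ×ˢ (QQ u l ×ˢ QQ d r) ∧ x.1.len + (x.2.1.len + x.2.2.len) = n} with hE3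
  have nonem : ∀ p, Ind p → ∃ k, k ∈ idx p := by
    intro p hp
    by_contra hc
    push Not at hc
    have h0 : idx p = ∅ := Set.eq_empty_iff_forall_notMem.2 hc
    have := (models_self hp.1.valid).ncard
    rw [h0] at this
    have := hp.2.1
    simp at *; omega
  have clash : ∀ {v w v' w' p}, Ind p → OneQ v w p → OneQ v' w' p → v' ≠ opp v ∧ w' ≠ opp w := by
    intro v w v' w' p hp h1 h2
    obtain ⟨k, hk⟩ := nonem p hp
    constructor
    · rintro rfl; exact not_pos_opp (h1 k hk).1 (h2 k hk).1
    · rintro rfl; exact not_pos_opp (h1 k hk).2 (h2 k hk).2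
  have hd : Disjoint E2 E3 := by
    rw [Set.disjoint_left]
    rintro ⟨c, b1, b2⟩ ⟨⟨-, h1, -⟩, -⟩ ⟨⟨-, h2, -⟩, -⟩
    exact (clash h1.1 h1.2 h2.2).2 rfl
  have hE : ∀ x ∈ E2 ∪ E3, ∃ w, (w = r ∨ w = l) ∧ T x.1 ∧ (Ind x.2.1 ∧ OneQ u w x.2.1) ∧
      (Ind x.2.2 ∧ OneQ PinLetter.d (opp w) x.2.2) ∧ x.1.len + (x.2.1.len + x.2.2.len) = n := by
    rintro ⟨c, b1, b2⟩ (⟨⟨h1, h2, h3⟩, h⟩ | ⟨⟨h1, h2, h3⟩, h⟩)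
    · exact ⟨r, Or.inl rfl, h1, h2, h3, h⟩
    · exact ⟨l, Or.inr rfl, h1, h2, h3, h⟩
  have hE' : ∀ c b1 b2 w, (w = r ∨ w = l) → T c → Ind b1 → OneQ u w b1 → Ind b2 →
      OneQ PinLetter.d (opp w) b2 → c.len + (b1.len + b2.len) = n → (c, b1, b2) ∈ E2 ∪ E3 := by
    rintro c b1 b2 w (rfl | rfl) h1 h2 h3 h4 h5 h6
    · exact Or.inl ⟨⟨h1, ⟨h2, h3⟩, ⟨h4, h5⟩⟩, h6⟩
    · exact Or.inr ⟨⟨h1, ⟨h2, h3⟩, ⟨h4, h5⟩⟩, h6⟩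
  let j : CPerm × CPerm × CPerm → CPerm × CPerm := fun x => (boxSum x.1 x.2.1, x.2.2)
  have jinj : InjOn j (E2 ∪ E3) := by
    rintro ⟨c, b1, b2⟩ hx ⟨c', b1', b2'⟩ hx' heq
    simp only [j, Prod.mk.injEq] at heq
    obtain ⟨e1, rfl⟩ := heq
    obtain ⟨w, hw, t1, t2, t3, -⟩ := hE _ hx
    obtain ⟨w', hw', t1', t2', t3', -⟩ := hE _ hx'
    have hww : w = w' := by
      have := (clash t3.1 t3.2 t3'.2).2
      rw [opp_opp] at this
      rcases hw with rfl | rfl <;> rcases hw' with rfl | rfl <;> simp_all [opp]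
    subst hww
    rcases unique_fac t1 t2.1 t1' t2'.1 e1 with ⟨rfl, rfl⟩ | ⟨c0, v0, w0, -, h1, h2, h3, h4, -, -⟩
    · rfl
    · exfalso
      have a1 := clash t2.1 t2.2 h3
      have a2 := clash t2'.1 t2'.2 h4
      exact a2.1 (by rcases h1 with rfl | rfl <;> simp_all [opp])
  have jE1 : j '' (E2 ∪ E3) ⊆ E1 := by
    rintro _ ⟨⟨c, b1, b2⟩, hx, rfl⟩
    obtain ⟨w, hw, t1, t2, t3, h⟩ := hE _ hx
    refine ⟨⟨t1.box t2.1.1, t3.1⟩, ?_⟩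
    show (boxSum c b1).len + b2.len = n
    rw [len_box t1.valid t2.1.1.valid]
    have h' : c.len + (b1.len + b2.len) = n := h
    rw [add_assoc]; exact h'
  have bij : BijOn (fun x : CPerm × CPerm => boxSum x.1 x.2) (E1 \ j '' (E2 ∪ E3)) {p | p ∈ SS ∧ p.len = n} := by
    refine ⟨?_, ?_, ?_⟩
    · rintro ⟨a, b⟩ ⟨⟨⟨h1, h2⟩, h3⟩, -⟩
      exact ⟨T.box h1 h2.1, by rw [len_box h1.valid h2.1.valid]; exact h3⟩
    · have key : ∀ a b a' b', (a, b) ∈ E1 → (a, b) ∉ j '' (E2 ∪ E3) → T a' → Ind b' →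
          boxSum a b = boxSum a' b' → (a = a' ∧ b = b') ∨ ∃ w, OneQ u w b ∧ OneQ PinLetter.d (opp w) b' := by
        rintro a b a' b' ⟨⟨h1, h2⟩, h3⟩ hn h1' h2' heq
        rcases unique_fac h1 h2 h1' h2' heq with h | ⟨c, v, w, tc, hv, hw, q1, q2, rfl, rfl⟩
        · exact Or.inl h
        · right
          rcases hv with rfl | rfl
          · exact ⟨w, q1, q2⟩
          · exfalso
            refine hn ⟨(c, b', b), hE' c b' b (opp w) ?_ tc h2' q2 h2 ?_ ?_, rfl⟩
            · rcases hw with rfl | rfl <;> simp [opp]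
            · rwa [opp_opp]
            · simp only [len_box tc.valid h2'.1.valid] at h3; omega
      rintro ⟨a, b⟩ ⟨hab, hj⟩ ⟨a', b'⟩ ⟨hab', hj'⟩ heq
      simp only at heq
      rcases key a b a' b' hab hj hab'.1.1 hab'.1.2 heq with ⟨rfl, rfl⟩ | ⟨w, q1, q2⟩
      · rfl
      · rcases key a' b' a b hab' hj' hab.1.1 hab.1.2 heq.symm with ⟨rfl, rfl⟩ | ⟨w', q1', q2'⟩
        · rfl
        · exact absurd rfl (clash hab.1.2 q1 q2').1
    · rintro p ⟨hp, hl⟩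
      obtain ⟨a, b, ta, tb, rfl⟩ := exists_fac n hp hl hn
      have hl' := hl
      rw [len_box ta.valid tb.1.valid] at hl'
      by_cases hj : (a, b) ∈ j '' (E2 ∪ E3)
      · obtain ⟨⟨c, b1, b2⟩, hx, heq⟩ := hj
        simp only [j, Prod.mk.injEq] at heq
        obtain ⟨rfl, rfl⟩ := heq
        obtain ⟨w, hw, t1, t2, t3, h⟩ := hE _ hx
        simp only at t1 t2 t3 h
        refine ⟨(boxSum c b2, b1), ⟨⟨⟨t1.box t3.1.1, t2.1⟩, ?_⟩, ?_⟩, ?_⟩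
        · show (boxSum c b2).len + b1.len = n
          rw [len_box t1.valid t3.1.1.valid]; omega
        · rintro ⟨⟨c', b1', b2'⟩, hx', heq⟩
          simp only [j, Prod.mk.injEq] at heq
          obtain ⟨-, rfl⟩ := heq
          obtain ⟨w', hw', -, -, t3', -⟩ := hE _ hx'
          exact absurd rfl (clash t2.1 t2.2 t3'.2).1
        · refine (box_comm t1.valid t2.1.1.valid t3.1.1.valid (v := u) (w := w) ?_ t2.2 t3.2).symm
          rcases hw with rfl | rfl <;> simp [PinLetter.isVert]
      · exact ⟨(a, b), ⟨⟨⟨ta, tb⟩, hl'⟩, hj⟩, rfl⟩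
  have fU : (E2 ∪ E3).Finite := (fE2 u r PinLetter.d l).union (fE2 u l PinLetter.d r)
  rw [← bij.image_eq, bij.injOn.ncard_image, ← Set.ncard_union_eq hd (fE2 u r PinLetter.d l) (fE2 u l PinLetter.d r),
    ← jinj.ncard_image, Set.ncard_sdiff_add_ncard_of_subset jE1 fE1]

end fac
end PinAux

namespace PinAux
open PinLetter Set CPerm

section comb

/-- Point `i` of the pin sequence is positive on the ray `c`. -/
def On (d : ℕ → PinLetter) (i : ℕ) (c : PinLetter) : Prop := c = d i ∨ c = d (i - 1)

/-- Order of the points along the ray `c`. -/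
def Lt (d : ℕ → PinLetter) (c : PinLetter) (i j : ℕ) : Prop :=
  (i < j ∧ ¬ (j = i + 1 ∧ c = d i)) ∨ (i = j + 1 ∧ c = d j)

theorem cfg_on {d : ℕ → PinLetter} (hd : Alt d) {i : ℕ} (hi : 1 ≤ i) (c : PinLetter) :
    0 < ht c (cfg d i) ↔ On d i c := ((cfg_spec hd i).pos hd hi le_rfl c).2

theorem cfg_lt {d : ℕ → PinLetter} (hd : Alt d) {i j : ℕ} (hi : 1 ≤ i) (hj : 1 ≤ j) {c : PinLetter}
    (h1 : On d i c) (h2 : On d j c) : ht c (cfg d i) < ht c (cfg d j) ↔ Lt d c i j := by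
  rw [← cfg_on hd hi] at h1
  rw [← cfg_on hd hj] at h2
  unfold Lt
  rcases lt_trichotomy i j with h | rfl | h
  · rcases (cfg_spec hd j).cmp hd hi h le_rfl h1 h2 with ⟨a, b⟩ | ⟨a, b⟩
    · refine iff_of_false b.not_gt ?_
      rintro (⟨_, h'⟩ | ⟨h', _⟩)
      · exact h' a
      · omega
    · exact iff_of_true b (Or.inl ⟨h, a⟩)
  · refine iff_of_false (lt_irrefl _) ?_
    rintro (⟨h', _⟩ | ⟨h', _⟩) <;> omega
  · rcases (cfg_spec hd i).cmp hd hj h le_rfl h2 h1 with ⟨a, b⟩ | ⟨a, b⟩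
    · exact iff_of_true b (Or.inr a)
    · refine iff_of_false b.not_gt ?_
      rintro (⟨h', _⟩ | h')
      · omega
      · exact a h'

theorem vert_par {d : ℕ → PinLetter} (hd : Alt d) (i : ℕ) : (d i).isVert = xor (decide (i % 2 = 1)) (d 0).isVert := by
  induction i with
  | zero => simp
  | succ k ih =>
    have := hd k
    rw [ih] at this
    have h2 : decide ((k+1) % 2 = 1) = !decide (k % 2 = 1) := by
      by_cases h : k % 2 = 1
      · have : (k+1) % 2 = 0 := by omega
        simp [h, this]
      · have : (k+1) % 2 = 1 := by omega
        simp [h, this]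
    rw [h2]
    revert this
    cases decide (k % 2 = 1) <;> cases (d 0).isVert <;> cases (d (k+1)).isVert <;> simp

theorem Alt.eo {d : ℕ → PinLetter} (hd : Alt d) {i j : ℕ} (h : i % 2 = j % 2) : d i = d j ∨ d i = opp (d j) := by
  apply two
  rw [vert_par hd i, vert_par hd j, h]

theorem Alt.ne {d : ℕ → PinLetter} (hd : Alt d) {i j : ℕ} (h : i % 2 ≠ j % 2) :
    d i ≠ d j ∧ d i ≠ opp (d j) := by
  have : (d i).isVert ≠ (d j).isVert := by
    rw [vert_par hd i, vert_par hd j]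
    rcases Nat.mod_two_eq_zero_or_one i with a | a <;> rcases Nat.mod_two_eq_zero_or_one j with b | b <;>
      simp_all
  exact ⟨(four_ne this).1, (four_ne this).2.1⟩

/-- Among same-parity letters, different means opposite. -/
theorem Alt.opp_of {d : ℕ → PinLetter} (hd : Alt d) {i j : ℕ} (h : i % 2 = j % 2) (hne : d i ≠ d j) :
    d i = opp (d j) := (hd.eo h).resolve_left hne

def Fl (t n k : ℕ) : Prop :=
  match t with
  | 0 => 2 ≤ k
  | 1 => n ≤ k + 1
  | _ => 2 ≤ k ∧ k + 1 ≤ n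

instance (t n k : ℕ) : Decidable (Fl t n k) := by
  unfold Fl; split <;> infer_instance

def Fam (t : ℕ) (d : ℕ → PinLetter) (n : ℕ) : Prop :=
  ∀ k ≤ n, d k = if Fl t n k then opp (d (k % 2)) else d (k % 2)

theorem before_iff {d : ℕ → PinLetter} (hd : Alt d) {n : ℕ} {I J : Set ℕ} (hI : I ⊆ Icc 1 n) (hJ : J ⊆ Icc 1 n) :
    Before (cfg d) I J ↔ ∀ i ∈ I, ∀ j ∈ J, ∀ c, On d i c → On d j c → Lt d c i j := by
  constructor
  · intro h i hi j hj c h1 h2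
    exact (cfg_lt hd (hI hi).1 (hJ hj).1 h1 h2).1
      (h i hi j hj c ((cfg_on hd (hI hi).1 c).2 h1) ((cfg_on hd (hJ hj).1 c).2 h2))
  · intro h i hi j hj c h1 h2
    rw [cfg_on hd (hI hi).1] at h1
    rw [cfg_on hd (hJ hj).1] at h2
    exact (cfg_lt hd (hI hi).1 (hJ hj).1 h1 h2).2 (h i hi j hj c h1 h2)

/-- Decomposability of a pin permutation in terms of a cut. -/
theorem dec_iff {d : ℕ → PinLetter} (hd : Alt d) {n : ℕ} (hn : 1 ≤ n) :
    ¬ BoxIndecomposable (pp d n) ↔ ∃ m, 2 ≤ m ∧ m ≤ n ∧ ∀ i j c, 1 ≤ j → j < m → m ≤ i → i ≤ n →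
      On d i c → On d j c → i = j + 1 ∧ c = d j := by
  have hm := pp_models hd n
  constructor
  · intro h
    obtain ⟨I, hI, hne, hne', hB⟩ := dec_split (by rw [pp_len hd]; exact hn) h hm
    rw [before_iff hd hI sdiff_subset] at hB
    have hsucc : ∀ i, i ∈ I → i + 1 ≤ n → i + 1 ∈ I := by
      intro i hi hin
      by_contra hc
      have := hB i hi (i+1) ⟨⟨by omega, hin⟩, hc⟩ (d i) (Or.inl rfl) (Or.inr (by simp))
      rcases this with ⟨_, h⟩ | ⟨h, _⟩
      · exact h ⟨rfl, rfl⟩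
      · omega
    classical
    have hex : ∃ m, m ∈ I := Set.nonempty_iff_ne_empty.2 hne
    set m := Nat.find hex with hmdef
    have hmI : m ∈ I := Nat.find_spec hex
    have hlt : ∀ j < m, j ∉ I := fun j hj => Nat.find_min hex hj
    have hge : ∀ k, m + k ≤ n → m + k ∈ I := by
      intro k
      induction k with
      | zero => exact fun _ => hmI
      | succ k ih => intro h; exact hsucc _ (ih (by omega)) (by omega)
    have hm1 := hI hmI
    refine ⟨m, ?_, hm1.2, ?_⟩
    · by_contra hc
      have h1 : m = 1 := by have := hm1.1; omega
      apply hne'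
      refine hI.antisymm fun k hk => ?_
      have := hge (k - m) (by have := hk.1; have := hk.2; omega)
      rwa [show m + (k - m) = k by have := hk.1; omega] at this
    · intro i j c h1 h2 h3 h4 o1 o2
      have hi : i ∈ I := by
        have := hge (i - m) (by omega)
        rwa [show m + (i - m) = i by omega] at this
      rcases hB i hi j ⟨⟨h1, by omega⟩, hlt j h2⟩ c o1 o2 with ⟨h, _⟩ | h
      · omega
      · exact h
  · rintro ⟨m, h2, hmn, h⟩ hi
    have hI : Icc m n ⊆ Icc 1 n := Icc_subset_Icc_left (by omega)
    have hB : Before (cfg d) (Icc m n) (Icc 1 n \ Icc m n) := by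
      rw [before_iff hd hI sdiff_subset]
      intro i hi j hj c o1 o2
      refine Or.inr (h i j c hj.1.1 ?_ hi.1 hi.2 o1 o2)
      by_contra hc
      exact hj.2 ⟨by omega, hj.1.2⟩
    rcases indec_split hi hm hI hB with h' | h'
    · have : m ∈ Icc m n := ⟨le_rfl, hmn⟩
      rw [h'] at this; exact this
    · have : 1 ∈ Icc 1 n := ⟨le_rfl, hn⟩
      rw [← h'] at this
      have := this.1; omega

theorem ind_iff {d : ℕ → PinLetter} (hd : Alt d) {n : ℕ} (hn : 2 ≤ n) :
    BoxIndecomposable (pp d n) ↔ ¬ Fam 0 d n ∧ ¬ Fam 1 d n := by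
  rw [← not_iff_not, dec_iff hd (by omega)]
  have hpm : ∀ k, k % 2 = 0 ∨ k % 2 = 1 := fun k => Nat.mod_two_eq_zero_or_one k
  constructor
  · rintro ⟨m, h2, hmn, h⟩
    have key : ∀ i j a b, 1 ≤ j → j < m → m ≤ i → i ≤ n → (a = i ∨ a = i - 1) → (b = j ∨ b = j - 1) →
        d a = d b → i = j + 1 ∧ d a = d j := by
      intro i j a b h1 h2 h3 h4 ha hb hab
      refine h i j (d a) h1 h2 h3 h4 ?_ ?_
      · rcases ha with rfl | rfl
        · exact Or.inl rfl
        · exact Or.inr rfl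
      · rw [hab]
        rcases hb with rfl | rfl
        · exact Or.inl rfl
        · exact Or.inr rfl
    have hop : d m = opp (d (m-2)) := by
      apply hd.opp_of (by omega)
      intro he
      have := (key m (m-1) m (m-2) (by omega) (by omega) le_rfl hmn (Or.inl rfl) (Or.inr (by omega)) he).2
      exact (hd.ne (i := m) (j := m - 1) (by omega)).1 this
    rintro ⟨f0, f1⟩
    by_cases hm2 : m = 2
    · subst hm2
      apply f0
      intro k hk
      by_cases hk2 : 2 ≤ k
      · rw [if_pos (show Fl 0 n k from hk2)]
        apply hd.opp_of (by omega)
        intro he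
        by_cases hk3 : k = 2
        · subst hk3
          rw [hop] at he; exact opp_ne _ he
        · have := (key k 1 k (k % 2) le_rfl (by omega) (by omega) hk (Or.inl rfl) (by omega) he).1
          omega
      · rw [if_neg (show ¬ Fl 0 n k from hk2), Nat.mod_eq_of_lt (by omega)]
    · by_cases hmn' : m = n
      · subst hmn'
        have hA : ∀ k, k + 2 ≤ m → ∀ a, (a = m ∨ a = m - 1) → d a ≠ d k := by
          intro k hk a ha he
          by_cases hk0 : k = 0
          · subst hk0
            have := (key m 1 a 0 le_rfl (by omega) le_rfl le_rfl ha (by omega) he).1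
            omega
          · by_cases hk1 : k + 2 = m ∧ a = m
            · obtain ⟨hk1, rfl⟩ := hk1
              have : k = a - 2 := by omega
              subst this
              rw [hop] at he; exact opp_ne _ he
            · have := (key m k a k (by omega) (by omega) le_rfl le_rfl ha (Or.inl rfl) he).1
              omega
        apply f1
        intro k hk
        by_cases hk2 : m ≤ k + 1
        · rw [if_pos (show Fl 1 m k from hk2)]
          apply hd.opp_of (by omega)
          exact hA _ (by omega) k (by omega)
        · rw [if_neg (show ¬ Fl 1 m k from hk2)]
          obtain ⟨a, ha, hp⟩ : ∃ a, (a = m ∨ a = m - 1) ∧ a % 2 = k % 2 := by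
            by_cases h : m % 2 = k % 2
            · exact ⟨m, Or.inl rfl, h⟩
            · exact ⟨m - 1, Or.inr rfl, by omega⟩
          have e1 := hd.opp_of hp (hA k (by omega) a ha)
          have e2 := hd.opp_of (j := k % 2) (by omega) (hA (k % 2) (by omega) a ha)
          exact opp_inj.1 (e1.symm.trans e2)
      · exfalso
        have n1 : d (m+1) ≠ d (m-1) := fun he => by
          have := (key (m+1) (m-1) (m+1) (m-1) (by omega) (by omega) (by omega) (by omega) (Or.inl rfl) (Or.inl rfl) he).1
          omega
        have n2 : d (m+1) ≠ d (m-3) := fun he => by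
          have := (key (m+1) (m-2) (m+1) (m-3) (by omega) (by omega) (by omega) (by omega) (Or.inl rfl) (by omega) he).1
          omega
        have n3 : d (m-1) ≠ d (m-3) := fun he => by
          have := (key m (m-2) (m-1) (m-3) (by omega) (by omega) (by omega) (by omega) (by omega) (by omega) he).1
          omega
        have e1 := hd.opp_of (by omega) n1
        have e2 := hd.opp_of (by omega) n2
        exact n3 (opp_inj.1 (e1.symm.trans e2))
  · intro h
    rw [not_and_or, not_not, not_not] at h
    rcases h with h | h
    · refine ⟨2, le_rfl, hn, ?_⟩
      intro i j c h1 h2 h3 h4 o1 o2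
      have hj : j = 1 := by omega
      subst hj
      have hk : ∀ k, 2 ≤ k → k ≤ n → ∀ b < 2, d k ≠ d b := by
        intro k hk hkn b hb he
        have e := h k hkn
        rw [if_pos (show Fl 0 n k from hk)] at e
        by_cases hp : k % 2 = b
        · rw [hp, he] at e
          exact opp_ne _ e.symm
        · exact (hd.ne (i := k) (j := b) (by omega)).1 he
      by_cases hi : i = 2
      · refine ⟨hi, ?_⟩
        subst hi
        rcases o1 with rfl | rfl
        · exfalso
          rcases o2 with o2 | o2
          · exact hk 2 le_rfl hn 1 (by omega) o2
          · exact hk 2 le_rfl hn 0 (by omega) o2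
        · rfl
      · exfalso
        rcases o1 with rfl | rfl
        · rcases o2 with o2 | o2
          · exact hk i (by omega) (by omega) 1 (by omega) o2
          · exact hk i (by omega) (by omega) 0 (by omega) o2
        · rcases o2 with o2 | o2
          · exact hk (i-1) (by omega) (by omega) 1 (by omega) o2
          · exact hk (i-1) (by omega) (by omega) 0 (by omega) o2
    · have hn3 : 3 ≤ n := by
        by_contra hc
        have : n = 2 := by omega
        subst this
        have := h 1 (by omega)
        rw [if_pos (show Fl 1 2 1 from by simp [Fl])] at this
        exact opp_ne _ this.symm
      have hk : ∀ a b, n ≤ a + 1 → a ≤ n → b + 2 ≤ n → d a ≠ d b := by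
        intro a b ha han hb he
        by_cases hp : a % 2 = b % 2
        · have e1 := h a han
          rw [if_pos (show Fl 1 n a from ha)] at e1
          have e2 := h b (by omega)
          rw [if_neg (show ¬ Fl 1 n b from by simp [Fl]; omega)] at e2
          rw [he, e2, hp] at e1
          exact opp_ne _ e1.symm
        · exact (hd.ne hp).1 he
      refine ⟨n, hn, le_rfl, ?_⟩
      intro i j c h1 h2 h3 h4 o1 o2
      have hi : i = n := by omega
      subst hi
      by_cases hj : i = j + 1
      · refine ⟨hj, ?_⟩
        rcases o2 with o2 | o2
        · exact o2
        · exfalso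
          rcases o1 with o1 | o1
          · exact hk i (j-1) (by omega) le_rfl (by omega) (o1.symm.trans o2)
          · exact hk (i-1) (j-1) (by omega) (by omega) (by omega) (o1.symm.trans o2)
      · exfalso
        rcases o1 with rfl | rfl
        · rcases o2 with o2 | o2
          · exact hk _ _ (by omega) (by omega) (by omega) o2
          · exact hk _ _ (by omega) (by omega) (by omega) o2
        · rcases o2 with o2 | o2
          · exact hk _ _ (by omega) (by omega) (by omega) o2
          · exact hk _ _ (by omega) (by omega) (by omega) o2

end comb
end PinAux

namespace PinAux
open PinLetter Set CPerm

section isos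

theorem Lt.asymm {d : ℕ → PinLetter} {c : PinLetter} {a b : ℕ} (h : Lt d c a b) : ¬ Lt d c b a := by
  intro h'
  rcases h with ⟨h1, h2⟩ | ⟨h1, h2⟩ <;> rcases h' with ⟨h3, h4⟩ | ⟨h3, h4⟩
  · omega
  · exact h2 ⟨h3, h4⟩
  · exact h4 ⟨h1, h2⟩
  · omega

/-- Combinatorial form of an isomorphism between two drawn pin sequences. -/
structure Iso (d d' : ℕ → PinLetter) (n : ℕ) (τ : ℕ → ℕ) : Prop where
  bij : BijOn τ (Icc 1 n) (Icc 1 n)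
  on : ∀ i ∈ Icc 1 n, ∀ c, On d i c ↔ On d' (τ i) c
  lt : ∀ i ∈ Icc 1 n, ∀ j ∈ Icc 1 n, ∀ c, On d i c → On d j c → (Lt d c i j ↔ Lt d' c (τ i) (τ j))

theorem exists_iso {d d' : ℕ → PinLetter} (hd : Alt d) (hd' : Alt d') {n : ℕ} (h : pp d n = pp d' n) :
    ∃ τ, Iso d d' n τ := by
  have m1 := pp_models hd n
  have m2 := pp_models hd' n
  rw [← h] at m2
  obtain ⟨τ, hb, ho⟩ := m1.iso m2
  refine ⟨τ, hb, ?_, ?_⟩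
  · intro i hi c
    rw [← cfg_on hd hi.1, ← cfg_on hd' (hb.mapsTo hi).1]
    exact (ho i hi c).1
  · intro i hi j hj c h1 h2
    have e : ∀ i ∈ Icc 1 n, On d i c → On d' (τ i) c := by
      intro i hi h
      rw [← cfg_on hd' (hb.mapsTo hi).1]
      exact (ho i hi c).1.1 ((cfg_on hd hi.1 c).2 h)
    rw [← cfg_lt hd hi.1 hj.1 h1 h2, ← cfg_lt hd' (hb.mapsTo hi).1 (hb.mapsTo hj).1 (e i hi h1) (e j hj h2)]
    exact (ho i hi c).2 j hj

theorem Iso.pp_eq {d d' : ℕ → PinLetter} (hd : Alt d) (hd' : Alt d') {n : ℕ} {τ : ℕ → ℕ} (h : Iso d d' n τ) :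
    pp d n = pp d' n := by
  have m1 := pp_models hd n
  have m2 := pp_models hd' n
  refine m1.uniq (m2.map h.bij (OE_of_rays ?_ ?_ ?_ ?_))
  · intro i hi c
    exact ((cfg_spec hd i).pos hd hi.1 le_rfl c).1
  · intro i hi c
    exact ((cfg_spec hd' _).pos hd' (h.bij.mapsTo hi).1 le_rfl c).1
  · intro i hi c
    rw [cfg_on hd hi.1, cfg_on hd' (h.bij.mapsTo hi).1]
    exact h.on i hi c
  · intro i hi j hj c h1 h2
    rw [cfg_on hd hi.1] at h1
    rw [cfg_on hd hj.1] at h2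
    rw [cfg_lt hd hi.1 hj.1 h1 h2, cfg_lt hd' (h.bij.mapsTo hi).1 (h.bij.mapsTo hj).1
      ((h.on i hi c).1 h1) ((h.on j hj c).1 h2)]
    exact h.lt i hi j hj c h1 h2

def Agree (d d' : ℕ → PinLetter) (n : ℕ) : Prop := ∀ k ≤ n, d k = d' k

theorem Agree.iso {d d' : ℕ → PinLetter} {n : ℕ} (h : Agree d d' n) : Iso d d' n id := by
  refine ⟨bijOn_id _, ?_, ?_⟩
  · intro i hi c
    have := hi.2
    unfold On
    rw [h i hi.2, h (i-1) (by omega)]; rfl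
  · intro i hi j hj c _ _
    unfold Lt
    rw [h i hi.2, h j hj.2]; rfl

def Rot (d d' : ℕ → PinLetter) (n : ℕ) : Prop :=
  Fam 2 d' n ∧ (∀ k < n, d k = d' (k + 1)) ∧ d n = d' ((n + 1) % 2)

theorem Rot.iso {d d' : ℕ → PinLetter} (hd' : Alt d') {n : ℕ} (hn : 3 ≤ n)
    (h : Rot d d' n) : Iso d d' n (fun i => if i = n then 1 else i + 1) := by
  obtain ⟨hf, hs, hl⟩ := h
  have hfl : ∀ k, 2 ≤ k → k + 1 ≤ n → ∀ b < 2, d' k ≠ d' b := by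
    intro k h1 h2 b hb he
    by_cases hp : k % 2 = b
    · have := hf k (by omega)
      rw [if_pos (show Fl 2 n k from ⟨h1, h2⟩), hp, he] at this
      exact opp_ne _ this.symm
    · exact (hd'.ne (i := k) (j := b) (by omega)).1 he
  have hnn : d' n = d' (n % 2) := by
    have := hf n le_rfl
    rwa [if_neg (show ¬ Fl 2 n n from fun h => by have := h.2; omega)] at this
  have hon : ∀ c, On d n c ↔ c = d' 0 ∨ c = d' 1 := by
    intro c
    unfold On
    rw [hl, hs (n-1) (by omega), show n - 1 + 1 = n by omega, hnn]
    rcases Nat.mod_two_eq_zero_or_one n with h | h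
    · rw [h, show (n+1) % 2 = 1 by omega]; tauto
    · rw [h, show (n+1) % 2 = 0 by omega]
  have hon' : ∀ i, 1 ≤ i → i < n → ∀ c, On d i c ↔ c = d' (i+1) ∨ c = d' i := by
    intro i h1 h2 c
    unfold On
    rw [hs i h2, hs (i-1) (by omega), show i - 1 + 1 = i by omega]
  have share : ∀ i, 1 ≤ i → i < n → ∀ c, On d i c → On d n c → (i = 1 ∧ c = d' 1) ∨ (i + 1 = n ∧ c = d' n) := by
    intro i h1 h2 c o1 o2
    rw [hon] at o2
    rw [hon' i h1 h2] at o1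
    have q : ∀ k, 2 ≤ k → k + 1 ≤ n → c ≠ d' k := by
      rintro k a b rfl
      rcases o2 with o2 | o2
      · exact hfl k a b 0 (by omega) o2
      · exact hfl k a b 1 (by omega) o2
    rcases o1 with o1 | o1
    · by_cases hi : i + 1 = n
      · rw [hi] at o1; exact Or.inr ⟨hi, o1⟩
      · exact absurd o1 (q _ (by omega) (by omega))
    · by_cases hi : i = 1
      · rw [hi] at o1; exact Or.inl ⟨hi, o1⟩
      · exact absurd o1 (q _ (by omega) (by omega))
  refine ⟨⟨?_, ?_, ?_⟩, ?_, ?_⟩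
  · intro i hi
    simp only [mem_Icc] at hi ⊢
    split <;> omega
  · intro i hi j hj he
    simp only [mem_Icc] at hi hj he
    split at he <;> split at he <;> omega
  · intro j hj
    simp only [mem_Icc] at hj
    by_cases h1 : j = 1
    · exact ⟨n, ⟨by omega, le_rfl⟩, by simp [h1]⟩
    · exact ⟨j - 1, ⟨by omega, by omega⟩, by
        simp only
        rw [if_neg (by omega)]; omega⟩
  · intro i hi c
    by_cases hin : i = n
    · subst hin
      rw [if_pos rfl, hon]; unfold On; simp; tauto
    · rw [if_neg hin, hon' i hi.1 (by have := hi.2; omega)]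
      unfold On; simp
  · intro i hi j hj c o1 o2
    simp only [mem_Icc] at hi hj ⊢
    by_cases hin : i = n <;> by_cases hjn : j = n
    · subst hin; subst hjn
      exact iff_of_false (fun h => h.asymm h) (fun h => h.asymm h)
    · subst hin
      rw [if_pos rfl, if_neg hjn]
      rcases share j hj.1 (by omega) c o2 o1 with ⟨rfl, rfl⟩ | ⟨rfl, rfl⟩
      · refine iff_of_false ?_ ?_
        · rintro (⟨h, _⟩ | ⟨h, _⟩) <;> omega
        · rintro (⟨_, h⟩ | ⟨h, _⟩)
          · exact h ⟨rfl, rfl⟩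
          · omega
      · refine iff_of_true (Or.inr ⟨rfl, (hs j (by omega)).symm⟩) (Or.inl ⟨by omega, fun h => by omega⟩)
    · subst hjn
      rw [if_pos rfl, if_neg hin]
      rcases share i hi.1 (by omega) c o1 o2 with ⟨rfl, rfl⟩ | ⟨rfl, rfl⟩
      · exact iff_of_true (Or.inl ⟨by omega, fun h => by omega⟩) (Or.inr ⟨rfl, rfl⟩)
      · refine iff_of_false ?_ ?_
        · rintro (⟨_, h⟩ | ⟨h, _⟩)
          · exact h ⟨rfl, (hs i (by omega)).symm⟩
          · omega
        · rintro (⟨h, _⟩ | ⟨h, _⟩) <;> omega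
    · rw [if_neg hin, if_neg hjn]
      unfold Lt
      rw [hs i (by omega), hs j (by omega)]
      simp

theorem Iso.symm {d d' : ℕ → PinLetter} {n : ℕ} {τ : ℕ → ℕ} (h : Iso d d' n τ) :
    ∃ σ, Iso d' d n σ ∧ (∀ i ∈ Icc 1 n, σ (τ i) = i) := by
  obtain ⟨h1, h2, h3⟩ := bij_symm h.bij
  refine ⟨_, ⟨h1, ?_, ?_⟩, h2⟩
  · intro i hi c
    rw [h.on _ (h1.mapsTo hi), h3 i hi]
  · intro i hi j hj c o1 o2
    rw [h.lt _ (h1.mapsTo hi) _ (h1.mapsTo hj), h3 i hi, h3 j hj]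
    · rw [h.on _ (h1.mapsTo hi), h3 i hi]; exact o1
    · rw [h.on _ (h1.mapsTo hj), h3 j hj]; exact o2

theorem On.left (d : ℕ → PinLetter) (i : ℕ) : On d i (d i) := Or.inl rfl
theorem On.right (d : ℕ → PinLetter) (i : ℕ) : On d i (d (i-1)) := Or.inr rfl

theorem chain_letter {d d' : ℕ → PinLetter} (hd : Alt d) {n : ℕ} {τ : ℕ → ℕ}
    (h : Iso d d' n τ) {i i' : ℕ} (hi : i ∈ Icc 1 n) (ht : τ i = i') (he : d i = d' i') :
    d (i-1) = d' (i'-1) := by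
  have := (h.on i hi (d (i-1))).1 (On.right _ _)
  rw [ht] at this
  rcases this with h1 | h1
  · rw [← he] at h1
    exact absurd h1 (hd.ne (by have := hi.1; omega)).1
  · exact h1

theorem chain_step {d d' : ℕ → PinLetter} (hd : Alt d) {n : ℕ} {τ : ℕ → ℕ}
    (h : Iso d d' n τ) {i i' : ℕ} (hi : i ∈ Icc 1 n) (ht : τ i = i') (he : d i = d' i')
    (h2 : 2 ≤ i) (h2' : 2 ≤ i') : τ (i-1) = i' - 1 := by
  have hc := chain_letter hd h hi ht he
  obtain ⟨c, hcd⟩ : ∃ c, c = d (i-1) := ⟨_, rfl⟩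
  have hcd' : c = d' (i'-1) := hcd.trans hc
  have hi1 : i - 1 ∈ Icc 1 n := ⟨by omega, by have := hi.2; omega⟩
  have hi' : i' ∈ Icc 1 n := ht ▸ h.bij.mapsTo hi
  have hi1' : i' - 1 ∈ Icc 1 n := ⟨by omega, by have := hi'.2; omega⟩
  have imm : ∀ (e : ℕ → PinLetter) m k, 2 ≤ m → c = e (m-1) → Lt e c m k → k ≠ m - 1 → Lt e c (m-1) k := by
    intro e m k hm _ hl hk
    rcases hl with ⟨a, b⟩ | ⟨a, b⟩
    · exact Or.inl ⟨by omega, fun h => by omega⟩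
    · omega
  have lt1 : Lt d c i (i-1) := Or.inr ⟨by omega, hcd⟩
  have lt1' : Lt d' c i' (i'-1) := Or.inr ⟨by omega, hcd'⟩
  obtain ⟨k, hk, hkt⟩ := h.bij.surjOn hi1'
  have o1 : On d i c := hcd ▸ On.right _ _
  have o2 : On d (i-1) c := hcd ▸ On.left _ _
  have o3 : On d k c := by
    rw [h.on k hk, hkt]; exact hcd' ▸ On.left _ _
  by_contra hcon
  have hki : k ≠ i - 1 := by
    rintro rfl; exact hcon hkt
  have a1 := (h.lt i hi _ hi1 c o1 o2).1 lt1
  rw [ht] at a1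
  have a2 := imm d' i' _ h2' hcd' a1 hcon
  rw [← hkt, ← h.lt k hk _ hi1 c o3 o2] at a2
  have b1 := (h.lt i hi k hk c o1 o3).2 (by rw [ht, hkt]; exact lt1')
  have b2 := imm d i _ h2 hcd b1 hki
  exact a2.asymm b2

theorem chain {d d' : ℕ → PinLetter} (hd : Alt d) {n : ℕ} {τ : ℕ → ℕ}
    (h : Iso d d' n τ) {i i' : ℕ} (hi : i ∈ Icc 1 n) (hii : i ≤ i') (ht : τ i = i') (he : d i = d' i') (k : ℕ) :
    (k < i → τ (i-k) = i' - k) ∧ (k ≤ i → d (i-k) = d' (i'-k)) := by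
  induction k with
  | zero => exact ⟨fun _ => ht, fun _ => he⟩
  | succ k ih =>
    have hn := hi.2
    refine ⟨fun hk => ?_, fun hk => ?_⟩
    · exact chain_step hd h (i := i - k) (i' := i' - k) ⟨by omega, by omega⟩ (ih.1 (by omega)) (ih.2 (by omega)) (by omega) (by omega)
    · exact chain_letter hd h (i := i - k) ⟨by omega, by omega⟩ (ih.1 (by omega)) (ih.2 (by omega))

/-- A maximal point on a ray exits in that direction, or is the first point. -/
theorem max_on {d : ℕ → PinLetter} {n i : ℕ} {c : PinLetter} (hi : i ∈ Icc 1 n) (ho : On d i c)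
    (hm : ∀ k ∈ Icc 1 n, On d k c → ¬ Lt d c i k) : c = d i ∨ (i = 1 ∧ c = d 0) := by
  rcases ho with h | h
  · exact Or.inl h
  · by_cases h1 : i = 1
    · subst h1; exact Or.inr ⟨rfl, h⟩
    · exfalso
      have := hi.1
      have := hi.2
      exact hm (i-1) ⟨by omega, by omega⟩ (h ▸ On.left _ _) (Or.inr ⟨by omega, h⟩)

theorem case_inner {d d' : ℕ → PinLetter} (hd : Alt d) (hd' : Alt d') {n : ℕ} (hn : 6 ≤ n) {τ : ℕ → ℕ}
    (h : Iso d d' n τ) {i : ℕ} (h2 : 2 ≤ i) (hin : i < n) (ht : τ i = n) (he : d i = d' n) : Rot d d' n := by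
  have hi : i ∈ Icc 1 n := ⟨by omega, by omega⟩
  have ch := chain hd h hi hin.le ht he
  have hx : ∀ x, 1 ≤ x → x ≤ i → τ x = n - i + x := by
    intro x h1 h2
    have := (ch (i-x)).1 (by omega)
    rw [show i - (i - x) = x by omega] at this
    omega
  have hy : ∀ y, i < y → y ≤ n → 1 ≤ τ y ∧ τ y ≤ n - i := by
    intro y h1 h2
    have hm := h.bij.mapsTo (show y ∈ Icc 1 n from ⟨by omega, h2⟩)
    refine ⟨hm.1, ?_⟩
    by_contra hc
    have e := hx (τ y - (n - i)) (by omega) (by have := hm.2; omega)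
    rw [show n - i + (τ y - (n - i)) = τ y by omega] at e
    have := h.bij.injOn (show _ ∈ Icc 1 n from ⟨by omega, by have := hm.2; omega⟩) (show y ∈ Icc 1 n from ⟨by omega, h2⟩) e
    have := hm.2
    omega
  have hd0 : d 0 = d' (n - i) := by
    have := (ch i).2 le_rfl
    rwa [Nat.sub_self] at this
  have share : ∀ x y c, 1 ≤ x → x ≤ i → i < y → y ≤ n → On d x c → On d y c →
      (x = i ∧ y = i + 1 ∧ c = d i) ∨ (x = 1 ∧ τ y = n - i ∧ c = d 0) := by
    intro x y c h1 h2 h3 h4 o1 o2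
    by_cases hc : y = x + 1 ∧ c = d x
    · have : x = i := by omega
      subst this
      exact Or.inl ⟨rfl, hc⟩
    · right
      have l : Lt d c x y := Or.inl ⟨by omega, hc⟩
      rw [h.lt x ⟨by omega, by omega⟩ y ⟨by omega, by omega⟩ c o1 o2, hx x h1 h2] at l
      have q := hy y h3 h4
      rcases l with ⟨a, b⟩ | ⟨a, b⟩
      · omega
      · have : τ y = n - i := by omega
        rw [this] at b
        exact ⟨by omega, this, b.trans hd0.symm⟩
  by_cases hlast : i + 1 = n
  · -- rotation
    have hni : i = n - 1 := by omega
    have hτn : τ n = 1 := by have := hy n (by omega) le_rfl; omega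
    have hs : ∀ k < n, d k = d' (k+1) := by
      intro k hk
      have := (ch (i-k)).2 (by omega)
      rw [show i - (i - k) = k by omega, show n - (i - k) = k + 1 by omega] at this
      exact this
    have hon : ∀ c, On d n c ↔ c = d' 0 ∨ c = d' 1 := by
      intro c
      rw [h.on n ⟨by omega, le_rfl⟩, hτn]; unfold On; simp; tauto
    have hno : ∀ k, 1 ≤ k → k + 2 ≤ n → ¬ On d n (d k) := by
      intro k h1 h2 o
      by_cases hk : k = 1
      · subst hk
        rcases share 2 n (d 1) (by omega) (by omega) (by omega) le_rfl (On.right _ _) o with q | q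
        · omega
        · omega
      · rcases share k n (d k) (by omega) (by omega) (by omega) le_rfl (On.left _ _) o with q | q
        · omega
        · omega
    have hb : ∀ b < 2, On d n (d' b) := by
      intro b hb
      rw [hon]
      have : b = 0 ∨ b = 1 := by omega
      rcases this with rfl | rfl <;> simp
    have hpar : ∀ b < 2, ∀ k, d' k = d' b → k % 2 = b := by
      intro b hb k he
      by_contra hc
      exact (hd'.ne (i := k) (j := b) (by omega)).1 he
    have hnn : d' n = d' (n % 2) := by
      have := (hon (d (n-1))).1 (On.right _ _)
      rw [hs (n-1) (by omega), show n - 1 + 1 = n by omega] at this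
      rcases this with q | q
      · rw [hpar 0 (by omega) _ q]; exact q
      · rw [hpar 1 (by omega) _ q]; exact q
    refine ⟨?_, hs, ?_⟩
    · intro k hk
      by_cases hfl : Fl 2 n k
      · rw [if_pos hfl]
        have h1 := hfl.1
        have h2 := hfl.2
        apply hd'.opp_of (by omega)
        intro he
        apply hno (k-1) (by omega) (by omega)
        rw [hs (k-1) (by omega), show k - 1 + 1 = k by omega, he]
        exact hb _ (by omega)
      · rw [if_neg hfl]
        by_cases hkn : k = n
        · subst hkn; exact hnn
        · have : k < 2 := by
            by_contra hc
            exact hfl ⟨by omega, by omega⟩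
          rw [Nat.mod_eq_of_lt this]
    · have q := (hon (d n)).1 (On.left _ _)
      have hne : d n ≠ d' (n % 2) := by
        rw [← hnn]
        have := hs (n-1) (by omega)
        rw [show n - 1 + 1 = n by omega] at this
        rw [← this]
        exact (hd.ne (by omega)).1
      rcases Nat.mod_two_eq_zero_or_one n with h | h
      · rw [h] at hne
        rw [show (n+1) % 2 = 1 by omega]; exact q.resolve_left hne
      · rw [h] at hne
        rw [show (n+1) % 2 = 0 by omega]; exact q.resolve_right hne
  · exfalso
    by_cases hi3 : 3 ≤ i
    · have no : ∀ k, i ≤ k → k ≤ n → ∀ b, (b = 1 ∨ b = 2) → d k ≠ d b := by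
        intro k h1 h2 b hb he
        have o1 : On d 2 (d k) := by
          rw [he]; rcases hb with rfl | rfl
          · exact On.right _ _
          · exact On.left _ _
        by_cases hk : k = i
        · subst hk
          rcases share 2 (k+1) (d k) (by omega) (by omega) (by omega) (by omega) o1 (On.right _ _) with q | q <;> omega
        · rcases share 2 k (d k) (by omega) (by omega) (by omega) (by omega) o1 (On.left _ _) with q | q <;> omega
      have : d (i+2) = d i := by
        obtain ⟨b, hb, hp⟩ : ∃ b, (b = 1 ∨ b = 2) ∧ b % 2 = i % 2 := by
          rcases Nat.mod_two_eq_zero_or_one i with h | h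
          · exact ⟨2, by simp, by omega⟩
          · exact ⟨1, by simp, by omega⟩
        rw [hd.opp_of (i := i+2) (j := b) (by omega) (no _ (by omega) (by omega) b hb),
          hd.opp_of (i := i) (j := b) (by omega) (no _ (by omega) (by omega) b hb)]
      rcases share i (i+2) (d i) (by omega) (by omega) (by omega) (by omega) (On.left _ _) (Or.inl this.symm) with q | q <;> omega
    · have : i = 2 := by omega
      subst this
      have no : ∀ k, 3 ≤ k → k ≤ n → ∀ b, (b = 1 ∨ b = 2) → d k ≠ d b := by
        intro k h1 h2 b hb he
        have o1 : On d 2 (d k) := by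
          rw [he]; rcases hb with rfl | rfl
          · exact On.right _ _
          · exact On.left _ _
        rcases share 2 k (d k) (by omega) (by omega) (by omega) (by omega) o1 (On.left _ _) with q | q
        · rw [q.2.1] at q
          exact (hd.ne (i := 3) (j := 2) (by omega)).1 q.2.2
        · omega
      have no4 := hd.opp_of (by omega) (no 4 (by omega) (by omega) 2 (by simp))
      have no3 := hd.opp_of (by omega) (no 3 (by omega) (by omega) 1 (by simp))
      have no5 := hd.opp_of (by omega) (no 5 (by omega) (by omega) 1 (by simp))
      have inj := fun (a b : ℕ) (ha : a ∈ Icc 1 n) (hb : b ∈ Icc 1 n) (e : τ a = τ b) => h.bij.injOn ha hb e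
      have o1 : On d 1 (d 0) := On.right _ _
      rcases hd.eo (i := 0) (j := 2) (by omega) with e0 | e0
      · have t3 : τ 3 = n - 2 := by
          rcases share 1 3 (d 0) (by omega) (by omega) (by omega) (by omega) o1 (by rw [e0]; exact On.right _ _) with q | q
          · omega
          · exact q.2.1
        have e53 : d 5 = d 3 := no5.trans no3.symm
        have after : ∀ y, (y = 5 ∨ y = 6) → τ y = n - 3 := by
          intro y hy'
          have ony : On d y (d 3) := by
            rw [← e53]
            rcases hy' with rfl | rfl
            · exact On.left _ _
            · exact On.right _ _
          have l : Lt d (d 3) 3 y := Or.inl ⟨by omega, fun h => by omega⟩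
          rw [h.lt 3 ⟨by omega, by omega⟩ y ⟨by omega, by omega⟩ _ (On.left _ _) ony, t3] at l
          have := hy y (by omega) (by omega)
          rcases l with ⟨a, _⟩ | ⟨a, _⟩ <;> omega
        have := inj 5 6 ⟨by omega, by omega⟩ ⟨by omega, by omega⟩ ((after 5 (by simp)).trans (after 6 (by simp)).symm)
        omega
      · have e04 : d 0 = d 4 := e0.trans no4.symm
        have q4 : τ 4 = n - 2 := by
          rcases share 1 4 (d 0) (by omega) (by omega) (by omega) (by omega) o1 (by rw [e04]; exact On.left _ _) with q | q
          · omega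
          · exact q.2.1
        have q5 : τ 5 = n - 2 := by
          rcases share 1 5 (d 0) (by omega) (by omega) (by omega) (by omega) o1 (by rw [e04]; exact On.right _ _) with q | q
          · omega
          · exact q.2.1
        have := inj 4 5 ⟨by omega, by omega⟩ ⟨by omega, by omega⟩ (q4.trans q5.symm)
        omega

theorem iso_cases {d d' : ℕ → PinLetter} (hd : Alt d) (hd' : Alt d') {n : ℕ} (hn : 6 ≤ n)
    (heq : pp d n = pp d' n) : Agree d d' n ∨ Rot d d' n ∨ Rot d' d n := by
  obtain ⟨τ, h⟩ := exists_iso hd hd' heq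
  obtain ⟨i, hi, ht⟩ := h.bij.surjOn (show n ∈ Icc 1 n from ⟨by omega, le_rfl⟩)
  -- transfer of maximality
  have maxs : ∀ k ∈ Icc 1 n, ∀ c, On d k c → (∀ j ∈ Icc 1 n, On d' j c → ¬ Lt d' c (τ k) j) →
      c = d k ∨ (k = 1 ∧ c = d 0) := by
    intro k hk c ho hm
    apply max_on hk ho
    intro j hj oj hl
    exact hm (τ j) (h.bij.mapsTo hj) ((h.on j hj c).1 oj) ((h.lt k hk j hj c ho oj).1 hl)
  have m1 := maxs i hi (d' n) (by rw [h.on i hi, ht]; exact On.left _ _) (by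
    intro j hj oj hl
    rw [ht] at hl
    have := hj.2
    rcases hl with ⟨a, _⟩ | ⟨a, b⟩
    · omega
    · exact (hd'.ne (by omega)).1 b)
  by_cases h1 : i = 1
  · right; right
    subst h1
    obtain ⟨q, hq, hqt⟩ := h.bij.surjOn (show n - 1 ∈ Icc 1 n from ⟨by omega, by omega⟩)
    have hq1 : q ≠ 1 := by
      rintro rfl; omega
    have oq : On d q (d' (n-1)) := by rw [h.on q hq, hqt]; exact On.left _ _
    have o1 : On d 1 (d' (n-1)) := by rw [h.on 1 hi, ht]; exact On.right _ _
    have m2 := maxs q hq (d' (n-1)) oq (by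
      intro j hj oj hl
      rw [hqt] at hl
      have := hj.2
      rcases hl with ⟨a, b⟩ | ⟨a, b⟩
      · exact b ⟨by omega, rfl⟩
      · exact (hd'.ne (by omega)).1 b)
    have m2 : d' (n-1) = d q := by
      rcases m2 with m | m
      · exact m
      · exact absurd m.1 hq1
    have hqn : q = n := by
      by_contra hqn
      have hq1' : q + 1 ∈ Icc 1 n := ⟨by omega, by have := hq.2; omega⟩
      have oq1 : On d (q+1) (d' (n-1)) := by rw [m2]; exact Or.inr rfl
      have l : Lt d (d' (n-1)) 1 (q+1) := Or.inl ⟨by have := hq.1; omega, fun h => by omega⟩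
      rw [h.lt 1 hi _ hq1' _ o1 oq1, ht] at l
      have b := (h.bij.mapsTo hq1').2
      rcases l with ⟨a, _⟩ | ⟨a, _⟩
      · omega
      · have := h.bij.injOn hq hq1' (by omega)
        omega
    subst hqn
    obtain ⟨σ, hσ, hinv⟩ := h.symm
    have e := hinv q hq
    rw [hqt] at e
    exact case_inner hd' hd hn hσ (i := q - 1) (by omega) (by omega) e m2
  · have he : d' n = d i := by
      rcases m1 with m | m
      · exact m
      · exact absurd m.1 h1
    by_cases hin : i = n
    · left
      subst hin
      intro k hk
      have := (chain hd h hi le_rfl ht he.symm (i-k)).2 (by omega)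
      rwa [show i - (i - k) = k by omega] at this
    · right; left
      have a := hi.1
      have b := hi.2
      exact case_inner hd hd' hn h (i := i) (by omega) (by omega) ht he.symm

end isos
end PinAux

namespace PinAux
open PinLetter Set CPerm

section words

def letter (v s : Bool) : PinLetter :=
  match v, s with
  | true, true => u
  | true, false => PinLetter.d
  | false, true => r
  | false, false => l

def sgn : PinLetter → Bool
  | .u => true
  | .r => true
  | _ => false

theorem letter_vert (v s : Bool) : (letter v s).isVert = v := by cases v <;> cases s <;> rfl
theorem letter_sgn (v s : Bool) : sgn (letter v s) = s := by cases v <;> cases s <;> rfl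
theorem letter_eq (c : PinLetter) : letter c.isVert (sgn c) = c := by cases c <;> rfl

/-- The pin sequence with binary code `k`. -/
def seq (k : ℕ) (i : ℕ) : PinLetter := letter (xor (decide (i % 2 = 1)) (k.testBit 0)) (k.testBit (i+1))

theorem alt_of {d : ℕ → PinLetter} {b : Bool} (h : ∀ i, (d i).isVert = xor (decide (i % 2 = 1)) b) : Alt d := by
  intro i
  rw [h, h]
  have h2 : decide ((i+1) % 2 = 1) = !decide (i % 2 = 1) := by
    by_cases h : i % 2 = 1
    · have : (i+1) % 2 = 0 := by omega
      simp [h, this]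
    · have : (i+1) % 2 = 1 := by omega
      simp [h, this]
  rw [h2]
  cases decide (i % 2 = 1) <;> cases b <;> simp

theorem seq_alt (k : ℕ) : Alt (seq k) := alt_of (b := k.testBit 0) fun i => by rw [seq, letter_vert]

theorem seq_inj {k k' n : ℕ} (hk : k < 2 ^ (n+2)) (hk' : k' < 2 ^ (n+2)) (h : Agree (seq k) (seq k') n) : k = k' := by
  apply Nat.eq_of_testBit_eq
  intro i
  by_cases hi : i < n + 2
  · rcases i with _ | i
    · have := congrArg PinLetter.isVert (h 0 (by omega))
      simpa [seq, letter_vert] using this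
    · have := congrArg sgn (h i (by omega))
      simpa only [seq, letter_sgn] using this
  · have := Nat.pow_le_pow_right (show 0 < 2 by omega) (show n + 2 ≤ i by omega)
    rw [Nat.testBit_lt_two_pow (by omega), Nat.testBit_lt_two_pow (by omega)]

theorem seq_surj {d : ℕ → PinLetter} (hd : Alt d) (n : ℕ) : ∃ k < 2 ^ (n+2), Agree d (seq k) n := by
  refine ⟨Nat.ofBits (n := n+2) (fun i => if i.val = 0 then (d 0).isVert else sgn (d (i.val - 1))),
    Nat.ofBits_lt_two_pow _, ?_⟩
  intro i hi
  unfold seq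
  rw [Nat.testBit_ofBits_lt _ _ (by omega), Nat.testBit_ofBits_lt _ _ (by omega)]
  simp only [if_true, Nat.add_sub_cancel, if_neg (Nat.succ_ne_zero i)]
  rw [← vert_par hd i, letter_eq]

theorem Agree.symm {d d' : ℕ → PinLetter} {n : ℕ} (h : Agree d d' n) : Agree d' d n := fun k hk => (h k hk).symm

theorem Agree.pp {d d' : ℕ → PinLetter} (hd : Alt d) (hd' : Alt d') {n : ℕ} (h : Agree d d' n) :
    pp d n = pp d' n := h.iso.pp_eq hd hd'

theorem Agree.fam {d d' : ℕ → PinLetter} {n t : ℕ} (hn : 1 ≤ n) (h : Agree d d' n) (hf : Fam t d n) : Fam t d' n := by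
  intro k hk
  rw [← h k hk, ← h (k%2) (by omega)]
  exact hf k hk

theorem seq_mod (k i : ℕ) (hi : i < 2) : seq (k % 8) i = seq k i := by
  unfold seq
  rw [show (8:ℕ) = 2^3 by norm_num, Nat.testBit_mod_two_pow, Nat.testBit_mod_two_pow]
  simp [show i + 1 < 3 by omega]

theorem fam_card {t n : ℕ} (hn : 3 ≤ n) : {k | k < 2 ^ (n+2) ∧ Fam t (seq k) n}.ncard = 8 := by
  have hFl : ∀ i < 2, ¬ Fl t n i := by
    intro i hi
    unfold Fl
    split <;> omega
  have hb : BijOn (fun k => k % 8) {k | k < 2 ^ (n+2) ∧ Fam t (seq k) n} (Iio 8) := by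
    refine ⟨fun k _ => Nat.mod_lt _ (by omega), ?_, ?_⟩
    · rintro k ⟨hk, hf⟩ k' ⟨hk', hf'⟩ he
      simp only at he
      have e : ∀ i < 2, seq k i = seq k' i := fun i hi => by rw [← seq_mod k i hi, he, seq_mod k' i hi]
      apply seq_inj hk hk'
      intro i hi
      rw [hf i hi, hf' i hi, e (i % 2) (by omega)]
    · intro c hc
      let D : ℕ → PinLetter := fun k => if Fl t n k then opp (seq c (k%2)) else seq c (k%2)
      have hD : Alt D := by
        apply alt_of (b := c.testBit 0)
        intro i
        have : (D i).isVert = (seq c (i%2)).isVert := by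
          simp only [D]; split
          · rw [isVert_opp]
          · rfl
        rw [this, seq, letter_vert, Nat.mod_mod]
      have hD2 : ∀ i < 2, D i = seq c i := by
        intro i hi
        simp only [D]
        rw [if_neg (hFl i hi), Nat.mod_eq_of_lt hi]
      obtain ⟨k, hk, ha⟩ := seq_surj hD n
      refine ⟨k, ⟨hk, ha.fam (by omega) ?_⟩, ?_⟩
      · intro i hi
        rw [hD2 (i%2) (by omega)]
      · simp only
        refine seq_inj (n := 1) (by have := Nat.mod_lt k (show 0 < 8 by omega); omega) (by exact hc) ?_
        intro i hi
        rw [seq_mod k i (by omega), ← ha i (by omega), hD2 i (by omega)]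
  have := hb.injOn.ncard_image
  rw [← this, hb.image_eq, Set.ncard_eq_toFinset_card']
  simp

theorem fam_disj {d : ℕ → PinLetter} {t t' n : ℕ} (h : Fam t d n) (h' : Fam t' d n) {k : ℕ} (hk : k ≤ n)
    (h1 : Fl t n k) (h2 : ¬ Fl t' n k) : False := by
  have e1 := h k hk
  have e2 := h' k hk
  rw [if_pos h1] at e1
  rw [if_neg h2] at e2
  exact opp_ne _ (e1.symm.trans e2)

theorem Rot.not_fam {d d' : ℕ → PinLetter} {n : ℕ} (hn : 6 ≤ n) (h : Rot d d' n) : ¬ Fam 2 d n := by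
  intro hf
  obtain ⟨hf', hs, -⟩ := h
  have e1 := hf (n-1) (by omega)
  have e2 := hf (n-3) (by omega)
  rw [if_pos (show Fl 2 n (n-1) from ⟨by omega, by omega⟩)] at e1
  rw [if_pos (show Fl 2 n (n-3) from ⟨by omega, by omega⟩), show (n-3)%2 = (n-1)%2 by omega, ← e1, hs _ (by omega),
    hs _ (by omega)] at e2
  have e3 := hf' (n-3+1) (by omega)
  have e4 := hf' (n-1+1) (by omega)
  rw [if_pos (show Fl 2 n _ from ⟨by omega, by omega⟩)] at e3
  rw [if_neg (show ¬ Fl 2 n _ from fun h => by have := h.2; omega)] at e4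
  rw [show (n-3+1)%2 = (n-1+1)%2 by omega] at e3
  exact opp_ne _ (e3.symm.trans (e2.trans e4))

theorem exists_rot {d' : ℕ → PinLetter} (hd' : Alt d') {n : ℕ} (hf : Fam 2 d' n) : ∃ d, Alt d ∧ Rot d d' n := by
  refine ⟨fun k => if k < n then d' (k+1) else d' ((k+1) % 2), ?_, hf, ?_, ?_⟩
  · apply alt_of (b := !(d' 0).isVert)
    intro i
    have h2 : decide ((i+1) % 2 = 1) = !decide (i % 2 = 1) := by
      by_cases h : i % 2 = 1
      · have : (i+1) % 2 = 0 := by omega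
        simp [h, this]
      · have : (i+1) % 2 = 1 := by omega
        simp [h, this]
    by_cases hi : i < n
    · rw [if_pos hi, vert_par hd', h2]; simp
    · rw [if_neg hi, vert_par hd', Nat.mod_mod, h2]; simp
  · intro k hk
    simp only [if_pos hk]
  · simp

theorem mem_GG {p : CPerm} {n : ℕ} : (p ∈ GG ∧ p.len = n) ↔ 
    ∃ k < 2^(n+2), BoxIndecomposable (pp (seq k) n) ∧ p = pp (seq k) n := by
  constructor
  · rintro ⟨h, rfl⟩
    obtain ⟨d, hd, hp⟩ := Ind.pp h
    obtain ⟨k, hk, ha⟩ := seq_surj hd p.len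
    have e := hp.trans (ha.pp hd (seq_alt k))
    exact ⟨k, hk, e ▸ h.2, e⟩
  · rintro ⟨k, hk, h, rfl⟩
    exact ⟨⟨T.pp (seq_alt k) n, h⟩, pp_len (seq_alt k) n⟩

theorem g_count {n : ℕ} (hn : 6 ≤ n) : cnt GG CPerm.len n + 24 = 2 ^ (n+2) := by
  set C := {k | k < 2^(n+2) ∧ ¬ Fam 0 (seq k) n ∧ ¬ Fam 1 (seq k) n ∧ ¬ Fam 2 (seq k) n} with hC
  have hb : BijOn (fun k => pp (seq k) n) C {p | p ∈ GG ∧ p.len = n} := by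
    refine ⟨?_, ?_, ?_⟩
    · rintro k ⟨hk, h0, h1, h2⟩
      exact mem_GG.2 ⟨k, hk, (ind_iff (seq_alt k) (by omega)).2 ⟨h0, h1⟩, rfl⟩
    · rintro k ⟨hk, h0, h1, h2⟩ k' ⟨hk', h0', h1', h2'⟩ he
      rcases iso_cases (seq_alt k) (seq_alt k') hn he with h | h | h
      · exact seq_inj hk hk' h
      · exact absurd h.1 h2'
      · exact absurd h.1 h2
    · rintro p hp
      obtain ⟨k, hk, hi, rfl⟩ := mem_GG.1 hp
      obtain ⟨h0, h1⟩ := (ind_iff (seq_alt k) (by omega)).1 hi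
      by_cases h2 : Fam 2 (seq k) n
      · obtain ⟨d, hd, hr⟩ := exists_rot (seq_alt k) h2
        have e1 := (hr.iso (seq_alt k) (by omega)).pp_eq hd (seq_alt k)
        obtain ⟨k', hk', ha⟩ := seq_surj hd n
        have e2 := ha.pp hd (seq_alt k')
        have e3 := e2.symm.trans e1
        rw [← e3] at hi
        obtain ⟨h0', h1'⟩ := (ind_iff (seq_alt k') (by omega)).1 hi
        exact ⟨k', ⟨hk', h0', h1', fun h => hr.not_fam hn (ha.symm.fam (by omega) h)⟩, e3⟩
      · exact ⟨k, ⟨hk, h0, h1, h2⟩, rfl⟩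
  have hc : cnt GG CPerm.len n = C.ncard := by
    unfold cnt
    rw [← hb.image_eq, hb.injOn.ncard_image]
  rw [hc]
  have fin : ∀ P : ℕ → Prop, {k | k < 2^(n+2) ∧ P k}.Finite := fun P => (Set.finite_Iio (2^(n+2))).subset fun k hk => hk.1
  set F := fun t => {k | k < 2 ^ (n+2) ∧ Fam t (seq k) n} with hF
  have d01 : Disjoint (F 0) (F 1) := Set.disjoint_left.2 fun k a b =>
    fam_disj a.2 b.2 (k := 2) (by omega) (by simp [Fl]) (by simp [Fl]; omega)
  have d02 : Disjoint (F 0) (F 2) := Set.disjoint_left.2 fun k a b =>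
    fam_disj a.2 b.2 (k := n) (by omega) (by simp [Fl]; omega) (by simp [Fl])
  have d12 : Disjoint (F 1) (F 2) := Set.disjoint_left.2 fun k a b =>
    fam_disj b.2 a.2 (k := 2) (by omega) (by simp [Fl]; omega) (by simp [Fl]; omega)
  have dC : Disjoint C (F 0 ∪ F 1 ∪ F 2) := Set.disjoint_left.2 fun k a b => by
    rcases b with (b | b) | b
    · exact a.2.1 b.2
    · exact a.2.2.1 b.2
    · exact a.2.2.2 b.2
  have hU : C ∪ (F 0 ∪ F 1 ∪ F 2) = Iio (2^(n+2)) := by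
    ext k
    simp only [hC, hF, mem_union, mem_ofPred_eq, mem_Iio]
    tauto
  have e0 : (F 0).ncard = 8 := fam_card (by omega)
  have e1 : (F 1).ncard = 8 := fam_card (by omega)
  have e2 : (F 2).ncard = 8 := fam_card (by omega)
  have := congrArg Set.ncard hU
  rw [Set.ncard_union_eq dC (fin _) (((fin _).union (fin _)).union (fin _)),
    Set.ncard_union_eq (Set.disjoint_union_left.2 ⟨d02, d12⟩) ((fin _).union (fin _)) (fin _),
    Set.ncard_union_eq d01 (fin _) (fin _), e0, e1, e2, Set.ncard_eq_toFinset_card' (Iio _)] at this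
  simpa using this

/-- The alternating word `v w v w …`. -/
def zig (v w : PinLetter) (k : ℕ) : PinLetter := if k % 2 = 0 then v else w

theorem zig_alt {v w : PinLetter} (h : v.isVert ≠ w.isVert) : Alt (zig v w) := by
  intro i
  unfold zig
  rcases Nat.mod_two_eq_zero_or_one i with a | a
  · rw [a, show (i+1) % 2 = 1 by omega]; simpa using h
  · rw [a, show (i+1) % 2 = 0 by omega]; simpa using h.symm

theorem zig_not_fam {v w : PinLetter} {t n k : ℕ} (hk : k ≤ n) (h1 : Fl t n k) : ¬ Fam t (zig v w) n := by
  intro h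
  have := h k hk
  rw [if_pos h1] at this
  unfold zig at this
  rw [Nat.mod_mod] at this
  exact opp_ne _ this.symm

theorem zig_ind {v w : PinLetter} (h : v.isVert ≠ w.isVert) {n : ℕ} (hn : 1 ≤ n) : BoxIndecomposable (pp (zig v w) n) := by
  by_cases h1 : n = 1
  · subst h1
    by_contra hc
    rw [dec_iff (zig_alt h) le_rfl] at hc
    obtain ⟨m, h2, h3, -⟩ := hc
    omega
  · rw [ind_iff (zig_alt h) (by omega)]
    exact ⟨zig_not_fam (k := 2) (by omega) (by simp [Fl]), zig_not_fam (k := n) le_rfl (by simp [Fl])⟩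

theorem mem_QQ {v w : PinLetter} (h : v.isVert ≠ w.isVert) {n : ℕ} (hn : 1 ≤ n) :
    {p | p ∈ QQ v w ∧ p.len = n} = {pp (zig v w) n, pp (zig w v) n} := by
  have one : ∀ {v w : PinLetter}, v.isVert ≠ w.isVert → ∀ c, (c = v ∨ c = w) → ∀ k, 1 ≤ k → 0 < ht c (cfg (zig v w) k) := by
    intro v w h c hc k hk
    rw [cfg_on (zig_alt h) hk]
    unfold On zig
    rcases Nat.mod_two_eq_zero_or_one k with a | a
    · rw [a, show (k-1) % 2 = 1 by omega]; simpa using hc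
    · rw [a, show (k-1) % 2 = 0 by omega]; simpa using hc.symm
  ext p
  constructor
  · rintro ⟨⟨hi, hq⟩, rfl⟩
    obtain ⟨d, hd, hp⟩ := Ind.pp hi
    rw [hp, oneQ_iff (pp_models hd _)] at hq
    have hall : ∀ k ≤ p.len, d k = v ∨ d k = w := by
      intro k hk
      have o : ∃ i ∈ Icc 1 p.len, On d i (d k) ∧ On d i v ∧ On d i w := by
        by_cases hk0 : k = 0
        · subst hk0
          have := hq 1 ⟨le_rfl, hn⟩
          rw [cfg_on hd le_rfl, cfg_on hd le_rfl] at this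
          exact ⟨1, ⟨le_rfl, hn⟩, Or.inr rfl, this⟩
        · have := hq k ⟨by omega, hk⟩
          rw [cfg_on hd (by omega), cfg_on hd (by omega)] at this
          exact ⟨k, ⟨by omega, hk⟩, Or.inl rfl, this⟩
      obtain ⟨i, hi, o1, o2, o3⟩ := o
      have hvw : v ≠ w := fun e => h (by rw [e])
      unfold On at o1 o2 o3
      rcases o2 with rfl | rfl <;> rcases o3 with rfl | rfl <;> tauto
    have hz : Agree d (zig v w) p.len ∨ Agree d (zig w v) p.len := by
      have aux : ∀ {v w : PinLetter}, v.isVert ≠ w.isVert → (∀ k ≤ p.len, d k = v ∨ d k = w) → d 0 = v →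
          Agree d (zig v w) p.len := by
        intro v w h hall h0 k hk
        have hv := vert_par hd k
        rw [h0] at hv
        unfold zig
        rcases Nat.mod_two_eq_zero_or_one k with a | a
        · rw [a] at hv ⊢
          rcases hall k hk with e | e
          · simpa using e
          · rw [e] at hv; simp at hv; exact absurd hv.symm h
        · rw [a] at hv ⊢
          rcases hall k hk with e | e
          · rw [e] at hv; simp at hv
          · simpa using e
      rcases hall 0 (by omega) with e | e
      · exact Or.inl (aux h hall e)
      · exact Or.inr (aux h.symm (fun k hk => (hall k hk).symm) e)
    rcases hz with hz | hz
    · left; rw [hp, pp_len hd]; exact hz.pp hd (zig_alt h)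
    · right; rw [mem_singleton_iff, hp, pp_len hd]; exact hz.pp hd (zig_alt h.symm)
  · rintro (rfl | rfl)
    · refine ⟨⟨⟨T.pp (zig_alt h) n, zig_ind h hn⟩, ?_⟩, pp_len (zig_alt h) n⟩
      rw [oneQ_iff (pp_models (zig_alt h) n)]
      exact fun i hi => ⟨one h v (Or.inl rfl) i hi.1, one h w (Or.inr rfl) i hi.1⟩
    · have h := h.symm
      refine ⟨⟨⟨T.pp (zig_alt h) n, zig_ind h hn⟩, ?_⟩, pp_len (zig_alt h) n⟩
      rw [oneQ_iff (pp_models (zig_alt h) n)]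
      exact fun i hi => ⟨one h v (Or.inr rfl) i hi.1, one h w (Or.inl rfl) i hi.1⟩

theorem q_count {v w : PinLetter} (h : v.isVert ≠ w.isVert) {n : ℕ} (hn : 6 ≤ n) :
    cnt (QQ v w) CPerm.len n = 2 := by
  unfold cnt
  rw [mem_QQ h (by omega)]
  apply Set.ncard_pair
  intro he
  have h2 : Fl 2 n 2 := ⟨le_rfl, by omega⟩
  rcases iso_cases (zig_alt h) (zig_alt h.symm) hn he with e | e | e
  · have := e 0 (by omega)
    simp [zig] at this
    exact h (by rw [this])
  · exact zig_not_fam (by omega) h2 e.1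
  · exact zig_not_fam (by omega) h2 e.1

end words
end PinAux

namespace PinAux
open PinLetter Set CPerm

section small

/-- Horizontal rank of the point `i`. -/
def cX (d : ℕ → PinLetter) (n i : ℕ) : ℕ :=
  ((List.range (n+1)).filter (fun j => decide ((cfg d j).1 < (cfg d i).1))).length

/-- Vertical rank of the point `i`. -/
def cY (d : ℕ → PinLetter) (n i : ℕ) : ℕ :=
  ((List.range (n+1)).filter (fun j => decide ((cfg d j).2 < (cfg d i).2))).length

/-- A computable form of the pin permutation. -/
def cp (d : ℕ → PinLetter) (n : ℕ) : CPerm :=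
  ⟨(List.range (n+1)).map (fun x => ((List.range (n+1)).map fun i => if cX d n i = x then cY d n i else 0).sum),
    cX d n 0⟩

theorem rank_eq {N : ℕ} {e : ℕ → ℕ} (he : BijOn e (Iio N) (Iio N)) {m : ℕ} (hm : m ≤ N) (P : ℕ → Bool)
    (hP : ∀ j < N, (P j = true ↔ e j < m)) : ((List.range N).filter P).length = m := by
  have h1 : ((List.range N).filter P).length = ((List.range N).filter P).toFinset.card :=
    (List.toFinset_card_of_nodup (List.nodup_range.filter _)).symm
  rw [h1]
  have h2 : ((((List.range N).filter P).toFinset).image e) = Finset.range m := by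
    ext k
    simp only [Finset.mem_image, List.mem_toFinset, List.mem_filter, List.mem_range, Finset.mem_range]
    constructor
    · rintro ⟨j, ⟨hj, h⟩, rfl⟩
      exact (hP j hj).1 h
    · intro hk
      obtain ⟨j, hj, rfl⟩ := he.surjOn (show k ∈ Iio N from lt_of_lt_of_le hk hm)
      exact ⟨j, ⟨hj, (hP j hj).2 hk⟩, rfl⟩
  have h3 := Finset.card_image_of_injOn (s := ((List.range N).filter P).toFinset) (f := e) (by
    intro a ha b hb hab
    simp at ha hb
    exact he.injOn ha.1 hb.1 hab)
  rw [← h3, h2, Finset.card_range]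

theorem pp_core {d : ℕ → PinLetter} (hd : Alt d) (n : ℕ) :
    (pp d n).vals.length = n + 1 ∧ (pp d n).origin = cX d n 0 ∧
      (∀ i < n + 1, (pp d n).valAt (cX d n i) = cY d n i) ∧ BijOn (cX d n) (Iio (n+1)) (Iio (n+1)) := by
  have hv := pp_valid hd n
  have hL : (pp d n).vals.length = n + 1 := by
    have := pp_len hd n
    have h2 := hv.2.1
    unfold CPerm.len at this
    omega
  obtain ⟨E, hE, h0, hlt⟩ := (pp_models hd n).ext
  rw [hL] at hE
  set t : ℕ → Option ℕ := fun i => if i = 0 then none else some i with ht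
  have htm : ∀ i < n + 1, t i ∈ extSet (Icc 1 n) := by
    intro i hi
    by_cases h : i = 0
    · simp [ht, h, extSet]
    · simp [ht, h, extSet]; omega
  have hte : ∀ i, ext (cfg d) (t i) = cfg d i := by
    intro i
    by_cases h : i = 0
    · simp [ht, h, ext, cfg]
    · simp [ht, h, ext]
  set e : ℕ → ℕ := fun i => E (t i) with hedef
  have he : BijOn e (Iio (n+1)) (Iio (n+1)) := by
    refine ⟨fun i hi => hE.mapsTo (htm i hi), ?_, ?_⟩
    · intro i hi j hj h
      have := hE.injOn (htm i hi) (htm j hj) h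
      simp only [ht] at this
      split_ifs at this <;> simp_all
    · intro k hk
      obtain ⟨a, ha, rfl⟩ := hE.surjOn hk
      rcases ha with rfl | ⟨i, hi, rfl⟩
      · exact ⟨0, by simp, by simp [e, t]⟩
      · have h1 := hi.1
        have h2 := hi.2
        refine ⟨i, by simp; omega, ?_⟩
        have : i ≠ 0 := by omega
        simp [e, t, this]
  have hval : BijOn (fun i => (pp d n).valAt (e i)) (Iio (n+1)) (Iio (n+1)) := by
    have hm : MapsTo (fun i => (pp d n).valAt (e i)) (Iio (n+1)) (Iio (n+1)) := by
      intro i hi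
      have := valAt_lt hv (j := e i) (by rw [hL]; exact he.mapsTo hi)
      rwa [hL] at this
    have hi : InjOn (fun i => (pp d n).valAt (e i)) (Iio (n+1)) := by
      intro i hi j hj h
      exact he.injOn hi hj (valAt_inj hv (by rw [hL]; exact he.mapsTo hi) (by rw [hL]; exact he.mapsTo hj) h)
    refine ⟨hm, hi, (Set.eq_of_subset_of_ncard_le (mapsTo_iff_image_subset.1 hm) ?_ (finite_Iio _)).ge⟩
    rw [hi.ncard_image]
  have hX : ∀ i < n+1, cX d n i = e i := by
    intro i hi
    refine rank_eq he (le_of_lt (he.mapsTo hi)) _ fun j hj => ?_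
    have := (hlt _ (htm j hj) _ (htm i hi)).1
    rw [hte, hte] at this
    simpa using this
  have hY : ∀ i < n+1, cY d n i = (pp d n).valAt (e i) := by
    intro i hi
    refine rank_eq hval (le_of_lt (hval.mapsTo hi)) _ fun j hj => ?_
    have := (hlt _ (htm j hj) _ (htm i hi)).2
    rw [hte, hte] at this
    simpa using this
  have ho : (pp d n).origin = cX d n 0 := by
    rw [hX 0 (by omega), ← h0]; simp [e, t]
  refine ⟨hL, ho, fun i hi => by rw [hX i hi, hY i hi], ?_⟩
  exact he.congr fun i hi => (hX i hi).symm

theorem cperm_ext {p q : CPerm} (h1 : p.vals = q.vals) (h2 : p.origin = q.origin) : p = q := by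
  rcases p with ⟨a, b⟩; rcases q with ⟨c, e⟩
  simp at h1 h2; subst h1; subst h2; rfl

/-- A checkable description of the pin permutation. -/
def chk (d : ℕ → PinLetter) (n : ℕ) (p : CPerm) : Bool :=
  decide (p.vals.length = n + 1) && decide (p.origin = cX d n 0) &&
    (List.range (n+1)).all fun i => decide (p.valAt (cX d n i) = cY d n i)

theorem pp_of_chk {d : ℕ → PinLetter} (hd : Alt d) {n : ℕ} {p : CPerm} (h : chk d n p = true) : pp d n = p := by
  obtain ⟨hL, ho, hv, he⟩ := pp_core hd n
  simp only [chk, Bool.and_eq_true, decide_eq_true_eq, List.all_eq_true, List.mem_range] at h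
  obtain ⟨⟨h1, h2⟩, h3⟩ := h
  refine cperm_ext (List.ext_getElem (by rw [hL, h1]) ?_) (by rw [ho, h2])
  intro x hx hx'
  obtain ⟨i, hi, rfl⟩ := he.surjOn (show x ∈ Iio (n+1) by rw [hL] at hx; exact hx)
  have e1 := hv i hi
  have e2 := h3 i hi
  rw [CPerm.valAt, List.getD_eq_getElem _ _ hx] at e1
  rw [CPerm.valAt, List.getD_eq_getElem _ _ hx'] at e2
  rw [e1, e2]

theorem pp_eq_cp {d : ℕ → PinLetter} (hd : Alt d) (n : ℕ) : pp d n = cp d n := by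
  obtain ⟨hL, ho, hv, he⟩ := pp_core hd n
  refine cperm_ext (List.ext_getElem (by simp [hL, cp]) ?_) ho
  intro x hx hx'
  simp only [cp, List.getElem_map, List.getElem_range]
  obtain ⟨i, hi, rfl⟩ := he.surjOn (show x ∈ Iio (n+1) by rw [hL] at hx; exact hx)
  have hs : ((List.range (n+1)).map fun j => if cX d n j = cX d n i then cY d n j else 0).sum
      = ∑ j ∈ Finset.range (n+1), if cX d n j = cX d n i then cY d n j else 0 := by
    rw [Finset.sum_eq_multiset_sum, Finset.range_val, ← Multiset.coe_range, Multiset.map_coe, Multiset.sum_coe]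
  rw [hs, Finset.sum_eq_single i]
  · rw [if_pos rfl, ← hv i hi, CPerm.valAt, List.getD_eq_getElem _ _ hx]
  · intro j hj hji
    rw [if_neg]
    rw [Finset.mem_range] at hj
    exact fun h => hji (he.injOn hj hi h)
  · intro h; exact absurd (Finset.mem_range.2 hi) h

instance (t : ℕ) (d : ℕ → PinLetter) (n : ℕ) : Decidable (Fam t d n) := by
  unfold Fam; infer_instance

/-- Codes of the box-indecomposable pin words of length `n`. -/
def gk (n : ℕ) : List ℕ :=
  (List.range (2^(n+2))).filter fun k => decide (n ≤ 1 ∨ (¬ Fam 0 (seq k) n ∧ ¬ Fam 1 (seq k) n))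

def chkL (n : ℕ) : List ℕ → List CPerm → Bool
  | [], [] => true
  | k :: ks, p :: ps => chk (seq k) n p && chkL n ks ps
  | _, _ => false

theorem chkL_eq {n : ℕ} : ∀ {ks : List ℕ} {ps : List CPerm}, chkL n ks ps = true → ks.map (fun k => pp (seq k) n) = ps
  | [], [], _ => rfl
  | k :: ks, p :: ps, h => by
    simp only [chkL, Bool.and_eq_true] at h
    rw [List.map_cons, chkL_eq h.2, pp_of_chk (seq_alt k) h.1]
  | [], _ :: _, h => by simp [chkL] at h
  | _ :: _, [], h => by simp [chkL] at h

theorem ind_one {d : ℕ → PinLetter} (hd : Alt d) : BoxIndecomposable (pp d 1) := by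
  by_contra h
  obtain ⟨m, h1, h2, -⟩ := (dec_iff hd le_rfl).1 h
  omega

theorem cnt_GG_eq {n : ℕ} (hn : 1 ≤ n) {L : List CPerm} (hL : chkL n (gk n) L = true) :
    cnt GG CPerm.len n = L.dedup.length := by
  unfold cnt
  rw [← List.card_toFinset, ← Set.ncard_coe_finset, ← chkL_eq hL]
  congr 1
  ext p
  simp only [mem_ofPred_eq, mem_GG, gk, List.coe_toFinset, List.mem_map, List.mem_filter, List.mem_range,
    decide_eq_true_eq]
  constructor
  · rintro ⟨k, hk, hi, rfl⟩
    refine ⟨k, ⟨hk, ?_⟩, rfl⟩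
    by_cases h : n ≤ 1
    · exact Or.inl h
    · exact Or.inr ((ind_iff (seq_alt k) (by omega)).1 hi)
  · rintro ⟨k, ⟨hk, hi⟩, rfl⟩
    refine ⟨k, hk, ?_, rfl⟩
    by_cases h : n ≤ 1
    · obtain rfl : n = 1 := by omega
      exact ind_one (seq_alt k)
    · exact (ind_iff (seq_alt k) (by omega)).2 (hi.resolve_left h)

/-- The box-indecomposable pin permutations of length 1, in the order of their codes. -/
def tab1 : List CPerm := [
  ⟨[0, 1],1⟩, ⟨[0, 1],1⟩, ⟨[1, 0],0⟩, ⟨[1, 0],1⟩, ⟨[1, 0],1⟩, ⟨[1, 0],0⟩,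
  ⟨[0, 1],0⟩, ⟨[0, 1],0⟩]

theorem g1 : cnt GG CPerm.len 1 = 4 := by
  rw [cnt_GG_eq (L := tab1) (by norm_num) (by decide +kernel)]; decide +kernel

/-- The box-indecomposable pin permutations of length 2, in the order of their codes. -/
def tab2 : List CPerm := [
  ⟨[1, 0, 2],2⟩, ⟨[1, 0, 2],2⟩, ⟨[1, 2, 0],2⟩, ⟨[2, 0, 1],0⟩, ⟨[2, 0, 1],0⟩, ⟨[1, 2, 0],2⟩,
  ⟨[0, 2, 1],0⟩, ⟨[0, 2, 1],0⟩]

theorem g2 : cnt GG CPerm.len 2 = 4 := by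
  rw [cnt_GG_eq (L := tab2) (by norm_num) (by decide +kernel)]; decide +kernel

/-- The box-indecomposable pin permutations of length 3, in the order of their codes. -/
def tab3 : List CPerm := [
  ⟨[2, 0, 1, 3],3⟩, ⟨[1, 2, 0, 3],3⟩, ⟨[2, 0, 3, 1],2⟩, ⟨[1, 3, 0, 2],3⟩, ⟨[2, 0, 3, 1],3⟩, ⟨[1, 3, 0, 2],1⟩,
  ⟨[1, 3, 0, 2],1⟩, ⟨[2, 0, 3, 1],3⟩, ⟨[3, 1, 0, 2],0⟩, ⟨[2, 1, 3, 0],3⟩, ⟨[1, 3, 0, 2],0⟩, ⟨[2, 0, 3, 1],1⟩,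
  ⟨[1, 3, 0, 2],3⟩, ⟨[2, 0, 3, 1],2⟩, ⟨[1, 3, 2, 0],3⟩, ⟨[3, 0, 2, 1],0⟩, ⟨[1, 3, 0, 2],2⟩, ⟨[2, 0, 3, 1],0⟩,
  ⟨[2, 0, 3, 1],0⟩, ⟨[1, 3, 0, 2],2⟩, ⟨[2, 0, 3, 1],1⟩, ⟨[1, 3, 0, 2],0⟩, ⟨[0, 2, 3, 1],0⟩, ⟨[0, 3, 1, 2],0⟩]

theorem g3 : cnt GG CPerm.len 3 = 16 := by
  rw [cnt_GG_eq (L := tab3) (by norm_num) (by decide +kernel)]; decide +kernel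

/-- The box-indecomposable pin permutations of length 4, in the order of their codes. -/
def tab4 : List CPerm := [
  ⟨[1, 3, 0, 2, 4],4⟩, ⟨[2, 0, 3, 1, 4],4⟩, ⟨[1, 3, 0, 4, 2],3⟩, ⟨[2, 0, 4, 1, 3],4⟩, ⟨[1, 3, 0, 4, 2],4⟩,
  ⟨[2, 0, 4, 1, 3],2⟩, ⟨[1, 2, 4, 0, 3],2⟩, ⟨[3, 0, 1, 4, 2],4⟩, ⟨[1, 4, 2, 0, 3],1⟩, ⟨[3, 0, 2, 4, 1],4⟩,
  ⟨[1, 4, 2, 0, 3],2⟩, ⟨[3, 0, 2, 4, 1],2⟩, ⟨[3, 1, 4, 0, 2],4⟩, ⟨[3, 1, 4, 0, 2],2⟩, ⟨[3, 1, 4, 2, 0],4⟩,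
  ⟨[4, 1, 3, 0, 2],0⟩, ⟨[3, 1, 4, 0, 2],3⟩, ⟨[3, 1, 4, 0, 2],0⟩, ⟨[3, 0, 2, 4, 1],2⟩, ⟨[1, 4, 2, 0, 3],2⟩,
  ⟨[3, 2, 0, 4, 1],2⟩, ⟨[2, 4, 1, 0, 3],0⟩, ⟨[3, 0, 2, 4, 1],1⟩, ⟨[1, 4, 2, 0, 3],0⟩, ⟨[3, 0, 2, 4, 1],3⟩,
  ⟨[1, 4, 2, 0, 3],4⟩, ⟨[3, 0, 4, 2, 1],2⟩, ⟨[1, 4, 3, 0, 2],4⟩, ⟨[3, 0, 2, 4, 1],2⟩, ⟨[1, 4, 2, 0, 3],2⟩,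
  ⟨[2, 4, 0, 3, 1],1⟩, ⟨[2, 4, 0, 3, 1],4⟩, ⟨[4, 2, 0, 3, 1],0⟩, ⟨[2, 4, 1, 3, 0],4⟩, ⟨[2, 4, 0, 3, 1],0⟩,
  ⟨[2, 4, 0, 3, 1],2⟩, ⟨[1, 4, 2, 0, 3],2⟩, ⟨[3, 0, 2, 4, 1],2⟩, ⟨[1, 4, 2, 0, 3],3⟩, ⟨[3, 0, 2, 4, 1],0⟩,
  ⟨[1, 4, 0, 2, 3],2⟩, ⟨[2, 0, 3, 4, 1],0⟩, ⟨[2, 0, 4, 1, 3],0⟩, ⟨[1, 3, 0, 4, 2],2⟩, ⟨[2, 0, 4, 1, 3],1⟩,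
  ⟨[1, 3, 0, 4, 2],0⟩, ⟨[0, 2, 4, 1, 3],0⟩, ⟨[0, 3, 1, 4, 2],0⟩]

theorem g4 : cnt GG CPerm.len 4 = 42 := by
  rw [cnt_GG_eq (L := tab4) (by norm_num) (by decide +kernel)]; decide +kernel

/-- The box-indecomposable pin permutations of length 5, in the order of their codes. -/
def tab5 : List CPerm := [
  ⟨[2, 0, 4, 1, 3, 5],5⟩, ⟨[1, 3, 0, 4, 2, 5],5⟩, ⟨[2, 0, 4, 1, 5, 3],4⟩, ⟨[1, 3, 0, 5, 2, 4],5⟩, ⟨[2, 0, 4, 1, 5, 3],5⟩,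
  ⟨[1, 3, 0, 5, 2, 4],3⟩, ⟨[2, 0, 3, 5, 1, 4],3⟩, ⟨[1, 4, 0, 2, 5, 3],5⟩, ⟨[2, 0, 5, 3, 1, 4],2⟩, ⟨[1, 4, 0, 3, 5, 2],5⟩,
  ⟨[2, 0, 5, 3, 1, 4],3⟩, ⟨[1, 4, 0, 3, 5, 2],3⟩, ⟨[2, 0, 3, 5, 1, 4],2⟩, ⟨[1, 4, 0, 2, 5, 3],3⟩, ⟨[4, 0, 2, 5, 1, 3],5⟩,
  ⟨[1, 4, 2, 5, 0, 3],3⟩, ⟨[4, 0, 2, 5, 3, 1],4⟩, ⟨[1, 5, 2, 4, 0, 3],3⟩, ⟨[4, 0, 2, 5, 3, 1],5⟩, ⟨[1, 5, 2, 4, 0, 3],1⟩,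
  ⟨[4, 0, 2, 5, 1, 3],4⟩, ⟨[1, 4, 2, 5, 0, 3],1⟩, ⟨[4, 0, 1, 3, 5, 2],3⟩, ⟨[1, 2, 5, 3, 0, 4],3⟩, ⟨[4, 0, 3, 1, 5, 2],2⟩,
  ⟨[1, 3, 5, 2, 0, 4],3⟩, ⟨[4, 0, 3, 1, 5, 2],3⟩, ⟨[1, 3, 5, 2, 0, 4],1⟩, ⟨[4, 1, 3, 5, 0, 2],3⟩, ⟨[4, 1, 5, 2, 0, 3],5⟩,
  ⟨[4, 1, 5, 3, 0, 2],2⟩, ⟨[4, 1, 5, 3, 0, 2],5⟩, ⟨[4, 1, 5, 3, 0, 2],3⟩, ⟨[4, 1, 5, 3, 0, 2],3⟩, ⟨[4, 1, 3, 5, 0, 2],2⟩,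
  ⟨[4, 1, 5, 2, 0, 3],3⟩, ⟨[3, 5, 1, 4, 0, 2],1⟩, ⟨[4, 2, 5, 0, 3, 1],5⟩, ⟨[5, 3, 1, 4, 0, 2],0⟩, ⟨[4, 2, 5, 1, 3, 0],5⟩,
  ⟨[3, 5, 1, 4, 0, 2],0⟩, ⟨[4, 2, 5, 0, 3, 1],3⟩, ⟨[2, 5, 1, 3, 0, 4],3⟩, ⟨[4, 2, 0, 3, 5, 1],3⟩, ⟨[2, 5, 3, 1, 0, 4],2⟩,
  ⟨[4, 3, 0, 2, 5, 1],3⟩, ⟨[2, 5, 1, 3, 0, 4],2⟩, ⟨[4, 2, 0, 3, 5, 1],1⟩, ⟨[1, 3, 5, 2, 0, 4],1⟩, ⟨[4, 0, 3, 1, 5, 2],3⟩,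
  ⟨[3, 1, 5, 2, 0, 4],0⟩, ⟨[4, 1, 3, 0, 5, 2],3⟩, ⟨[3, 1, 5, 2, 0, 4],1⟩, ⟨[4, 1, 3, 0, 5, 2],1⟩, ⟨[1, 3, 5, 2, 0, 4],0⟩,
  ⟨[4, 0, 3, 1, 5, 2],1⟩, ⟨[1, 5, 3, 0, 2, 4],5⟩, ⟨[3, 0, 4, 2, 5, 1],4⟩, ⟨[1, 5, 3, 0, 4, 2],4⟩, ⟨[3, 0, 5, 2, 4, 1],4⟩,
  ⟨[1, 5, 3, 0, 4, 2],5⟩, ⟨[3, 0, 5, 2, 4, 1],2⟩, ⟨[1, 5, 3, 0, 2, 4],4⟩, ⟨[3, 0, 4, 2, 5, 1],2⟩, ⟨[1, 5, 2, 4, 0, 3],3⟩,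
  ⟨[4, 0, 2, 5, 3, 1],4⟩, ⟨[1, 5, 4, 2, 0, 3],3⟩, ⟨[4, 0, 3, 5, 2, 1],2⟩, ⟨[1, 5, 2, 4, 0, 3],2⟩, ⟨[4, 0, 2, 5, 3, 1],2⟩,
  ⟨[3, 5, 1, 4, 0, 2],5⟩, ⟨[4, 2, 5, 0, 3, 1],2⟩, ⟨[3, 5, 1, 4, 2, 0],5⟩, ⟨[5, 2, 4, 0, 3, 1],0⟩, ⟨[3, 5, 1, 4, 0, 2],4⟩,
  ⟨[4, 2, 5, 0, 3, 1],0⟩, ⟨[3, 5, 0, 2, 4, 1],3⟩, ⟨[2, 5, 3, 0, 4, 1],2⟩, ⟨[3, 5, 2, 0, 4, 1],2⟩, ⟨[3, 5, 2, 0, 4, 1],2⟩,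
  ⟨[3, 5, 2, 0, 4, 1],3⟩, ⟨[3, 5, 2, 0, 4, 1],0⟩, ⟨[3, 5, 0, 2, 4, 1],2⟩, ⟨[2, 5, 3, 0, 4, 1],0⟩, ⟨[3, 0, 4, 2, 5, 1],2⟩,
  ⟨[1, 5, 3, 0, 2, 4],4⟩, ⟨[3, 0, 4, 2, 5, 1],3⟩, ⟨[1, 5, 3, 0, 2, 4],2⟩, ⟨[3, 0, 2, 4, 5, 1],2⟩, ⟨[1, 5, 2, 0, 3, 4],2⟩,
  ⟨[2, 4, 0, 3, 5, 1],1⟩, ⟨[2, 5, 0, 3, 1, 4],4⟩, ⟨[4, 2, 0, 3, 5, 1],0⟩, ⟨[2, 5, 1, 3, 0, 4],4⟩, ⟨[4, 2, 0, 3, 5, 1],1⟩,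
  ⟨[2, 5, 1, 3, 0, 4],2⟩, ⟨[2, 4, 0, 3, 5, 1],0⟩, ⟨[2, 5, 0, 3, 1, 4],2⟩, ⟨[1, 4, 0, 2, 5, 3],3⟩, ⟨[2, 0, 3, 5, 1, 4],2⟩,
  ⟨[1, 4, 2, 0, 5, 3],2⟩, ⟨[3, 0, 2, 5, 1, 4],2⟩, ⟨[1, 4, 2, 0, 5, 3],3⟩, ⟨[3, 0, 2, 5, 1, 4],0⟩, ⟨[1, 4, 0, 2, 5, 3],2⟩,
  ⟨[2, 0, 3, 5, 1, 4],0⟩, ⟨[2, 0, 4, 1, 5, 3],0⟩, ⟨[1, 3, 0, 5, 2, 4],2⟩, ⟨[2, 0, 4, 1, 5, 3],1⟩, ⟨[1, 3, 0, 5, 2, 4],0⟩,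
  ⟨[0, 2, 4, 1, 5, 3],0⟩, ⟨[0, 3, 1, 5, 2, 4],0⟩]

theorem g5 : cnt GG CPerm.len 5 = 100 := by
  rw [cnt_GG_eq (L := tab5) (by norm_num) (by decide +kernel)]; decide +kernel

theorem g0 : cnt GG CPerm.len 0 = 0 := by
  have : {p | p ∈ GG ∧ CPerm.len p = 0} = ∅ := by
    ext p
    simp only [mem_ofPred_eq, mem_empty_iff_false, iff_false]
    rintro ⟨⟨-, h⟩, h0⟩
    have := h.1
    omega
  rw [cnt, this, ncard_empty]

theorem q0 (v w : PinLetter) : cnt (QQ v w) CPerm.len 0 = 0 := by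
  have : {p | p ∈ QQ v w ∧ CPerm.len p = 0} = ∅ := by
    ext p
    simp only [mem_ofPred_eq, mem_empty_iff_false, iff_false]
    rintro ⟨⟨⟨-, h⟩, -⟩, h0⟩
    have := h.1
    omega
  rw [cnt, this, ncard_empty]

theorem cnt_QQ_eq {v w : PinLetter} (h : v.isVert ≠ w.isVert) {n : ℕ} (hn : 1 ≤ n) :
    cnt (QQ v w) CPerm.len n = if cp (zig v w) n = cp (zig w v) n then 1 else 2 := by
  unfold cnt
  rw [mem_QQ h hn, pp_eq_cp (zig_alt h), pp_eq_cp (zig_alt h.symm)]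
  split_ifs with he
  · rw [he]; simp
  · exact Set.ncard_pair he

theorem q_all {v w : PinLetter} (h : v.isVert ≠ w.isVert) (n : ℕ) :
    cnt (QQ v w) CPerm.len n = if n = 0 then 0 else if n ≤ 2 then 1 else 2 := by
  rcases Nat.lt_or_ge n 6 with hn | hn
  · interval_cases n
    · simp [q0]
    all_goals
      rw [cnt_QQ_eq h (by norm_num)]
      revert h; revert v w
      intro v w; cases v <;> cases w <;> decide +kernel
  · rw [q_count h hn, if_neg (by omega), if_neg (by omega)]

theorem s0 : cnt SS CPerm.len 0 = 1 := by
  have : {p | p ∈ SS ∧ CPerm.len p = 0} = {CPerm.trivial} := by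
    ext p
    simp only [mem_ofPred_eq, mem_singleton_iff]
    constructor
    · rintro ⟨h, h0⟩
      exact len_zero h.valid h0
    · rintro rfl
      exact ⟨T.nil, rfl⟩
  rw [cnt, this, ncard_singleton]

end small
end PinAux

namespace PinAux
open PinLetter Set CPerm

section genfun
open PowerSeries

/-- Coefficients of the generating function of the class. -/
noncomputable def sa (n : ℕ) : ℝ := (CPerm.count CompletePinClass n : ℝ)

theorem sa_eq (n : ℕ) : sa n = (cnt SS CPerm.len n : ℝ) := by
  unfold sa CPerm.count cnt SS
  congr 2
  ext p
  simp only [mem_ofPred_eq, mem_class]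

theorem gen_rec :
    (mk sa) + (mk sa) * ((mk fun n => (cnt (QQ u r) CPerm.len n : ℝ)) * (mk fun n => (cnt (QQ PinLetter.d l) CPerm.len n : ℝ))
      + (mk fun n => (cnt (QQ u l) CPerm.len n : ℝ)) * (mk fun n => (cnt (QQ PinLetter.d r) CPerm.len n : ℝ)))
    = 1 + (mk sa) * (mk fun n => (cnt GG CPerm.len n : ℝ)) := by
  have fS := finite_len SS (fun p hp => T.valid hp)
  have fG := finite_len GG (fun p hp => T.valid hp.1)
  have fQ := fun v w => finite_len (QQ v w) (fun p hp => T.valid hp.1.1)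
  have e0 : (mk sa : PowerSeries ℝ) = mk fun n => (cnt SS CPerm.len n : ℝ) := by
    ext n; simp [sa_eq]
  have eG : (mk fun n => (cnt SS CPerm.len n : ℝ)) * (mk fun n => (cnt GG CPerm.len n : ℝ))
      = mk fun n => (cnt (SS ×ˢ GG) (fun x => x.1.len + x.2.len) n : ℝ) := by
    ext n
    rw [coeff_mul, coeff_mk, (cnt_prod (ℓ := CPerm.len) (ℓ' := CPerm.len) fS fG).2 n]
    simp [coeff_mk]
  have eQ : ∀ v w v' w', (mk fun n => (cnt (QQ v w) CPerm.len n : ℝ)) * (mk fun n => (cnt (QQ v' w') CPerm.len n : ℝ))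
      = mk fun n => (cnt (QQ v w ×ˢ QQ v' w') (fun x => x.1.len + x.2.len) n : ℝ) := by
    intro v w v' w'
    ext n
    rw [coeff_mul, coeff_mk, (cnt_prod (ℓ := CPerm.len) (ℓ' := CPerm.len) (fQ v w) (fQ v' w')).2 n]
    simp [coeff_mk]
  have eS : ∀ v w v' w', (mk fun n => (cnt SS CPerm.len n : ℝ)) *
      (mk fun n => (cnt (QQ v w ×ˢ QQ v' w') (fun x => x.1.len + x.2.len) n : ℝ))
      = mk fun n => (cnt (SS ×ˢ (QQ v w ×ˢ QQ v' w')) (fun x => x.1.len + (x.2.1.len + x.2.2.len)) n : ℝ) := by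
    intro v w v' w'
    ext n
    rw [coeff_mul, coeff_mk, (cnt_prod (ℓ := CPerm.len) (ℓ' := fun x : CPerm × CPerm => x.1.len + x.2.len) fS
      (cnt_prod (fQ v w) (fQ v' w')).1).2 n]
    simp [coeff_mk]
  rw [e0, eG, eQ, eQ, mul_add, eS, eS]
  ext n
  rcases Nat.eq_zero_or_pos n with rfl | hn
  · simp only [map_add, coeff_mk]
    have z1 : cnt (SS ×ˢ GG) (fun x => x.1.len + x.2.len) 0 = 0 := by
      rw [(cnt_prod (ℓ := CPerm.len) (ℓ' := CPerm.len) fS fG).2 0]; simp [g0]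
    have z2 : ∀ v w v' w', cnt (SS ×ˢ (QQ v w ×ˢ QQ v' w')) (fun x => x.1.len + (x.2.1.len + x.2.2.len)) 0 = 0 := by
      intro v w v' w'
      rw [(cnt_prod (ℓ := CPerm.len) (ℓ' := fun x : CPerm × CPerm => x.1.len + x.2.len) fS
        (cnt_prod (fQ v w) (fQ v' w')).1).2 0]
      have z3 : cnt (QQ v w ×ˢ QQ v' w') (fun x => x.1.len + x.2.len) 0 = 0 := by
        rw [(cnt_prod (ℓ := CPerm.len) (ℓ' := CPerm.len) (fQ v w) (fQ v' w')).2 0]; simp [q0]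
      simp [z3]
    rw [z1, z2, z2, s0]; simp
  · have := cnt_recurrence n hn
    have h1 : coeff n (1 : PowerSeries ℝ) = 0 := by rw [coeff_one, if_neg (by omega)]
    simp only [map_add, coeff_mk, h1]
    rw [zero_add]
    exact_mod_cast this

theorem co (a : ℕ → ℝ) (c : ℝ) (k n : ℕ) : coeff n (mk a * (C c * X ^ k)) = if k ≤ n then c * a (n-k) else 0 := by
  rw [mul_left_comm, coeff_C_mul, coeff_mul_X_pow']
  split_ifs <;> simp

theorem co' (c : ℝ) (k n : ℕ) : coeff n (C c * X ^ k : PowerSeries ℝ) = if n = k then c else 0 := by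
  rw [coeff_C_mul, coeff_X_pow]; split_ifs <;> simp

/-- Coefficients of the generating function of one-quadrant oscillations. -/
noncomputable def qa (n : ℕ) : ℝ := if n = 0 then 0 else if n ≤ 2 then 1 else 2

theorem q_gen : (mk qa) * (1 - X) = X + X ^ 3 := by
  have : (mk qa) * (1 - X) = mk qa * (C 1 * X^0) + mk qa * (C (-1) * X ^ 1) := by
    simp; ring
  rw [this]
  have : (X + X^3 : PowerSeries ℝ) = C 1 * X^1 + C 1 * X ^3 := by simp
  rw [this]
  ext n
  simp only [map_add, co, co']
  rcases Nat.lt_or_ge n 4 with h | h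
  · interval_cases n <;> norm_num [qa]
  · obtain ⟨m, rfl⟩ := Nat.exists_eq_add_of_le h
    rw [if_pos (by omega), if_pos (by omega), if_neg (by omega), if_neg (by omega)]
    unfold qa
    rw [if_neg (by omega), if_neg (by omega), if_neg (by omega), if_neg (by omega)]
    norm_num

theorem g_gen : (mk fun n => (cnt GG CPerm.len n : ℝ)) * ((1 - X) * (1 - 2 * X)) =
    4 * X - 8 * X^2 + 12 * X^3 + 2 * X^4 + 6 * X^5 + 16 * X^6 - 8 * X^7 := by
  set a : ℕ → ℝ := fun n => (cnt GG CPerm.len n : ℝ) with ha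
  have C2 : (2 : PowerSeries ℝ) = C 2 := (map_ofNat C 2).symm
  have hs : (mk a) * ((1 - X) * (1 - 2 * X)) =
      mk a * (C 1 * X^0) + mk a * (C (-3) * X ^ 1) + mk a * (C 2 * X^2) := by
    have : (C (-3) : PowerSeries ℝ) = -3 := by rw [map_neg, map_ofNat]
    rw [this, map_one, map_ofNat]; ring
  have hr : (4 * X - 8 * X^2 + 12 * X^3 + 2 * X^4 + 6 * X^5 + 16 * X^6 - 8 * X^7 : PowerSeries ℝ) =
      C 4 * X ^ 1 + C (-8) * X^2 + C 12 * X^3 + C 2 * X^4 + C 6 * X^5 + C 16 * X^6 + C (-8) * X^7 := by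
    simp only [map_neg, map_ofNat]; ring
  rw [hs, hr]
  have a0 : a 0 = 0 := by simp [ha, g0]
  have a1 : a 1 = 4 := by simp [ha, g1]
  have a2 : a 2 = 4 := by simp [ha, g2]
  have a3 : a 3 = 16 := by simp [ha, g3]
  have a4 : a 4 = 42 := by simp [ha, g4]
  have a5 : a 5 = 100 := by simp [ha, g5]
  have ab : ∀ m, a (m+6) = 256 * 2^m - 24 := by
    intro m
    have := g_count (n := m+6) (by omega)
    have h2 : (cnt GG CPerm.len (m+6) : ℝ) + 24 = 2 ^ (m+6+2) := by exact_mod_cast this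
    have : a (m+6) = 2^(m+6+2) - 24 := by rw [ha]; linarith
    rw [this]; ring
  ext n
  simp only [map_add, co, co']
  rcases Nat.lt_or_ge n 8 with h | h
  · have a6 := ab 0
    have a7 := ab 1
    norm_num at a6 a7
    interval_cases n <;> norm_num [a0, a1, a2, a3, a4, a5, a6, a7]
  · obtain ⟨m, rfl⟩ := Nat.exists_eq_add_of_le h
    have e1 : 8 + m - 0 = (m + 2) + 6 := by omega
    have e2 : 8 + m - 1 = (m + 1) + 6 := by omega
    have e3 : 8 + m - 2 = m + 6 := by omega
    rw [if_pos (by omega), if_pos (by omega), if_pos (by omega), e1, e2, e3, ab, ab, ab]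
    repeat rw [if_neg (by omega)]
    ring

theorem gen_fun : (mk sa) * (1 - 8 * X + 19 * X^2 - 26 * X^3 + 14 * X^4 - 12 * X^5 - 8 * X^6 + 20 * X^7 - 8 * X^8)
    = (1 - X)^2 * (1 - 2 * X) := by
  have h := gen_rec
  have hq : ∀ v w : PinLetter, v.isVert ≠ w.isVert → (mk fun n => (cnt (QQ v w) CPerm.len n : ℝ)) = mk qa := by
    intro v w hvw
    ext n
    rw [coeff_mk, coeff_mk, q_all hvw, qa]
    split_ifs <;> simp
  rw [hq _ _ (by decide), hq _ _ (by decide), hq _ _ (by decide), hq _ _ (by decide)] at h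
  have hg := g_gen
  have hq := q_gen
  set F := (mk sa : PowerSeries ℝ)
  set q := (mk qa : PowerSeries ℝ)
  set g : PowerSeries ℝ := (mk fun n => (cnt GG CPerm.len n : ℝ))
  linear_combination (1 - X)^2 * (1 - 2 * X) * h + F * (1 - X) * hg
    - 2 * F * (1 - 2*X) * (q * (1 - X) + (X + X^3)) * hq

end genfun
end PinAux

namespace PinAux
section growth
open Filter Topology Set

/-- Growth of a sequence satisfying a renewal equation. -/
theorem growth {a G : ℕ → ℝ} (hG : ∀ n, 0 ≤ G n) (hG0 : G 0 = 0) (hG1 : 1 ≤ G 1) (h0 : a 0 = 1)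
    (hr : ∀ n, 1 ≤ n → a n = ∑ k ∈ Finset.range (n+1), G k * a (n-k))
    {α : ℝ} (hα : 0 < α) (hα1 : α < 1) (hs : HasSum (fun k => G k * α ^ k) 1) :
    Tendsto (fun n : ℕ => (a n) ^ ((n : ℝ)⁻¹)) atTop (𝓝 α⁻¹) := by
  have a1 : ∀ n, 1 ≤ a n := by
    intro n
    induction n using Nat.strong_induction_on with
    | _ n ih =>
      rcases Nat.eq_zero_or_pos n with rfl | hn
      · exact h0.ge
      rw [hr n hn]
      have hnn : ∀ k ∈ Finset.range (n+1), 0 ≤ G k * a (n-k) := by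
        intro k _
        rcases Nat.eq_zero_or_pos k with rfl | hk
        · simp [hG0]
        · exact mul_nonneg (hG k) (zero_le_one.trans (ih _ (by omega)))
      refine le_trans ?_ (Finset.single_le_sum hnn (Finset.mem_range.2 (show 1 < n+1 by omega)))
      have := ih (n-1) (by omega)
      nlinarith
  have an : ∀ n, 0 ≤ a n := fun n => zero_le_one.trans (a1 n)
  have up : ∀ n, a n * α ^ n ≤ 1 := by
    intro n
    induction n using Nat.strong_induction_on with
    | _ n ih =>
      rcases Nat.eq_zero_or_pos n with rfl | hn
      · simp [h0]
      rw [hr n hn, Finset.sum_mul]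
      calc _ ≤ ∑ k ∈ Finset.range (n+1), G k * α ^ k := by
            apply Finset.sum_le_sum
            intro k hk
            rw [Finset.mem_range] at hk
            rcases Nat.eq_zero_or_pos k with rfl | hk0
            · simp [hG0]
            have := ih (n-k) (by omega)
            have e : α ^ n = α ^ k * α ^ (n-k) := by rw [← pow_add]; congr 1; omega
            calc _ = (G k * α ^ k) * (a (n-k) * α ^ (n-k)) := by rw [e]; ring
              _ ≤ (G k * α ^ k) * 1 := mul_le_mul_of_nonneg_left this (mul_nonneg (hG k) (by positivity))
              _ = _ := mul_one _
        _ ≤ 1 := sum_le_hasSum _ (fun k _ => mul_nonneg (hG k) (by positivity)) hs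
  have low : ∀ x, α < x → x < 1 → ∃ K : ℕ, ∀ n, x ^ K ≤ a n * x ^ n := by
    intro x hx hx1
    have hx0 : 0 < x := hα.trans hx
    have ht := hs.tendsto_sum_nat
    have hev : ∀ᶠ N in atTop, 1 - (x - α) < ∑ k ∈ Finset.range N, G k * α ^ k :=
      ht.eventually (lt_mem_nhds (by linarith))
    obtain ⟨N, hN, hN2⟩ := (hev.and (eventually_ge_atTop 2)).exists
    have hsum : 1 ≤ ∑ k ∈ Finset.range N, G k * x ^ k := by
      have hd : G 1 * x ^ 1 - G 1 * α ^ 1 ≤ ∑ k ∈ Finset.range N, (G k * x ^ k - G k * α ^ k) := by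
        refine Finset.single_le_sum (f := fun k => G k * x ^ k - G k * α ^ k) ?_ (Finset.mem_range.2 (by omega))
        intro k _
        have : α ^ k ≤ x ^ k := pow_le_pow_left₀ hα.le hx.le k
        have := mul_le_mul_of_nonneg_left this (hG k)
        simpa using this
      rw [Finset.sum_sub_distrib] at hd
      have : x - α ≤ G 1 * x ^ 1 - G 1 * α ^ 1 := by
        rw [pow_one, pow_one]; nlinarith
      linarith
    refine ⟨N, fun n => ?_⟩
    induction n using Nat.strong_induction_on with
    | _ n ih =>
      rcases Nat.lt_or_ge n N with h | h
      · calc x ^ N ≤ x ^ n := pow_le_pow_of_le_one hx0.le hx1.le h.le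
          _ ≤ a n * x ^ n := le_mul_of_one_le_left (by positivity) (a1 n)
      · rw [hr n (by omega), Finset.sum_mul]
        calc x ^ N ≤ (∑ k ∈ Finset.range N, G k * x ^ k) * x ^ N := le_mul_of_one_le_left (by positivity) hsum
          _ = ∑ k ∈ Finset.range N, G k * x ^ k * x ^ N := Finset.sum_mul ..
          _ ≤ ∑ k ∈ Finset.range N, G k * a (n-k) * x ^ n := by
            apply Finset.sum_le_sum
            intro k hk
            rw [Finset.mem_range] at hk
            rcases Nat.eq_zero_or_pos k with rfl | hk0
            · simp [hG0]
            have := ih (n-k) (by omega)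
            have e : x ^ n = x ^ k * x ^ (n-k) := by rw [← pow_add]; congr 1; omega
            calc _ ≤ (G k * x ^ k) * (a (n-k) * x ^ (n-k)) :=
                  mul_le_mul_of_nonneg_left this (mul_nonneg (hG k) (by positivity))
              _ = _ := by rw [e]; ring
          _ ≤ _ := by
            apply Finset.sum_le_sum_of_subset_of_nonneg
            · intro k; simp only [Finset.mem_range]; omega
            · intro k _ _
              exact mul_nonneg (mul_nonneg (hG k) (an _)) (by positivity)
  rw [tendsto_order]
  constructor
  · intro b hb
    have hc : ContinuousAt (fun x : ℝ => x⁻¹) α := continuousAt_inv₀ hα.ne'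
    have he : ∀ᶠ x in 𝓝[>] α, b < x⁻¹ ∧ x < 1 :=
      ((hc.eventually (lt_mem_nhds hb)).and (gt_mem_nhds hα1)).filter_mono nhdsWithin_le_nhds
    obtain ⟨x, ⟨hxb, hx1⟩, hx⟩ := (he.and self_mem_nhdsWithin).exists
    have hx : α < x := hx
    have hx0 : 0 < x := hα.trans hx
    obtain ⟨K, hK⟩ := low x hx hx1
    have hlim : Tendsto (fun n : ℕ => (x ^ K) ^ ((n : ℝ)⁻¹) * x⁻¹) atTop (𝓝 x⁻¹) := by
      have h1 : Tendsto (fun n : ℕ => (x ^ K) ^ ((n : ℝ)⁻¹)) atTop (𝓝 ((x ^ K) ^ (0:ℝ))) :=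
        ((Real.continuous_const_rpow (by positivity)).tendsto 0).comp (tendsto_inv_atTop_nhds_zero_nat (𝕜 := ℝ))
      rw [Real.rpow_zero] at h1
      simpa using h1.mul_const x⁻¹
    filter_upwards [hlim.eventually (lt_mem_nhds hxb), eventually_ge_atTop 1] with n hn hn1
    refine lt_of_lt_of_le hn ?_
    have e : x⁻¹ = ((x⁻¹) ^ n) ^ ((n : ℝ)⁻¹) := (Real.pow_rpow_inv_natCast (by positivity) (by omega)).symm
    rw [e, ← Real.mul_rpow (by positivity) (by positivity)]
    refine Real.rpow_le_rpow (by positivity) ?_ (by positivity)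
    rw [inv_pow, ← div_eq_mul_inv, div_le_iff₀ (by positivity)]
    exact hK n
  · intro b hb
    filter_upwards [eventually_ge_atTop 1] with n hn1
    refine lt_of_le_of_lt ?_ hb
    have e : α⁻¹ = ((α⁻¹) ^ n) ^ ((n : ℝ)⁻¹) := (Real.pow_rpow_inv_natCast (by positivity) (by omega)).symm
    rw [e]
    refine Real.rpow_le_rpow (an n) ?_ (by positivity)
    rw [inv_pow, ← one_div, le_div_iff₀ (by positivity)]
    exact up n

/-- Coefficients of the generating function of the box-indecomposables, corrected for commutation. -/
noncomputable def gc (n : ℕ) : ℝ :=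
  4 * 2 ^ n - 8 * n + (if n = 0 then -4 else if n = 1 then 4 else if n = 2 then 2 else if n = 3 then 4
    else if n = 5 then -4 else 0)

theorem gc_big (m : ℕ) : gc (m + 6) = 256 * 2 ^ m - 8 * m - 48 := by
  unfold gc
  repeat rw [if_neg (by omega)]
  push_cast; ring

theorem gc_nonneg (n : ℕ) : 0 ≤ gc n := by
  rcases Nat.lt_or_ge n 6 with h | h
  · interval_cases n <;> norm_num [gc]
  · obtain ⟨m, rfl⟩ := Nat.exists_eq_add_of_le' h
    rw [gc_big]
    have : (m : ℝ) < 2 ^ m := by exact_mod_cast Nat.lt_two_pow_self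
    have h1 : (1:ℝ) ≤ 2 ^ m := one_le_pow₀ (by norm_num)
    linarith

open PowerSeries in
theorem gc_gen : (mk gc) * ((1 - X)^2 * (1 - 2 * X)) =
    4 * X - 14 * X^2 + 24 * X^3 - 14 * X^4 + 12 * X^5 + 8 * X^6 - 20 * X^7 + 8 * X^8 := by
  have hs : (mk gc) * ((1 - X)^2 * (1 - 2 * X)) =
      mk gc * (C 1 * X^0) + mk gc * (C (-4) * X ^ 1) + mk gc * (C 5 * X^2) + mk gc * (C (-2) * X^3) := by
    simp only [map_neg, map_ofNat, map_one]; ring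
  have hr : (4 * X - 14 * X^2 + 24 * X^3 - 14 * X^4 + 12 * X^5 + 8 * X^6 - 20 * X^7 + 8 * X^8 : PowerSeries ℝ) =
      C 4 * X ^ 1 + C (-14) * X^2 + C 24 * X^3 + C (-14) * X^4 + C 12 * X^5 + C 8 * X^6 + C (-20) * X^7 + C 8 * X^8 := by
    simp only [map_neg, map_ofNat]; ring
  rw [hs, hr]
  ext n
  simp only [map_add, co, co']
  rcases Nat.lt_or_ge n 9 with h | h
  · interval_cases n <;> norm_num [gc]
  · obtain ⟨m, rfl⟩ := Nat.exists_eq_add_of_le h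
    have e1 : 9 + m - 0 = (m + 3) + 6 := by omega
    have e2 : 9 + m - 1 = (m + 2) + 6 := by omega
    have e3 : 9 + m - 2 = (m + 1) + 6 := by omega
    have e4 : 9 + m - 3 = m + 6 := by omega
    rw [if_pos (by omega), if_pos (by omega), if_pos (by omega), if_pos (by omega), e1, e2, e3, e4,
      gc_big, gc_big, gc_big, gc_big]
    repeat rw [if_neg (by omega)]
    push_cast
    ring

open PowerSeries in
theorem sa_gc : (mk sa) * (1 - mk gc) = 1 := by
  have h1 := gen_fun
  have h2 := gc_gen
  have hne : ((1 - X)^2 * (1 - 2 * X) : PowerSeries ℝ) ≠ 0 := by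
    intro h
    have := congrArg (constantCoeff (R := ℝ)) h
    simp at this
  apply mul_right_cancel₀ hne
  linear_combination h1 - mk sa * h2

open PowerSeries in
theorem sa_zero : sa 0 = 1 := by
  rw [sa_eq, s0]; simp

open PowerSeries in
theorem sa_rec (n : ℕ) (hn : 1 ≤ n) : sa n = ∑ k ∈ Finset.range (n+1), gc k * sa (n-k) := by
  have h : mk sa = 1 + mk gc * mk sa := by linear_combination sa_gc
  have := congrArg (coeff n) h
  rw [map_add, coeff_mk, coeff_one, if_neg (by omega), zero_add, coeff_mul,
    Finset.Nat.sum_antidiagonal_eq_sum_range_succ_mk] at this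
  simpa [coeff_mk] using this

theorem gc_sum {α : ℝ} (hα : 0 < α) (hα2 : α < 1/2)
    (hr : 1 - 8 * α + 19 * α ^ 2 - 26 * α ^ 3 + 14 * α ^ 4 - 12 * α ^ 5 - 8 * α ^ 6 +
          20 * α ^ 7 - 8 * α ^ 8 = 0) : HasSum (fun k => gc k * α ^ k) 1 := by
  have s1 : HasSum (fun n : ℕ => (2 * α) ^ n) (1 - 2 * α)⁻¹ :=
    hasSum_geometric_of_lt_one (by linarith) (by linarith)
  have s2 : HasSum (fun n : ℕ => (n : ℝ) * α ^ n) (α / (1 - α) ^ 2) :=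
    hasSum_coe_mul_geometric_of_norm_lt_one (by rw [Real.norm_eq_abs, abs_of_pos hα]; linarith)
  set c : ℕ → ℝ := fun n => (if n = 0 then -4 else if n = 1 then 4 else if n = 2 then 2 else if n = 3 then 4
    else if n = 5 then -4 else 0) * α ^ n with hc
  have s3 : HasSum c (∑ n ∈ Finset.range 6, c n) := by
    apply hasSum_sum_of_ne_finset_zero
    intro n hn
    simp only [Finset.mem_range, not_lt] at hn
    simp only [hc]
    repeat rw [if_neg (by omega)]
    ring
  have s := ((s1.mul_left 4).sub (s2.mul_left 8)).add s3
  have hf : (fun k => gc k * α ^ k) = fun n : ℕ => 4 * (2 * α) ^ n - 8 * ((n : ℝ) * α ^ n) + c n := by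
    funext n
    simp only [gc, hc, mul_pow]; ring
  rw [hf]
  suffices he : 1 = 4 * (1 - 2 * α)⁻¹ - 8 * (α / (1 - α) ^ 2) + ∑ n ∈ Finset.range 6, c n by
    rw [he]; exact s
  simp only [Finset.sum_range_succ, Finset.sum_range_zero, hc]
  norm_num
  have h1 : (1 - 2 * α) ≠ 0 := by linarith
  have h2 : (1 - α) ≠ 0 := by linarith
  field_simp
  linear_combination hr

theorem growth_main {α : ℝ} (hα : 0 < α)
    (hr : 1 - 8 * α + 19 * α ^ 2 - 26 * α ^ 3 + 14 * α ^ 4 - 12 * α ^ 5 - 8 * α ^ 6 +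
          20 * α ^ 7 - 8 * α ^ 8 = 0)
    (hmin : ∀ β : ℝ, 0 < β →
        1 - 8 * β + 19 * β ^ 2 - 26 * β ^ 3 + 14 * β ^ 4 - 12 * β ^ 5 - 8 * β ^ 6 +
            20 * β ^ 7 - 8 * β ^ 8 = 0 → α ≤ β) :
    Tendsto (fun n : ℕ => (sa n) ^ ((n : ℝ)⁻¹)) atTop (𝓝 α⁻¹) := by
  have hlt : α ≤ 1/5 := by
    let P : ℝ → ℝ := fun β => 1 - 8 * β + 19 * β ^ 2 - 26 * β ^ 3 + 14 * β ^ 4 - 12 * β ^ 5 - 8 * β ^ 6 +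
            20 * β ^ 7 - 8 * β ^ 8
    have hP : Continuous P := by fun_prop
    have := intermediate_value_Icc' (a := (0:ℝ)) (b := 1/5) (by norm_num) hP.continuousOn
    obtain ⟨β, hβ, h0⟩ := this (show (0:ℝ) ∈ Icc (P (1/5)) (P 0) by constructor <;> norm_num [P])
    have : β ≠ 0 := by rintro rfl; norm_num [P] at h0
    exact (hmin β (lt_of_le_of_ne hβ.1 this.symm) h0).trans hβ.2
  exact growth gc_nonneg (by norm_num [gc]) (by norm_num [gc]) sa_zero sa_rec hα (by linarith)
    (gc_sum hα (by linarith) hr)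

end growth
end PinAux

open Filter PowerSeries

/-- The centred complete pin class `P°` has generating
function `(1−z)²(1−2z)/(1 − 8z + 19z² − 26z³ + 14z⁴ − 12z⁵ − 8z⁶ + 20z⁷ − 8z⁸)`,
and its growth rate `ω_∞ ≈ 5.24112` is the reciprocal of the smallest
positive real root of the denominator. -/
theorem complete_pin_class_genfun_and_growth :
    (PowerSeries.mk fun n => (CPerm.count CompletePinClass n : ℝ)) *
        (1 - 8 * (PowerSeries.X : PowerSeries ℝ) + 19 * PowerSeries.X ^ 2 -
          26 * PowerSeries.X ^ 3 + 14 * PowerSeries.X ^ 4 - 12 * PowerSeries.X ^ 5 -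
          8 * PowerSeries.X ^ 6 + 20 * PowerSeries.X ^ 7 - 8 * PowerSeries.X ^ 8) =
      (1 - (PowerSeries.X : PowerSeries ℝ)) ^ 2 * (1 - 2 * PowerSeries.X) ∧
    ∀ α : ℝ, 0 < α →
      1 - 8 * α + 19 * α ^ 2 - 26 * α ^ 3 + 14 * α ^ 4 - 12 * α ^ 5 - 8 * α ^ 6 +
          20 * α ^ 7 - 8 * α ^ 8 = 0 →
      (∀ β : ℝ, 0 < β →
        1 - 8 * β + 19 * β ^ 2 - 26 * β ^ 3 + 14 * β ^ 4 - 12 * β ^ 5 - 8 * β ^ 6 +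
            20 * β ^ 7 - 8 * β ^ 8 = 0 → α ≤ β) →
      Tendsto (fun n : ℕ => ((CPerm.count CompletePinClass n : ℝ)) ^ ((n : ℝ)⁻¹))
        atTop (nhds α⁻¹) := by
  exact ⟨PinAux.gen_fun, fun α hα hr hmin => PinAux.growth_main hα hr hmin⟩
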